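/- Let n ≥ 3 and let φ, f, S, X_0, X_m and Φ_0^m be as described in the context. Then for every integer m ≥ 1 and every integer ñ with 1 ≤ ñ ≤ n−1, there do not exist a simple-ñ-od graph T with branch point s_0 and simplicial maps α : X_m → T and β : T → X_0 such that β ∘ α = Φ_0^m and β(s_0) = v_0. -/

import Mathlib

/-! ## Graphs (geometric realizations of finite connected 1-complexes) -/

/-- The data of a graph structure on a space `G`: a finite vertex set and
finitely many parametrized edges. -/
structure GraphData (G : Type*) where
  verts : Finset G
  nE : ℕ
  edge : Fin nE → ℝ → G

namespace GraphData

variable {G : Type*}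

/-- Two vertices are adjacent if they are joined by an edge. -/
def Adj (Γ : GraphData G) (v w : G) : Prop :=
  ∃ e, ({Γ.edge e 0, Γ.edge e 1} : Set G) = {v, w}

/-- The axioms making `Γ` an actual graph (a finite connected one-dimensional
simplicial complex realized in `G`): each edge is an arc (parametrized by `[0,1]`)
joining two distinct vertices, open edges avoid the vertices, the edges cover `G`,
two distinct edges meet only in vertices, and an edge is determined by its
endpoints. -/
def IsGraph [TopologicalSpace G] (Γ : GraphData G) : Prop :=
  (∀ e, ContinuousOn (Γ.edge e) (Set.Icc 0 1)) ∧
  (∀ e, Set.InjOn (Γ.edge e) (Set.Icc 0 1)) ∧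
  (∀ e, Γ.edge e 0 ∈ Γ.verts) ∧
  (∀ e, Γ.edge e 1 ∈ Γ.verts) ∧
  (∀ e, Γ.edge e 0 ≠ Γ.edge e 1) ∧
  (∀ e, ∀ t ∈ Set.Ioo (0:ℝ) 1, Γ.edge e t ∉ (Γ.verts : Set G)) ∧
  (⋃ e, Γ.edge e '' Set.Icc 0 1) = Set.univ ∧
  (∀ e e', e ≠ e' →
    (Γ.edge e '' Set.Icc 0 1) ∩ (Γ.edge e' '' Set.Icc 0 1) ⊆ (Γ.verts : Set G)) ∧
  (∀ e e', ({Γ.edge e 0, Γ.edge e 1} : Set G) = {Γ.edge e' 0, Γ.edge e' 1} → e = e')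

end GraphData

/-- A simplicial map between graphs: continuous, vertices to vertices, and each
edge is mapped either onto a vertex or, affinely with respect to the fixed
parametrizations, onto an edge. -/
def IsSimplicialMap {G H : Type*} [TopologicalSpace G] [TopologicalSpace H]
    (Γ : GraphData G) (Δ : GraphData H) (φ : G → H) : Prop :=
  Continuous φ ∧ (∀ v ∈ Γ.verts, φ v ∈ Δ.verts) ∧
  ∀ e, (∃ w ∈ Δ.verts, ∀ t ∈ Set.Icc (0:ℝ) 1, φ (Γ.edge e t) = w) ∨
    ∃ e', (∀ t ∈ Set.Icc (0:ℝ) 1, φ (Γ.edge e t) = Δ.edge e' t) ∨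
          (∀ t ∈ Set.Icc (0:ℝ) 1, φ (Γ.edge e t) = Δ.edge e' (1 - t))

/-- `Γ` is a simple-`m`-od graph with branch point `t₀` and arms given by the
vertex paths `⟨t₀, t i 1, …, t i (k i)⟩` (`i < m`): the arms are nondegenerate,
pairwise meet exactly in `t₀`, exhaust the vertices, and two vertices are
adjacent exactly when they are consecutive on an arm. -/
def IsSimpleOdWith {G : Type*} [TopologicalSpace G] (Γ : GraphData G) (m : ℕ) (t₀ : G)
    (k : Fin m → ℕ) (t : Fin m → ℕ → G) : Prop :=
  Γ.IsGraph ∧ (∀ i, 1 ≤ k i) ∧ (∀ i, t i 0 = t₀) ∧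
  ((Γ.verts : Set G) = {t₀} ∪ {x | ∃ i j, 1 ≤ j ∧ j ≤ k i ∧ x = t i j}) ∧
  (∀ i j i' j', 1 ≤ j → j ≤ k i → 1 ≤ j' → j' ≤ k i' → t i j = t i' j' →
    i = i' ∧ j = j') ∧
  (∀ i j, 1 ≤ j → j ≤ k i → t i j ≠ t₀) ∧
  (∀ v w, Γ.Adj v w ↔ ∃ i j, j + 1 ≤ k i ∧ ({v, w} : Set G) = {t i j, t i (j + 1)})

/-- `Γ` is a simple-`m`-od graph with branch point `t₀`. -/
def IsSimpleOdGraphData {G : Type*} [TopologicalSpace G] (Γ : GraphData G) (m : ℕ)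
    (t₀ : G) : Prop :=
  ∃ k t, IsSimpleOdWith Γ m t₀ k t

/-- Composite bonding maps `Φ_i^{i+k} : X (i+k) → X i` of an inverse sequence. -/
def bondIter {X : ℕ → Type*} (Φ : ∀ i, X (i + 1) → X i) (i : ℕ) :
    ∀ k : ℕ, X (i + k) → X i
  | 0 => id
  | k + 1 => fun x => bondIter Φ i k (Φ (i + k) x)

/-- The inverse limit of an inverse sequence of spaces. -/
def InvLimit {X : ℕ → Type*} (Φ : ∀ i, X (i + 1) → X i) : Type _ :=
  {x : ∀ i, X i // ∀ i, Φ i (x (i + 1)) = x i}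

instance {X : ℕ → Type*} [∀ i, TopologicalSpace (X i)] (Φ : ∀ i, X (i + 1) → X i) :
    TopologicalSpace (InvLimit Φ) :=
  instTopologicalSpaceSubtype
/-! ## The simple-`n`-od `S`, the bonding map `φ = nφ`, and the continuum `nK` -/

noncomputable section

/-- Arm-coordinate parametrization of the simple-`n`-od in `ℂ`: the pair `(k, t)`
is sent to the point at (clamped) parameter `t ∈ [0,1]` on the ray in the
direction `e^{2πik/n}`. -/
def embC (n : ℕ) (p : ℕ × ℝ) : ℂ :=
  ((min 1 (max 0 p.2) : ℝ) : ℂ) * Complex.exp (2 * Real.pi * Complex.I * (p.1 : ℂ) / (n : ℂ))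

/-- The underlying simple-`n`-od `S ⊆ ℂ`. -/
def Sset (n : ℕ) : Set ℂ := Set.range (embC n)

/-- The simple-`n`-od `S` as a (compact metric) space. -/
abbrev Sspace (n : ℕ) := ↥(Sset n)

/-- Arm coordinates `(ray index, parameter)` of the vertices `v_0, …, v_{n+2}`
of the graph `X_0`:  `v_0` is the branch point; for `1 ≤ i ≤ n-2`, `v_i` is the tip
of ray `i - 1`; `v_{n-1}` and `v_{n+1}` are the midpoint and tip of ray `n - 2`;
`v_n` and `v_{n+2}` are the midpoint and tip of ray `n - 1`. -/
def vcoord (n i : ℕ) : ℕ × ℝ :=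
  if i = 0 then (0, 0)
  else if i ≤ n - 2 then (i - 1, 1)
  else if i = n - 1 then (n - 2, 1 / 2)
  else if i = n then (n - 1, 1 / 2)
  else if i = n + 1 then (n - 2, 1)
  else (n - 1, 1)

/-- The vertex `v_i` of `X_0` as a point of `S`. -/
def vpt (n i : ℕ) : Sspace n := ⟨embC n (vcoord n i), Set.mem_range_self _⟩

/-- The branch point `v_0` of `S`. -/
def centerPt (n : ℕ) : Sspace n := vpt n 0

/-- Affine interpolation, in arm coordinates, between two adjacent vertices of
`X_0` (they lie on a common ray; if one of them is the branch point, the ray of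
the other one is used). -/
def interpC (w w' : ℕ × ℝ) (s : ℝ) : ℕ × ℝ :=
  (if w.2 = 0 then w'.1 else w.1, (1 - s) * w.2 + s * w'.2)

/-- Arm coordinates of the `φ`-image of the `j`-th vertex of `X_1` (counted from
`v_0` outwards) on the `a`-th arm of `X_1` (`1 ≤ a ≤ n`), following the defining
table of `φ = nφ`:

* arm `a ≤ n - 3` has vertices `v_0, u_a, u_{(n-3)+a}, …, u_{2(n-1)(n-3)+a}, v_a`;
* arm `n - 2` has vertices `v_0, u_{(2n-1)(n-3)+2(n-1)+1}, v_{n-2}`;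
* arm `n - 1` has vertices `v_0, u_{(2n-1)(n-3)+2(n-1)+2}, u_{(2n-1)(n-3)+2(n-1)+3},
  v_{n-1}, v_{n+1}`;
* arm `n` has vertices `v_0, u_{(2n-1)(n-3)+1}, …, u_{(2n-1)(n-3)+2(n-1)}, v_n, v_{n+2}`. -/
def imgCoord (n a j : ℕ) : ℕ × ℝ :=
  if a = n then
    (if j = 0 then vcoord n 0
     else if j ≤ 2 * n - 2 then
       (if j = 1 then vcoord n (n - 1)
        else if j % 2 = 0 then vcoord n 0
        else if j = 3 then vcoord n (n - 2)
        else vcoord n ((j - 3) / 2))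
     else if j = 2 * n - 1 then vcoord n n
     else vcoord n (n + 2))
  else if a = n - 1 then
    (if j = 0 then vcoord n 0
     else if j = 1 then vcoord n (n - 1)
     else if j = 2 then vcoord n 0
     else if j = 3 then vcoord n n
     else vcoord n (n + 2))
  else if a = n - 2 then
    (if j = 0 then vcoord n 0
     else if j = 1 then vcoord n (n - 1)
     else vcoord n (n + 1))
  else
    (if j = 0 then vcoord n 0
     else if j ≤ 2 * n - 1 then
       (if j = 1 then vcoord n (n - 1)
        else if j = 2 * n - 1 then vcoord n n
        else if (j - 1) % 2 = 1 then vcoord n 0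
        else vcoord n ((a + (j - 1) / 2 - 2) % (n - 2) + 1))
     else vcoord n (n + 2))

/-- Locating a parameter `t ∈ [0,1]` on arm `a` of the subdivision `X_1`:
returns the index `j` of the edge of `X_1` containing the point together with the
affine coordinate `s ∈ [0,1]` inside this edge.  The vertices of `X_1` are placed
at: `j/(2n)` (`0 ≤ j ≤ 2n`) on arms `a ≤ n-3`; at `0, 1/2, 1` on arm `n-2`;
at `0, 1/6, 2/6, 3/6, 1` on arm `n-1` (the vertices `v_{n-1}`, `v_{n+1}` sit at
`1/2` and `1`); and at `j/(4n-2)` (`0 ≤ j ≤ 2n-1`) followed by `1` on arm `n`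
(the vertices `v_n`, `v_{n+2}` sit at `1/2` and `1`). -/
def segOf (n a : ℕ) (t : ℝ) : ℕ × ℝ :=
  if a = n then
    (if t ≤ 1 / 2 then
      (min (2 * n - 2) ⌊(4 * (n : ℝ) - 2) * t⌋₊,
        (4 * (n : ℝ) - 2) * t - (min (2 * n - 2) ⌊(4 * (n : ℝ) - 2) * t⌋₊ : ℕ))
     else (2 * n - 1, 2 * t - 1))
  else if a = n - 1 then
    (if t ≤ 1 / 2 then
      (min 2 ⌊6 * t⌋₊, 6 * t - (min 2 ⌊6 * t⌋₊ : ℕ))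
     else (3, 2 * t - 1))
  else if a = n - 2 then
    (min 1 ⌊2 * t⌋₊, 2 * t - (min 1 ⌊2 * t⌋₊ : ℕ))
  else
    (min (2 * n - 1) ⌊2 * (n : ℝ) * t⌋₊,
      2 * (n : ℝ) * t - (min (2 * n - 1) ⌊2 * (n : ℝ) * t⌋₊ : ℕ))

/-- The bonding map `φ` in arm coordinates: a point with arm coordinates `p` lies
on arm `a = p.1 % n + 1` at parameter `t`; it lies in the `j`-th edge of `X_1`
on this arm with affine coordinate `s`, and is mapped to the corresponding affine
combination of the `φ`-images of the endpoints of this edge. -/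
def Gmap (n : ℕ) (p : ℕ × ℝ) : ℕ × ℝ :=
  interpC (imgCoord n (p.1 % n + 1) (segOf n (p.1 % n + 1) (min 1 (max 0 p.2))).1)
    (imgCoord n (p.1 % n + 1) ((segOf n (p.1 % n + 1) (min 1 (max 0 p.2))).1 + 1))
    (segOf n (p.1 % n + 1) (min 1 (max 0 p.2))).2

/-- The piecewise-linear bonding map `f : S → S` induced by `φ`. -/
def fS (n : ℕ) : Sspace n → Sspace n := fun z =>
  ⟨embC n (Gmap n (Function.invFun (embC n) (z : ℂ))), Set.mem_range_self _⟩

/-- The continuum `nK`: the inverse limit of the sequence `S ←f S ←f S ⋯`,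
realized inside the countable product `S^ℕ`. -/
abbrev nK (n : ℕ) := {x : ℕ → Sspace n // ∀ k, fS n (x (k + 1)) = x k}

end

noncomputable section

/-- Arm coordinates of the parametrization of the `e`-th edge of `X_0`
(`0 ≤ e ≤ n+1`): for `e < n-2` the edge is `⟨v_0, v_{e+1}⟩` (a whole ray);
edge `n-2` is `⟨v_0, v_{n-1}⟩`; edge `n-1` is `⟨v_{n-1}, v_{n+1}⟩`;
edge `n` is `⟨v_0, v_n⟩`; edge `n+1` is `⟨v_n, v_{n+2}⟩`. -/
def X0edgeCoord (n e : ℕ) (t : ℝ) : ℕ × ℝ :=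
  if e < n - 2 then (e, t)
  else if e = n - 2 then (n - 2, t / 2)
  else if e = n - 1 then (n - 2, (1 + t) / 2)
  else if e = n then (n - 1, t / 2)
  else (n - 1, (1 + t) / 2)

/-- The graph `X_0`: the simple-`n`-od `S`, with vertex set `{v_0, …, v_{n+2}}`
and the `n + 2` edges listed in `X0edgeCoord`. -/
def X0graph (n : ℕ) : GraphData (Sspace n) :=
  letI := Classical.decEq (Sspace n)
  { verts := (Finset.range (n + 3)).image (vpt n)
    nE := n + 2
    edge := fun e t => ⟨embC n (X0edgeCoord n (e : ℕ) t), Set.mem_range_self _⟩ }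

end

/-! ## Words read along the arms of `X_1` -/

namespace OdWord

/-- The number of letter positions (minus one) of the word of an arm of `X_1`:
`some i` stands for the arm whose first proper letter is `i + 1`, `none` for the arm
carrying no proper letter. -/
def size (s : ℕ) : Option (Fin s) → ℕ
  | none => 1
  | some _ => s + 1

/-- The `r`-th nonzero letter of the word of an arm of `X_1`. -/
def letter (s : ℕ) (x : Option (Fin s)) (r : ℕ) : ℕ :=
  if r = 0 then s + 1
  else if r = size s x then s + 2
  else match x with
    | none => 0
    | some i => ((i : ℕ) + (r - 1)) % s + 1

variable {s : ℕ}

lemma one_le_size (x : Option (Fin s)) : 1 ≤ size s x := by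
  cases x <;> simp [size]

lemma letter_zero (x : Option (Fin s)) : letter s x 0 = s + 1 := by simp [letter]

lemma letter_size (x : Option (Fin s)) : letter s x (size s x) = s + 2 := by
  have := one_le_size x
  simp [letter]; omega

lemma letter_some {i : Fin s} {r : ℕ} (h1 : 1 ≤ r) (h2 : r ≤ s) :
    letter s (some i) r = ((i : ℕ) + (r - 1)) % s + 1 := by
  have : ¬ r = s + 1 := by omega
  have : ¬ r = 0 := by omega
  simp [letter, size, *]

lemma letter_some_mem {i : Fin s} {r : ℕ} (h1 : 1 ≤ r) (h2 : r ≤ s) :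
    1 ≤ letter s (some i) r ∧ letter s (some i) r ≤ s := by
  rw [letter_some h1 h2]
  have := Nat.mod_lt ((i : ℕ) + (r - 1)) (show 0 < s by omega)
  omega

lemma letter_bounds (x : Option (Fin s)) {r : ℕ} (hr : r ≤ size s x) :
    1 ≤ letter s x r ∧ letter s x r ≤ s + 2 := by
  rcases Nat.eq_zero_or_pos r with rfl | h
  · rw [letter_zero]; omega
  rcases hr.eq_or_lt with rfl | h'
  · rw [letter_size]; omega
  cases x with
  | none => simp [size] at h'; omega
  | some i =>
    have := letter_some_mem (i := i) h (by simp [size] at h'; omega)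
    omega

lemma mod_cancel {i r r' : ℕ} (hr : r < s) (hr' : r' < s)
    (h : (i + r) % s = (i + r') % s) : r = r' := by
  have h1 : i + r ≡ i + r' [MOD s] := h
  have h2 : r % s = r' % s := Nat.ModEq.add_left_cancel' i h1
  rwa [Nat.mod_eq_of_lt hr, Nat.mod_eq_of_lt hr'] at h2

lemma letter_inj (x : Option (Fin s)) {r r' : ℕ} (hr : r ≤ size s x) (hr' : r' ≤ size s x)
    (h : letter s x r = letter s x r') : r = r' := by
  cases x with
  | none =>
    simp only [size] at hr hr'
    interval_cases r <;> interval_cases r' <;> simp_all [letter, size]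
  | some i =>
    have key : ∀ q, q ≤ s + 1 → (q = 0 ∧ letter s (some i) q = s + 1) ∨
        (q = s + 1 ∧ letter s (some i) q = s + 2) ∨
        (1 ≤ q ∧ q ≤ s ∧ letter s (some i) q ≤ s) := by
      intro q hq
      rcases Nat.eq_zero_or_pos q with rfl | h
      · exact Or.inl ⟨rfl, letter_zero _⟩
      rcases hq.eq_or_lt with rfl | h'
      · exact Or.inr (Or.inl ⟨rfl, letter_size (some i)⟩)
      · exact Or.inr (Or.inr ⟨h, by omega, (letter_some_mem h (by omega)).2⟩)
    simp only [size] at hr hr'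
    rcases key r hr with h1 | h1 | h1 <;> rcases key r' hr' with h2 | h2 | h2 <;> try omega
    rw [letter_some h1.1 h1.2.1, letter_some h2.1 h2.2.1] at h
    have := mod_cancel (s := s) (i := i) (r := r - 1) (r' := r' - 1) (by omega) (by omega) (by omega)
    omega

lemma letter_one_inj {x y : Option (Fin s)} (h : letter s x 1 = letter s y 1) : x = y := by
  have h0 : letter s (none : Option (Fin s)) 1 = s + 2 := letter_size none
  have h1 : ∀ i : Fin s, letter s (some i) 1 = i + 1 := by
    intro i
    rw [letter_some le_rfl (by have := i.2; omega)]
    simp [Nat.mod_eq_of_lt i.2]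
  cases x with
  | none => cases y with
    | none => rfl
    | some j => rw [h0, h1] at h; have := j.2; omega
  | some i => cases y with
    | none => rw [h0, h1] at h; have := i.2; omega
    | some j => rw [h1, h1] at h; congr 1; ext; omega

lemma letter_last_inj {x y : Option (Fin s)}
    (h : letter s x (size s x - 1) = letter s y (size s y - 1)) : x = y := by
  have h0 : letter s (none : Option (Fin s)) (size s (none : Option (Fin s)) - 1) = s + 1 :=
    letter_zero none
  have h1 : ∀ i : Fin s, letter s (some i) (size s (some i) - 1) = (s - 1 + i) % s + 1 ∧
      letter s (some i) (size s (some i) - 1) ≤ s := by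
    intro i
    have hi := i.2
    have e : size s (some i) - 1 = s := by simp [size]
    rw [e]
    exact ⟨by rw [letter_some (by omega) le_rfl, Nat.add_comm (i : ℕ)],
      (letter_some_mem (by omega) le_rfl).2⟩
  cases x with
  | none => cases y with
    | none => rfl
    | some j => have := (h1 j).2; rw [h0] at h; omega
  | some i => cases y with
    | none => have := (h1 i).2; rw [h0] at h; omega
    | some j =>
      rw [(h1 i).1, (h1 j).1] at h
      congr 1; ext
      exact mod_cancel (i := s - 1) i.2 j.2 (by omega)

lemma exists_letter_eq (i : Fin s) {μ : ℕ} (h1 : 1 ≤ μ) (h2 : μ ≤ s) :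
    ∃ r, 1 ≤ r ∧ r ≤ s ∧ letter s (some i) r = μ := by
  have hi := i.2
  by_cases h : (i : ℕ) + 1 ≤ μ
  · refine ⟨μ - i, by omega, by omega, ?_⟩
    rw [letter_some (by omega) (by omega)]
    have : (i : ℕ) + (μ - i - 1) = μ - 1 := by omega
    rw [this, Nat.mod_eq_of_lt (by omega)]; omega
  · refine ⟨s + μ - i, by omega, by omega, ?_⟩
    rw [letter_some (by omega) (by omega)]
    have : (i : ℕ) + (s + μ - i - 1) = (μ - 1) + s := by omega
    rw [this, Nat.add_mod_right, Nat.mod_eq_of_lt (by omega)]; omega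

/-- Locations of vertices of `X_1`: the branch point, the `j`-th vertex of an arm whose
word ends in `v_n v_{n+2}`, and the two vertices `p`, `q` of the remaining arm. -/
inductive Loc (s : ℕ)
  | O : Loc s
  | pt : Option (Fin s) → ℕ → Loc s
  | p : Loc s
  | q : Loc s

/-- The index of the vertex of `X_0` onto which a vertex of `X_1` is mapped. -/
def label : Loc s → ℕ
  | Loc.O => 0
  | Loc.pt x j => if j % 2 = 0 then (if j ≤ 2 * size s x then 0 else s + 4)
      else letter s x (j / 2)
  | Loc.p => s + 1
  | Loc.q => s + 3

lemma label_even {x : Option (Fin s)} {r : ℕ} (hr : r ≤ size s x) :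
    label (Loc.pt x (2 * r)) = 0 := by
  simp [label]; omega

lemma label_odd {x : Option (Fin s)} {r : ℕ} : label (Loc.pt x (2 * r + 1)) = letter s x r := by
  have h1 : (2 * r + 1) % 2 = 1 := by omega
  have h2 : (2 * r + 1) / 2 = r := by omega
  simp [label, h1, h2]

lemma label_tip {x : Option (Fin s)} : label (Loc.pt x (2 * size s x + 2)) = s + 4 := by
  have h1 : (2 * size s x + 2) % 2 = 0 := by omega
  simp [label, h1]

lemma letter_eq_zero_iff (x : Option (Fin s)) {r : ℕ} (hr : r ≤ size s x) :
    letter s x r = s + 1 ↔ r = 0 := by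
  constructor
  · intro h
    exact letter_inj x hr (Nat.zero_le _) (h.trans (letter_zero x).symm)
  · rintro rfl
    exact letter_zero x

lemma letter_eq_size_iff (x : Option (Fin s)) {r : ℕ} (hr : r ≤ size s x) :
    letter s x r = s + 2 ↔ r = size s x := by
  constructor
  · intro h
    exact letter_inj x hr le_rfl (h.trans (letter_size x).symm)
  · rintro rfl
    exact letter_size x

/-! ## Positions in a simple od -/

section Position

variable {V K : Type*}

/-- Two points have the same position (arm and depth) in a simple od. -/
def PosEq (arm : V → K) (dep : V → ℕ) (z w : V) : Prop :=
  dep z = dep w ∧ (dep z = 0 ∨ arm z = arm w)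

/-- Two points have consecutive positions in a simple od. -/
def Consec (arm : V → K) (dep : V → ℕ) (z z' : V) : Prop :=
  (dep z' = dep z + 1 ∧ (dep z = 0 ∨ arm z = arm z')) ∨
    (dep z = dep z' + 1 ∧ (dep z' = 0 ∨ arm z = arm z'))

lemma Consec.symm {arm : V → K} {dep : V → ℕ} {z z' : V} (h : Consec arm dep z z') :
    Consec arm dep z' z := by
  rcases h with ⟨h, h'⟩ | ⟨h, h'⟩
  · exact Or.inr ⟨h, h'.imp_right Eq.symm⟩
  · exact Or.inl ⟨h, h'.imp_right Eq.symm⟩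

lemma PosEq.symm {arm : V → K} {dep : V → ℕ} {z z' : V} (h : PosEq arm dep z z') :
    PosEq arm dep z' z := by
  unfold PosEq at *; grind

/-- If the classes of the points of a region are constant along its edges and determined,
across its boundary, by the component of the complement, then they all agree. -/
lemma region_const {C D : Type*} {E : V → V → Prop}
    (conn : ∀ P : V → Prop, (∀ g g', E g g' → (P g ↔ P g')) → ∀ z z', P z → P z')
    (R : V → Prop) (cls : V → C) (comp : V → D)
    (hin : ∀ g g', E g g' → R g → R g' → cls g = cls g')
    (hout : ∀ g g', E g g' → ¬ R g → ¬ R g' → comp g = comp g')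
    (hcross : ∀ g g' h h', R g → ¬ R g' → (E g g' ∨ E g' g) → R h → ¬ R h' →
      (E h h' ∨ E h' h) → comp g' = comp h' → cls g = cls h)
    {z z' : V} (hz : R z) (hz' : R z') : cls z = cls z' := by
  have key := conn (fun w => (R w ∧ cls w = cls z) ∨ (¬ R w ∧ ∃ g g', R g ∧ ¬ R g' ∧
    (E g g' ∨ E g' g) ∧ comp g' = comp w ∧ cls g = cls z)) ?_ z z' (Or.inl ⟨hz, rfl⟩)
  · rcases key with h | h
    · exact h.2.symm
    · exact absurd hz' h.1
  · have aux : ∀ g g', R g → ¬ R g' → (E g g' ∨ E g' g) → (cls g = cls z ↔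
        ∃ h h', R h ∧ ¬ R h' ∧ (E h h' ∨ E h' h) ∧ comp h' = comp g' ∧ cls h = cls z) := by
      intro g g' hg hg' hE
      constructor
      · intro h
        exact ⟨g, g', hg, hg', hE, rfl, h⟩
      · rintro ⟨h, h', hh, hh', hE', hc, hcl⟩
        rw [← hcl]
        exact hcross _ _ _ _ hg hg' hE hh hh' hE' hc.symm
    intro g g' hE
    by_cases hg : R g <;> by_cases hg' : R g'
    · simp [hg, hg', hin g g' hE hg hg']
    · simpa [hg, hg'] using aux g g' hg hg' (Or.inl hE)
    · simpa [hg, hg'] using (aux g' g hg' hg (Or.inr hE)).symm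
    · simp [hg, hg', hout g g' hE hg hg']

end Position

/-! ## Vertices of `X_1` placed in a simple od with too few arms -/

section System

variable {V K : Type*}

/-- `τ` runs through the word of the arm `x`, from the branch point up to `v_n`. -/
structure Tr (loc : V → Loc s) (arm : V → K) (dep : V → ℕ) (x : Option (Fin s))
    (τ : ℕ → V) : Prop where
  zero : loc (τ 0) = Loc.O
  pt : ∀ j, 1 ≤ j → j ≤ 2 * size s x + 1 → loc (τ j) = Loc.pt x j
  consec : ∀ j, j < 2 * size s x + 1 → Consec arm dep (τ j) (τ (j + 1))

/-- The elementary edges between vertices of `X_1`. -/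
inductive Edge (loc : V → Loc s) (arm : V → K) (dep : V → ℕ) : V → V → Prop
  | tr {x τ j} : Tr loc arm dep x τ → j < 2 * size s x + 1 → Edge loc arm dep (τ j) (τ (j + 1))
  | tip {x z z'} : loc z = Loc.pt x (2 * size s x + 1) → loc z' = Loc.pt x (2 * size s x + 2) →
      Consec arm dep z z' → Edge loc arm dep z z'
  | op {z z'} : loc z = Loc.O → loc z' = Loc.p → Consec arm dep z z' → Edge loc arm dep z z'
  | pq {z z'} : loc z = Loc.p → loc z' = Loc.q → Consec arm dep z z' → Edge loc arm dep z z'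

lemma Edge.consec {loc : V → Loc s} {arm : V → K} {dep : V → ℕ} {z z' : V}
    (h : Edge loc arm dep z z') : Consec arm dep z z' := by
  cases h with
  | tr h hj => exact h.consec _ hj
  | tip _ _ h => exact h
  | op _ _ h => exact h
  | pq _ _ h => exact h

/-- Vertices of `X_1` are placed at the vertices of a simple od with arms `K`, compatibly with
their labels, consecutive vertices being placed consecutively. -/
structure IsSystem (loc : V → Loc s) (arm : V → K) (dep : V → ℕ) : Prop where
  coh : ∀ z z', PosEq arm dep z z' → label (loc z) = label (loc z')
  zero : ∀ z, dep z = 0 → label (loc z) = 0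
  conn : ∀ P : V → Prop, (∀ g g', Edge loc arm dep g g' → (P g ↔ P g')) → ∀ z z', P z → P z'

namespace Tr

variable {loc : V → Loc s} {arm : V → K} {dep : V → ℕ} {x : Option (Fin s)} {τ : ℕ → V}

lemma label_even (h : Tr loc arm dep x τ) {r : ℕ} (hr : r ≤ size s x) :
    label (loc (τ (2 * r))) = 0 := by
  rcases Nat.eq_zero_or_pos r with rfl | h'
  · simp [h.zero, label]
  · rw [h.pt _ (by omega) (by omega), OdWord.label_even hr]

lemma label_odd (h : Tr loc arm dep x τ) {r : ℕ} (hr : r ≤ size s x) :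
    label (loc (τ (2 * r + 1))) = letter s x r := by
  rw [h.pt _ (by omega) (by omega), OdWord.label_odd]

lemma label_odd_ne (h : Tr loc arm dep x τ) {r r' : ℕ} (hr : r ≤ size s x)
    (hr' : r' ≤ size s x) (hne : r ≠ r') :
    label (loc (τ (2 * r + 1))) ≠ label (loc (τ (2 * r' + 1))) := by
  rw [h.label_odd hr, h.label_odd hr']
  exact fun e => hne (letter_inj x hr hr' e)

lemma eq_of_label_ne_zero (h : Tr loc arm dep x τ) {j : ℕ} (hj : j ≤ 2 * size s x + 1)
    (hl : label (loc (τ j)) ≠ 0) :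
    ∃ r, r ≤ size s x ∧ j = 2 * r + 1 ∧ label (loc (τ j)) = letter s x r := by
  obtain ⟨r, hr | hr⟩ : ∃ r, j = 2 * r ∨ j = 2 * r + 1 := ⟨j / 2, by omega⟩
  · exact absurd (hr ▸ h.label_even (r := r) (by omega)) hl
  · exact ⟨r, by omega, hr, hr ▸ h.label_odd (r := r) (by omega)⟩

end Tr

namespace IsSystem

variable {loc : V → Loc s} {arm : V → K} {dep : V → ℕ}

lemma straight_out (S : IsSystem loc arm dep) {p q r : V} (hpq : Consec arm dep p q)
    (hqr : Consec arm dep q r) (hne : label (loc p) ≠ label (loc r))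
    (h : dep q = dep p + 1) : dep r = dep q + 1 := by
  have := mt (S.coh p r) hne
  unfold PosEq Consec at *
  grind

lemma straight_in (S : IsSystem loc arm dep) {p q r : V} (hpq : Consec arm dep p q)
    (hqr : Consec arm dep q r) (hne : label (loc p) ≠ label (loc r))
    (hq : 1 ≤ dep q) (h : dep p = dep q + 1) : dep q = dep r + 1 := by
  have := mt (S.coh p r) hne
  unfold PosEq Consec at *
  grind

lemma straight_through (S : IsSystem loc arm dep) {o p q r t : V} (hop : Consec arm dep o p)
    (hpq : Consec arm dep p q) (hqr : Consec arm dep q r) (hrt : Consec arm dep r t)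
    (hoq : label (loc o) ≠ label (loc q)) (hot : label (loc o) ≠ label (loc t))
    (hqt : label (loc q) ≠ label (loc t)) (hp : 1 ≤ dep p) (h : dep q = dep p + 1) :
    dep r = dep q + 1 := by
  have h1 := mt (S.coh o q) hoq
  have h2 := mt (S.coh o t) hot
  have h3 := mt (S.coh q t) hqt
  unfold PosEq Consec at *
  grind

/-- A chain of consecutive points with pairwise distinct labels at even indices which starts
outwards away from the branch point keeps going outwards. -/
lemma run (S : IsSystem loc arm dep) {σ : ℕ → V} {L : ℕ}
    (hc : ∀ j, j < 2 * L → Consec arm dep (σ j) (σ (j + 1)))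
    (hl : ∀ i i', i ≤ L → i' ≤ L → i ≠ i' → label (loc (σ (2 * i))) ≠ label (loc (σ (2 * i'))))
    (h1 : 1 ≤ dep (σ 1)) (h2 : dep (σ 2) = dep (σ 1) + 1) (i : ℕ) (hi : i + 1 ≤ L) :
    dep (σ (2 * i + 2)) = dep (σ 2) + 2 * i ∧ arm (σ (2 * i + 2)) = arm (σ 2) ∧
      dep (σ (2 * i + 2)) = dep (σ (2 * i + 1)) + 1 := by
  induction i with
  | zero => simp [h2]
  | succ i ih =>
    obtain ⟨ih1, ih2, ih3⟩ := ih (by omega)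
    have c0 := hc (2 * i) (by omega)
    have c1 := hc (2 * i + 1) (by omega)
    have c2 := hc (2 * i + 2) (by omega)
    have c3 := hc (2 * i + 3) (by omega)
    have l1 := hl i (i + 1) (by omega) (by omega) (by omega)
    have l2 := hl i (i + 2) (by omega) (by omega) (by omega)
    have l3 := hl (i + 1) (i + 2) (by omega) (by omega) (by omega)
    have e1 : dep (σ (2 * i + 3)) = dep (σ (2 * i + 2)) + 1 :=
      S.straight_through c0 c1 c2 c3 l1 l2 l3 (by omega) ih3
    have e2 : dep (σ (2 * i + 3 + 1)) = dep (σ (2 * i + 3)) + 1 := S.straight_out c2 c3 l3 e1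
    have e : 2 * (i + 1) + 2 = 2 * i + 3 + 1 := by ring
    have e' : 2 * (i + 1) + 1 = 2 * i + 2 + 1 := by ring
    rw [e, e']
    refine ⟨by omega, ?_, e2⟩
    unfold Consec at c2 c3
    grind

lemma letters_after (S : IsSystem loc arm dep) {x : Option (Fin s)} {τ : ℕ → V}
    (h : Tr loc arm dep x τ) {r : ℕ} (h1 : 1 ≤ r) (hd : 1 ≤ dep (τ (2 * r)))
    (hd' : dep (τ (2 * r + 1)) = dep (τ (2 * r)) + 1) {t : ℕ} (ht : r + t ≤ size s x) :
    dep (τ (2 * (r + t) + 1)) = dep (τ (2 * r + 1)) + 2 * t ∧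
      arm (τ (2 * (r + t) + 1)) = arm (τ (2 * r + 1)) := by
  obtain ⟨r, rfl⟩ : ∃ k, r = k + 1 := ⟨r - 1, by omega⟩
  have := S.run (σ := fun k => τ (2 * r + 1 + k)) (L := size s x - r)
    (fun j hj => h.consec _ (by omega))
    (fun i i' hi hi' hne => by
      have := h.label_odd_ne (r := r + i) (r' := r + i') (by omega) (by omega) (by omega)
      have e : ∀ i, 2 * r + 1 + 2 * i = 2 * (r + i) + 1 := fun i => by ring
      simpa only [e] using this)
    (by simpa [mul_add] using hd) (by simpa [mul_add] using hd') t (by omega)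
  have e : 2 * r + 1 + (2 * t + 2) = 2 * (r + 1 + t) + 1 := by ring
  have e' : 2 * r + 1 + 2 = 2 * (r + 1) + 1 := by ring
  simp only [e, e'] at this
  exact ⟨this.1, this.2.1⟩

lemma letters_before (S : IsSystem loc arm dep) {x : Option (Fin s)} {τ : ℕ → V}
    (h : Tr loc arm dep x τ) {r : ℕ} (h1 : r + 1 ≤ size s x) (hd : 1 ≤ dep (τ (2 * r + 2)))
    (hd' : dep (τ (2 * r + 1)) = dep (τ (2 * r + 2)) + 1) {t : ℕ} (ht : t ≤ r) :
    dep (τ (2 * (r - t) + 1)) = dep (τ (2 * r + 1)) + 2 * t ∧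
      arm (τ (2 * (r - t) + 1)) = arm (τ (2 * r + 1)) := by
  have := S.run (σ := fun k => τ (2 * r + 3 - k)) (L := r + 1)
    (fun j hj => by
      have := h.consec (2 * r + 3 - (j + 1)) (by omega)
      have e : 2 * r + 3 - (j + 1) + 1 = 2 * r + 3 - j := by omega
      rw [e] at this
      exact this.symm)
    (fun i i' hi hi' hne => by
      have := h.label_odd_ne (r := r + 1 - i) (r' := r + 1 - i') (by omega) (by omega) (by omega)
      have e : ∀ i, i ≤ r + 1 → 2 * r + 3 - 2 * i = 2 * (r + 1 - i) + 1 := fun i hi => by omega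
      simpa only [e i hi, e i' hi'] using this)
    hd hd' t (by omega)
  have e : 2 * r + 3 - (2 * t + 2) = 2 * (r - t) + 1 := by omega
  have e' : 2 * r + 3 - 2 = 2 * r + 1 := by omega
  simp only [e, e'] at this
  exact ⟨this.1, this.2.1⟩

lemma exists_missing (S : IsSystem loc arm dep) [Fintype K] (hK : Fintype.card K ≤ s + 1) :
    ∃ μ, 1 ≤ μ ∧ μ ≤ s + 2 ∧ ∀ z, dep z = 1 → label (loc z) ≠ μ := by
  by_contra! hcon
  have : ∀ i : Fin (s + 2), ∃ z, dep z = 1 ∧ label (loc z) = i + 1 := by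
    intro i
    exact hcon (i + 1) (by omega) (by omega)
  choose g hg hg' using this
  have hinj : Function.Injective (fun i => arm (g i)) := by
    intro i j hij
    have := S.coh (g i) (g j) ⟨by rw [hg, hg], Or.inr hij⟩
    rw [hg', hg'] at this
    ext; omega
  have := Fintype.card_le_of_injective _ hinj
  simp at this; omega

/-- The part of the od lying strictly below the first occurrence of `μ` on each arm. -/
def Core (loc : V → Loc s) (arm : V → K) (dep : V → ℕ) (μ : ℕ) (z : V) : Prop :=
  ∀ w, label (loc w) = μ → arm w = arm z → dep z < dep w

lemma core_of_dep_zero (S : IsSystem loc arm dep) {μ : ℕ} (hμ : 1 ≤ μ) {z : V}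
    (hz : dep z = 0) : Core loc arm dep μ z := by
  intro w hw _
  by_contra h
  have := S.zero w (by omega)
  omega

lemma core_cross (S : IsSystem loc arm dep) {μ : ℕ} (hμ : 1 ≤ μ)
    (hmiss : ∀ z, dep z = 1 → label (loc z) ≠ μ) {g g' : V} (hc : Consec arm dep g g')
    (hg : Core loc arm dep μ g) (hg' : ¬ Core loc arm dep μ g') :
    label (loc g') = μ ∧ dep g' = dep g + 1 ∧ 1 ≤ dep g ∧ arm g = arm g' := by
  simp only [Core, not_forall] at hg'
  obtain ⟨w, hw, hwa, hwd⟩ := hg'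
  have h0 : dep w ≠ 0 := fun h => by have := S.zero w h; omega
  have h1 : dep w ≠ 1 := fun h => hmiss w h hw
  have h2 := hg w hw
  have h3 := S.coh w g'
  unfold PosEq at h3
  unfold Consec at hc
  grind

lemma core_cross_posEq (S : IsSystem loc arm dep) {μ : ℕ} (hμ : 1 ≤ μ)
    (hmiss : ∀ z, dep z = 1 → label (loc z) ≠ μ) {g g' h h' : V} (hc : Consec arm dep g g')
    (hg : Core loc arm dep μ g) (hg' : ¬ Core loc arm dep μ g') (hc' : Consec arm dep h h')
    (hh : Core loc arm dep μ h) (hh' : ¬ Core loc arm dep μ h') (ha : arm g' = arm h') :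
    PosEq arm dep g' h' ∧ PosEq arm dep g h := by
  obtain ⟨a1, a2, a3, a4⟩ := S.core_cross hμ hmiss hc hg hg'
  obtain ⟨b1, b2, b3, b4⟩ := S.core_cross hμ hmiss hc' hh hh'
  have e1 := hg h' b1 (by grind)
  have e2 := hh g' a1 (by grind)
  unfold PosEq
  grind

lemma dep_pos_of_not_core (S : IsSystem loc arm dep) {μ : ℕ} (hμ : 1 ≤ μ) {z : V}
    (hz : ¬ Core loc arm dep μ z) : 1 ≤ dep z := by
  by_contra h
  exact hz (S.core_of_dep_zero hμ (by omega))

lemma not_core_of_label {μ : ℕ} {z : V} (hz : label (loc z) = μ) :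
    ¬ Core loc arm dep μ z := fun h => lt_irrefl _ (h z hz rfl)

lemma arm_eq_of_not_core (S : IsSystem loc arm dep) {μ : ℕ} (hμ : 1 ≤ μ) {g g' : V}
    (hc : Consec arm dep g g') (hg : ¬ Core loc arm dep μ g) (hg' : ¬ Core loc arm dep μ g') :
    arm g = arm g' := by
  have := S.dep_pos_of_not_core hμ hg
  have := S.dep_pos_of_not_core hμ hg'
  unfold Consec at hc
  grind

/-- The arm on which a vertex lies, for the arms carrying a word. -/
def typ : Loc s → Option (Option (Fin s))
  | Loc.pt x _ => some x
  | _ => none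

/-- Points on two traverses of arms whose last zeros are both placed at the branch point,
when `v_{n-1}` does not occur at depth one. -/
lemma eq_of_missing_first (S : IsSystem loc arm dep)
    (hmiss : ∀ z, dep z = 1 → label (loc z) ≠ s + 1) {x y : Option (Fin s)} {τ σ : ℕ → V}
    (hτ : Tr loc arm dep x τ) (hσ : Tr loc arm dep y σ)
    (hx : dep (τ (2 * size s x)) = 0) (hy : dep (σ (2 * size s y)) = 0) : x = y := by
  have hμ : 1 ≤ s + 1 := by omega
  have sx := one_le_size x
  have sy := one_le_size y
  let R : V → Prop := fun z => Core loc arm dep (s + 1) z ∧ loc z ≠ Loc.O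
  have hR1 : ∀ {x : Option (Fin s)} {τ : ℕ → V}, Tr loc arm dep x τ →
      ¬ Core loc arm dep (s + 1) (τ 1) := fun {x τ} h =>
    not_core_of_label (by rw [h.label_odd (r := 0) (Nat.zero_le _), letter_zero])
  have hRp : ∀ {z : V}, loc z = Loc.p → ¬ Core loc arm dep (s + 1) z := fun hz =>
    not_core_of_label (by rw [hz]; rfl)
  have hcrossing : ∀ g g', R g → ¬ R g' → (Edge loc arm dep g g' ∨ Edge loc arm dep g' g) →
      (¬ Core loc arm dep (s + 1) g' ∧ Consec arm dep g g') ∧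
      ((∃ x τ, Tr loc arm dep x τ ∧ g' = τ 1 ∧ g = τ 2) ∨ (loc g' = Loc.p ∧ loc g = Loc.q)) := by
    rintro g g' ⟨hg, hgO⟩ hg' hE
    have hc : Consec arm dep g g' := hE.elim Edge.consec fun h => h.consec.symm
    have hnc : ¬ Core loc arm dep (s + 1) g' := by
      intro hcore
      have hO : loc g' = Loc.O := by
        by_contra h
        exact hg' ⟨hcore, h⟩
      rcases hE with hE | hE
      · cases hE with
        | @tr x τ j h hj =>
          rw [h.pt _ (by omega) (by omega)] at hO
          cases hO
        | tip _ h _ => rw [h] at hO; cases hO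
        | op _ h _ => rw [h] at hO; cases hO
        | pq _ h _ => rw [h] at hO; cases hO
      · cases hE with
        | @tr x τ j h hj =>
          rcases Nat.eq_zero_or_pos j with rfl | hj'
          · exact hR1 h hg
          · rw [h.pt _ (by omega) (by omega)] at hO
            cases hO
        | tip h _ _ => rw [h] at hO; cases hO
        | op _ h _ => exact hRp h hg
        | pq h _ _ => rw [h] at hO; cases hO
    refine ⟨⟨hnc, hc⟩, ?_⟩
    have hl := (S.core_cross hμ hmiss hc hg hnc).1
    rcases hE with hE | hE
    · cases hE with
      | @tr x τ j h hj =>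
        obtain ⟨r, hr, hjr, hlr⟩ := h.eq_of_label_ne_zero (j := j + 1) (by omega) (by omega)
        have : r = 0 := (letter_eq_zero_iff x hr).1 (by omega)
        obtain rfl : j = 0 := by omega
        exact absurd h.zero hgO
      | tip _ h _ => rw [h, label_tip] at hl; omega
      | op h _ _ => exact absurd h hgO
      | pq _ h _ => rw [h] at hl; simp [label] at hl
    · cases hE with
      | @tr x τ j h hj =>
        obtain ⟨r, hr, hjr, hlr⟩ := h.eq_of_label_ne_zero (j := j) (by omega) (by omega)
        have : r = 0 := (letter_eq_zero_iff x hr).1 (by omega)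
        obtain rfl : j = 1 := by omega
        exact Or.inl ⟨x, τ, h, rfl, rfl⟩
      | @tip x _ _ h _ _ =>
        rw [h, label_odd, letter_size] at hl; omega
      | op h _ _ => rw [h] at hl; simp [label] at hl
      | pq h h' _ => exact Or.inr ⟨h, h'⟩
  have key := region_const S.conn R (fun z => typ (loc z)) arm ?_ ?_ ?_
    (z := τ (2 * size s x)) (z' := σ (2 * size s y)) ?_ ?_
  · simpa [hτ.pt (2 * size s x) (by omega) (by omega),
      hσ.pt (2 * size s y) (by omega) (by omega), typ] using key
  · rintro g g' hE ⟨hg, hgO⟩ ⟨hg', hgO'⟩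
    cases hE with
    | @tr x τ j h hj =>
      rcases Nat.eq_zero_or_pos j with rfl | hj'
      · exact absurd h.zero hgO
      · simp [h.pt j (by omega) (by omega), h.pt (j + 1) (by omega) (by omega), typ]
    | tip h h' _ => simp [h, h', typ]
    | op h _ _ => exact absurd h hgO
    | pq h _ _ => exact absurd hg (hRp h)
  · intro g g' hE hg hg'
    by_cases hcg : Core loc arm dep (s + 1) g <;> by_cases hcg' : Core loc arm dep (s + 1) g'
    · exfalso
      have hO : loc g = Loc.O := by by_contra h; exact hg ⟨hcg, h⟩
      have hO' : loc g' = Loc.O := by by_contra h; exact hg' ⟨hcg', h⟩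
      cases hE with
      | @tr x τ j h hj =>
        rw [h.pt _ (by omega) (by omega)] at hO'
        cases hO'
      | tip _ h _ => rw [h] at hO'; cases hO'
      | op _ h _ => rw [h] at hO'; cases hO'
      | pq _ h _ => rw [h] at hO'; cases hO'
    · exact (S.core_cross hμ hmiss hE.consec hcg hcg').2.2.2
    · exact (S.core_cross hμ hmiss hE.consec.symm hcg' hcg).2.2.2.symm
    · exact S.arm_eq_of_not_core hμ hE.consec hcg hcg'
  · intro g g' h h' hg hg' hE hh hh' hE' ha
    obtain ⟨⟨c1, c2⟩, c3⟩ := hcrossing g g' hg hg' hE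
    obtain ⟨⟨d1, d2⟩, d3⟩ := hcrossing h h' hh hh' hE'
    obtain ⟨p1, p2⟩ := S.core_cross_posEq hμ hmiss c2 hg.1 c1 d2 hh.1 d1 ha
    have lab := S.coh _ _ p2
    obtain ⟨e1, e2, e3, -⟩ := S.core_cross hμ hmiss c2 hg.1 c1
    obtain ⟨f1, f2, f3, -⟩ := S.core_cross hμ hmiss d2 hh.1 d1
    rcases c3 with ⟨x, τ, t1, rfl, rfl⟩ | ⟨t1, t2⟩ <;>
      rcases d3 with ⟨y, σ, u1, rfl, rfl⟩ | ⟨u1, u2⟩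
    · have sx := one_le_size x
      have sy := one_le_size y
      have k1 := S.straight_in (t1.consec 1 (by omega)) (t1.consec 2 (by omega))
        (t1.label_odd_ne (r := 0) (r' := 1) (by omega) (by omega) (by omega)) e3 e2
      have k2 := S.straight_in (u1.consec 1 (by omega)) (u1.consec 2 (by omega))
        (u1.label_odd_ne (r := 0) (r' := 1) (by omega) (by omega) (by omega)) f3 f2
      have k3 : PosEq arm dep (τ 3) (σ 3) := by
        have c1 := t1.consec 2 (by omega)
        have c2 := u1.consec 2 (by omega)
        unfold PosEq at *
        unfold Consec at c1 c2
        grind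
      have k4 := S.coh _ _ k3
      have k5 := t1.label_odd (r := 1) sx
      have k6 := u1.label_odd (r := 1) sy
      have : x = y := letter_one_inj (k5.symm.trans (k4.trans k6))
      simp [t1.pt 2 (by omega) (by omega), u1.pt 2 (by omega) (by omega), typ, this]
    · have := t1.label_even (r := 1) (one_le_size x)
      rw [mul_one] at this
      rw [this, u2] at lab
      simp [label] at lab
    · have := u1.label_even (r := 1) (one_le_size y)
      rw [mul_one] at this
      rw [this, t2] at lab
      simp [label] at lab
    · simp [t2, u2, typ]
  · exact ⟨S.core_of_dep_zero hμ hx, by simp [hτ.pt (2 * size s x) (by omega) (by omega)]⟩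
  · exact ⟨S.core_of_dep_zero hμ hy, by simp [hσ.pt (2 * size s y) (by omega) (by omega)]⟩

open Classical in
/-- The arm of a vertex lying beyond the letter `μ` on it. -/
noncomputable def beyond (μ : ℕ) : Loc s → Option (Option (Fin s))
  | Loc.pt x j => if ∃ r, r ≤ size s x ∧ letter s x r = μ ∧ 2 * r + 1 < j then some x else none
  | _ => none

lemma beyond_pt_of_lt {μ : ℕ} {x : Option (Fin s)} {r j : ℕ} (hr : r ≤ size s x)
    (hl : letter s x r = μ) (h : 2 * r + 1 < j) : beyond μ (Loc.pt x j) = some x :=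
  if_pos ⟨r, hr, hl, h⟩

lemma beyond_pt_of_le {μ : ℕ} {x : Option (Fin s)} {r j : ℕ} (hr : r ≤ size s x)
    (hl : letter s x r = μ) (h : j ≤ 2 * r + 1) : beyond μ (Loc.pt x j) = none := by
  refine if_neg ?_
  rintro ⟨r', hr', hl', h'⟩
  have := letter_inj x hr hr' (hl.trans hl'.symm)
  omega

lemma beyond_pt_succ {μ : ℕ} {x : Option (Fin s)} {j : ℕ}
    (h : ∀ r, r ≤ size s x → letter s x r = μ → j ≠ 2 * r + 1) :
    beyond μ (Loc.pt x j) = beyond μ (Loc.pt x (j + 1)) := by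
  have : (∃ r, r ≤ size s x ∧ letter s x r = μ ∧ 2 * r + 1 < j) ↔
      ∃ r, r ≤ size s x ∧ letter s x r = μ ∧ 2 * r + 1 < j + 1 := by
    refine exists_congr fun r => and_congr_right fun hr => and_congr_right fun hl => ?_
    have := h r hr hl
    omega
  simp [beyond, this]

/-- Points on two traverses of arms whose last zeros are both placed at the branch point,
when a proper letter does not occur at depth one. -/
lemma eq_of_missing_letter (S : IsSystem loc arm dep) {μ : ℕ} (hμ : 1 ≤ μ) (hμs : μ ≤ s)
    (hmiss : ∀ z, dep z = 1 → label (loc z) ≠ μ) {x y : Option (Fin s)} {τ σ : ℕ → V}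
    (hτ : Tr loc arm dep x τ) (hσ : Tr loc arm dep y σ)
    (hx : dep (τ (2 * size s x)) = 0) (hy : dep (σ (2 * size s y)) = 0) : x = y := by
  have hcrossing : ∀ g g', Core loc arm dep μ g → ¬ Core loc arm dep μ g' →
      (Edge loc arm dep g g' ∨ Edge loc arm dep g' g) → Consec arm dep g g' ∧
      ∃ x τ r, Tr loc arm dep x τ ∧ 1 ≤ r ∧ r + 1 ≤ size s x ∧ letter s x r = μ ∧
        g' = τ (2 * r + 1) ∧ (g = τ (2 * r) ∨ g = τ (2 * r + 2)) := by
    intro g g' hg hg' hE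
    have hc : Consec arm dep g g' := hE.elim Edge.consec fun h => h.consec.symm
    refine ⟨hc, ?_⟩
    have hl := (S.core_cross hμ hmiss hc hg hg').1
    have haux : ∀ {x : Option (Fin s)} {r : ℕ}, r ≤ size s x → letter s x r = μ →
        1 ≤ r ∧ r + 1 ≤ size s x := by
      intro x r hr h
      have h1 : r ≠ 0 := fun h0 => by have := (letter_eq_zero_iff x hr).2 h0; omega
      have h2 : r ≠ size s x := fun h0 => by have := (letter_eq_size_iff x hr).2 h0; omega
      omega
    rcases hE with hE | hE
    · cases hE with
      | @tr x τ j h hj =>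
        obtain ⟨r, hr, hjr, hlr⟩ := h.eq_of_label_ne_zero (j := j + 1) (by omega) (by omega)
        obtain ⟨k1, k2⟩ := haux hr (hlr.symm.trans hl)
        obtain rfl : j = 2 * r := by omega
        exact ⟨x, τ, r, h, k1, k2, hlr.symm.trans hl, rfl, Or.inl rfl⟩
      | tip _ h _ => rw [h, label_tip] at hl; omega
      | op _ h _ => rw [h] at hl; simp [label] at hl; omega
      | pq _ h _ => rw [h] at hl; simp [label] at hl; omega
    · cases hE with
      | @tr x τ j h hj =>
        obtain ⟨r, hr, hjr, hlr⟩ := h.eq_of_label_ne_zero (j := j) (by omega) (by omega)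
        obtain ⟨k1, k2⟩ := haux hr (hlr.symm.trans hl)
        subst hjr
        exact ⟨x, τ, r, h, k1, k2, hlr.symm.trans hl, rfl, Or.inr rfl⟩
      | @tip x _ _ h _ _ => rw [h, label_odd, letter_size] at hl; omega
      | op h _ _ => rw [h] at hl; simp [label] at hl; omega
      | pq h h' _ => rw [h] at hl; simp [label] at hl; omega
  have key := region_const S.conn (Core loc arm dep μ) (fun z => beyond μ (loc z)) arm ?_ ?_ ?_
    (z := τ (2 * size s x)) (z' := σ (2 * size s y)) (S.core_of_dep_zero hμ hx)
    (S.core_of_dep_zero hμ hy)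
  · have hend : ∀ {x : Option (Fin s)} {τ : ℕ → V}, Tr loc arm dep x τ →
        beyond μ (loc (τ (2 * size s x))) = x.map some := by
      intro x τ h
      have sx := one_le_size x
      rw [h.pt _ (by omega) (by omega)]
      cases x with
      | none =>
        refine if_neg ?_
        rintro ⟨r, hr, hl, -⟩
        simp only [size] at hr
        interval_cases r
        · rw [letter_zero] at hl; omega
        · have : letter s (none : Option (Fin s)) 1 = s + 2 := letter_size none
          omega
      | some i =>
        obtain ⟨r, h1, h2, h3⟩ := exists_letter_eq i hμ hμs
        exact beyond_pt_of_lt (r := r) (by simp [size]; omega) h3 (by simp [size]; omega)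
    simp only [hend hτ, hend hσ] at key
    cases x <;> cases y <;> simp_all
  · intro g g' hE hg hg'
    cases hE with
    | @tr x τ j h hj =>
      have hne : ∀ r, r ≤ size s x → letter s x r = μ → j ≠ 2 * r + 1 := by
        rintro r hr hl rfl
        exact not_core_of_label (by rw [h.label_odd hr, hl]) hg
      rcases Nat.eq_zero_or_pos j with rfl | hj'
      · rw [h.zero, h.pt 1 le_rfl (by omega)]
        refine (if_neg ?_).symm
        rintro ⟨r, -, -, h⟩
        omega
      · rw [h.pt j (by omega) (by omega), h.pt (j + 1) (by omega) (by omega)]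
        exact beyond_pt_succ hne
    | @tip x _ _ h h' _ =>
      simp only [h, h']
      refine beyond_pt_succ fun r hr hl hj => ?_
      have := (letter_eq_size_iff x hr).2 (by omega)
      omega
    | op h h' _ => simp [h, h', beyond]
    | pq h h' _ => simp [h, h', beyond]
  · intro g g' hE hg hg'
    exact S.arm_eq_of_not_core hμ hE.consec hg hg'
  · intro g g' h h' hg hg' hE hh hh' hE' ha
    obtain ⟨c, x, τ, r, hT, r1, r2, r3, rfl, c'⟩ := hcrossing g g' hg hg' hE
    obtain ⟨d, y, σ, q, hT', q1, q2, q3, rfl, d'⟩ := hcrossing h h' hh hh' hE'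
    obtain ⟨p1, p2⟩ := S.core_cross_posEq hμ hmiss c hg hg' d hh hh' ha
    obtain ⟨-, e2, e3, -⟩ := S.core_cross hμ hmiss c hg hg'
    obtain ⟨-, f2, f3, -⟩ := S.core_cross hμ hmiss d hh hh'
    have mixed : ∀ {x y : Option (Fin s)} {τ σ : ℕ → V} {r q : ℕ}, Tr loc arm dep x τ →
        Tr loc arm dep y σ → 1 ≤ r → r + 1 ≤ size s x → 1 ≤ q → q + 1 ≤ size s y →
        PosEq arm dep (τ (2 * r + 1)) (σ (2 * q + 1)) →
        1 ≤ dep (τ (2 * r)) → dep (τ (2 * r + 1)) = dep (τ (2 * r)) + 1 →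
        1 ≤ dep (σ (2 * q + 2)) → dep (σ (2 * q + 1)) = dep (σ (2 * q + 2)) + 1 → False := by
      intro x y τ σ r q hT hT' r1 r2 q1 q2 p1 e3 e2 f3 f2
      have hpos : ∀ t, r + t ≤ size s x → t ≤ q →
          letter s x (r + t) = letter s y (q - t) := by
        intro t ht ht'
        have o := S.letters_after hT r1 e3 e2 ht
        have i := S.letters_before hT' q2 f3 f2 ht'
        have := S.coh (τ (2 * (r + t) + 1)) (σ (2 * (q - t) + 1)) (by unfold PosEq at *; grind)
        rwa [hT.label_odd ht, hT'.label_odd (by omega)] at this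
      by_cases hle : size s x - r ≤ q
      · have := hpos (size s x - r) (by omega) hle
        rw [Nat.add_sub_cancel' (by omega), letter_size, eq_comm,
          letter_eq_size_iff y (by omega)] at this
        omega
      · have := hpos q (by omega) le_rfl
        rw [Nat.sub_self, letter_zero, letter_eq_zero_iff x (by omega)] at this
        omega
    have hout : ∀ {x : Option (Fin s)} {τ : ℕ → V} {r : ℕ}, Tr loc arm dep x τ → 1 ≤ r →
        r + 1 ≤ size s x → letter s x r = μ → beyond μ (loc (τ (2 * r))) = none := by
      intro x τ r hT h1 h2 h3
      rw [hT.pt _ (by omega) (by omega)]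
      exact beyond_pt_of_le (r := r) (by omega) h3 (by omega)
    have hin : ∀ {x : Option (Fin s)} {τ : ℕ → V} {r : ℕ}, Tr loc arm dep x τ → 1 ≤ r →
        r + 1 ≤ size s x → letter s x r = μ → beyond μ (loc (τ (2 * r + 2))) = some x := by
      intro x τ r hT h1 h2 h3
      rw [hT.pt _ (by omega) (by omega)]
      exact beyond_pt_of_lt (r := r) (by omega) h3 (by omega)
    rcases c' with rfl | rfl <;> rcases d' with rfl | rfl
    · rw [hout hT r1 r2 r3, hout hT' q1 q2 q3]
    · exact (mixed hT hT' r1 r2 q1 q2 p1 e3 e2 f3 f2).elim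
    · exact (mixed hT' hT q1 q2 r1 r2 p1.symm f3 f2 e3 e2).elim
    · rw [hin hT r1 r2 r3, hin hT' q1 q2 q3]
      have hpos : ∀ t, t ≤ r → t ≤ q → letter s x (r - t) = letter s y (q - t) := by
        intro t ht ht'
        have o := S.letters_before hT r2 e3 e2 ht
        have i := S.letters_before hT' q2 f3 f2 ht'
        have := S.coh (τ (2 * (r - t) + 1)) (σ (2 * (q - t) + 1)) (by unfold PosEq at *; grind)
        rwa [hT.label_odd (by omega), hT'.label_odd (by omega)] at this
      have hrq : r = q := by
        rcases le_total r q with hle | hle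
        · have := hpos r le_rfl hle
          rw [Nat.sub_self, letter_zero, eq_comm, letter_eq_zero_iff y (by omega)] at this
          omega
        · have := hpos q hle le_rfl
          rw [Nat.sub_self, letter_zero, letter_eq_zero_iff x (by omega)] at this
          omega
      subst hrq
      have := hpos (r - 1) (by omega) (by omega)
      rw [Nat.sub_sub_self r1] at this
      rw [letter_one_inj this]

/-- An arm is determined by the property that the last zero of its word is placed at the branch
point. -/
lemma eq_of_last_zero_center (S : IsSystem loc arm dep) [Fintype K]
    (hK : Fintype.card K ≤ s + 1) {x y : Option (Fin s)} {τ σ : ℕ → V}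
    (hτ : Tr loc arm dep x τ) (hσ : Tr loc arm dep y σ)
    (hx : dep (τ (2 * size s x)) = 0) (hy : dep (σ (2 * size s y)) = 0) : x = y := by
  obtain ⟨μ, h1, h2, hmiss⟩ := S.exists_missing hK
  rcases (show μ ≤ s ∨ μ = s + 1 ∨ μ = s + 2 by omega) with h | rfl | rfl
  · exact S.eq_of_missing_letter h1 h hmiss hτ hσ hx hy
  · exact S.eq_of_missing_first hmiss hτ hσ hx hy
  · exfalso
    have hl := hτ.label_odd (r := size s x) le_rfl
    rw [letter_size] at hl
    refine hmiss _ ?_ hl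
    have c := hτ.consec (2 * size s x) (by omega)
    unfold Consec at c
    omega

/-- The labels of the two last vertices of an arm carrying a word. -/
def IsLast (l : Loc s) : Prop := label l = s + 2 ∨ label l = s + 4

/-- Two vertices at the same position and labelled by `v_n` or `v_{n+2}` lie on the same arm. -/
lemma typ_eq_of_isLast (S : IsSystem loc arm dep) [Fintype K]
    (hK : Fintype.card K ≤ s + 1) {z z' : V} (hz : IsLast (loc z))
    (hpos : PosEq arm dep z z') : typ (loc z) = typ (loc z') := by
  have hd0 : ∀ w, IsLast (loc w) → 1 ≤ dep w := by
    intro w hw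
    by_contra h
    have := S.zero w (by omega)
    unfold IsLast at hw
    omega
  have hcoh : ∀ w w', PosEq arm dep w w' → IsLast (loc w) → IsLast (loc w') := by
    intro w w' h hw
    have := S.coh _ _ h
    unfold IsLast at *
    omega
  let k := arm z
  let d := dep z
  have hd : 1 ≤ d := hd0 z hz
  let R : V → Prop := fun w => arm w = k ∧ 1 ≤ dep w ∧ ∀ e, min d (dep w) ≤ e →
    e ≤ max d (dep w) → ∃ u, arm u = k ∧ dep u = e ∧ IsLast (loc u)
  have hRlast : ∀ w, R w → IsLast (loc w) := by
    rintro w ⟨h1, h2, h3⟩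
    obtain ⟨u, u1, u2, u3⟩ := h3 (dep w) (min_le_right _ _) (le_max_right _ _)
    exact hcoh u w ⟨u2, Or.inr (u1.trans h1.symm)⟩ u3
  have hRext : ∀ w w', R w → Consec arm dep w w' → IsLast (loc w') → R w' := by
    rintro w w' ⟨h1, h2, h3⟩ hc hw'
    have := hd0 w' hw'
    have harm : arm w' = k := by unfold Consec at hc; grind
    refine ⟨harm, this, fun e he he' => ?_⟩
    by_cases hew : e = dep w'
    · exact ⟨w', harm, hew.symm, hw'⟩
    · refine h3 e ?_ ?_ <;> unfold Consec at hc <;> omega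
  have hRz : ∀ w, PosEq arm dep z w → R w := by
    intro w hw
    have hw' := hcoh z w hw hz
    refine ⟨?_, hd0 w hw', fun e he he' => ⟨z, rfl, ?_, hz⟩⟩
    · have := hd0 z hz
      unfold PosEq at hw
      grind
    · have := hw.1
      omega
  have hcrossing : ∀ g g', R g → ¬ R g' → (Edge loc arm dep g g' ∨ Edge loc arm dep g' g) →
      ∃ x τ, Tr loc arm dep x τ ∧ g = τ (2 * size s x + 1) ∧ g' = τ (2 * size s x) := by
    intro g g' hg hg' hE
    have hc : Consec arm dep g g' := hE.elim Edge.consec fun h => h.consec.symm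
    have hl := hRlast g hg
    have hl' : ¬ IsLast (loc g') := fun h => hg' (hRext g g' hg hc h)
    rcases hE with hE | hE
    · cases hE with
      | @tr x τ j h hj =>
        have hl0 := hl
        unfold IsLast at hl0
        obtain ⟨r, hr, hjr, hlr⟩ := h.eq_of_label_ne_zero (j := j) (by omega) (by omega)
        have := letter_bounds x hr
        have := (letter_eq_size_iff x hr).1 (by omega)
        omega
      | tip _ h _ => exact absurd (Or.inr (by rw [h, label_tip])) hl'
      | op h _ _ => rw [h] at hl; simp [IsLast, label] at hl
      | pq h _ _ => rw [h] at hl; simp [IsLast, label] at hl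
    · cases hE with
      | @tr x τ j h hj =>
        have hl0 := hl
        unfold IsLast at hl0
        obtain ⟨r, hr, hjr, hlr⟩ := h.eq_of_label_ne_zero (j := j + 1) (by omega) (by omega)
        have := letter_bounds x hr
        have := (letter_eq_size_iff x hr).1 (by omega)
        obtain rfl : j = 2 * size s x := by omega
        exact ⟨x, τ, h, rfl, rfl⟩
      | tip h _ _ => exact absurd (Or.inl (by rw [h, label_odd, letter_size])) hl'
      | op _ h _ => rw [h] at hl; simp [IsLast, label] at hl
      | pq _ h _ => rw [h] at hl; simp [IsLast, label] at hl
  refine region_const S.conn R (fun w => typ (loc w)) (fun w => arm w = k ∧ d < dep w) ?_ ?_ ?_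
    (hRz z ⟨rfl, Or.inr rfl⟩) (hRz z' hpos)
  · intro g g' hE hg hg'
    have hl := hRlast g hg
    cases hE with
    | @tr x τ j h hj =>
      rcases Nat.eq_zero_or_pos j with rfl | hj'
      · rw [h.zero] at hl; simp [IsLast, label] at hl
      · simp [h.pt j (by omega) (by omega), h.pt (j + 1) (by omega) (by omega), typ]
    | tip h h' _ => simp [h, h', typ]
    | op h _ _ => rw [h] at hl; simp [IsLast, label] at hl
    | pq h _ _ => rw [h] at hl; simp [IsLast, label] at hl
  · have aux : ∀ g g', Consec arm dep g g' → ¬ R g' → arm g = k ∧ d < dep g →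
        arm g' = k ∧ d < dep g' := by
      rintro g g' hc hg' ⟨h1, h2⟩
      have harm : arm g' = k := by unfold Consec at hc; grind
      refine ⟨harm, ?_⟩
      by_contra hcon
      refine hg' (hRz g' ⟨?_, Or.inr harm.symm⟩)
      unfold Consec at hc
      change d = dep g'
      omega
    intro g g' hE hg hg'
    exact propext ⟨aux g g' hE.consec hg', aux g' g hE.consec.symm hg⟩
  · intro g g' h h' hg hg' hE hh hh' hE' hcomp
    obtain ⟨x, τ, hT, rfl, rfl⟩ := hcrossing g g' hg hg' hE
    obtain ⟨y, σ, hT', rfl, rfl⟩ := hcrossing h h' hh hh' hE'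
    have c := hT.consec (2 * size s x) (by omega)
    have c' := hT'.consec (2 * size s y) (by omega)
    have l : ¬ IsLast (loc (τ (2 * size s x))) := by
      simp [IsLast, hT.label_even (r := size s x) le_rfl]
    have l' : ¬ IsLast (loc (σ (2 * size s y))) := by
      simp [IsLast, hT'.label_even (r := size s y) le_rfl]
    have nolast : ∀ g g', R g → ¬ IsLast (loc g') → arm g' = k → dep g' < min d (dep g) ∨
        max d (dep g) < dep g' := by
      rintro g g' ⟨h1, h2, h3⟩ hl ha
      by_contra hcon
      obtain ⟨u, u1, u2, u3⟩ := h3 (dep g') (by omega) (by omega)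
      exact hl (hcoh u g' ⟨u2, Or.inr (u1.trans ha.symm)⟩ u3)
    have n1 := nolast _ _ hg l
    have n2 := nolast _ _ hg l'
    have n3 := nolast _ _ hh l
    have n4 := nolast _ _ hh l'
    have a1 := hg.1
    have a2 := hh.1
    have b1 := hg.2.1
    have b2 := hh.2.1
    have hkey : PosEq arm dep (τ (2 * size s x)) (σ (2 * size s y)) ∧
        (dep (τ (2 * size s x + 1)) = dep (σ (2 * size s y + 1))) := by
      have hcomp' : (arm (τ (2 * size s x)) = k ∧ d < dep (τ (2 * size s x))) ↔
          (arm (σ (2 * size s y)) = k ∧ d < dep (σ (2 * size s y))) := by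
        simpa using hcomp
      unfold Consec at c c'
      rw [a1] at c
      rw [a2] at c'
      unfold PosEq
      by_cases A : arm (τ (2 * size s x)) = k <;> by_cases B : arm (σ (2 * size s y)) = k <;>
        simp only [A, B, true_and, false_and, or_true, or_false, and_true, forall_const,
          false_iff, iff_false] at * <;> omega
    obtain ⟨p1, p2⟩ := hkey
    have goal : x = y := by
      by_cases h0 : dep (τ (2 * size s x)) = 0
      · exact S.eq_of_last_zero_center hK hT hT' h0 (p1.1 ▸ h0)
      · have sx := one_le_size x
        have sy := one_le_size y
        have e1 : 2 * (size s x - 1) + 1 + 1 = 2 * size s x := by omega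
        have e2 : 2 * (size s y - 1) + 1 + 1 = 2 * size s y := by omega
        have k1 := hT.consec (2 * (size s x - 1) + 1) (by omega)
        have k2 := hT'.consec (2 * (size s y - 1) + 1) (by omega)
        have m1 := hT.label_odd_ne (r := size s x) (r' := size s x - 1) le_rfl (by omega)
          (by omega)
        have m2 := hT'.label_odd_ne (r := size s y) (r' := size s y - 1) le_rfl (by omega)
          (by omega)
        rw [e1] at k1
        rw [e2] at k2
        have o1 := mt (S.coh _ _) m1
        have o2 := mt (S.coh _ _) m2
        have k3 : PosEq arm dep (τ (2 * (size s x - 1) + 1)) (σ (2 * (size s y - 1) + 1)) := by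
          unfold PosEq at *
          unfold Consec at *
          grind
        have := S.coh _ _ k3
        rw [hT.label_odd (by omega), hT'.label_odd (by omega)] at this
        exact letter_last_inj this
    rw [hT.pt (2 * size s x + 1) (by omega) (by omega),
      hT'.pt (2 * size s y + 1) (by omega) (by omega), goal]

/-! ### Collapsing onto the vertices of `X_0` -/

/-- The labels of the vertices of `X_0` other than `v_0`, `v_{n-1}` and the proper letters. -/
def IsEnd (l : Loc s) : Prop := s + 2 ≤ label l

/-- There is a vertex of `X_1` with an end label at the given position. -/
def EndAt (loc : V → Loc s) (arm : V → K) (dep : V → ℕ) (k : K) (e : ℕ) : Prop :=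
  ∃ u, arm u = k ∧ dep u = e ∧ IsEnd (loc u)

open Classical in
/-- The depth after moving every vertex without an end label just above the last end label
below it. -/
noncomputable def snap (loc : V → Loc s) (arm : V → K) (dep : V → ℕ) (z : V) : ℕ :=
  if IsEnd (loc z) then dep z
  else if Nat.findGreatest (EndAt loc arm dep (arm z)) (dep z) = 0 then 0
  else Nat.findGreatest (EndAt loc arm dep (arm z)) (dep z) + 1

lemma snap_of_isEnd {z : V} (h : IsEnd (loc z)) : snap loc arm dep z = dep z := if_pos h

lemma dep_pos_of_isEnd (S : IsSystem loc arm dep) {z : V} (h : IsEnd (loc z)) :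
    1 ≤ dep z := by
  by_contra h0
  have := S.zero z (by omega)
  unfold IsEnd at h
  omega

lemma isEnd_congr (S : IsSystem loc arm dep) {z z' : V} (h : PosEq arm dep z z') :
    IsEnd (loc z) ↔ IsEnd (loc z') := by
  rw [IsEnd, IsEnd, S.coh z z' h]

lemma not_endAt (S : IsSystem loc arm dep) {z : V} (h : ¬ IsEnd (loc z)) {k : K} {e : ℕ}
    (hk : arm z = k) (he : dep z = e) : ¬ EndAt loc arm dep k e := by
  rintro ⟨u, hu, hu', hu''⟩
  exact h ((S.isEnd_congr ⟨hu'.trans he.symm, Or.inr (hu.trans hk.symm)⟩).1 hu'')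

lemma endAt_pos (S : IsSystem loc arm dep) {k : K} {e : ℕ} (h : EndAt loc arm dep k e) :
    1 ≤ e := by
  obtain ⟨u, -, rfl, hu⟩ := h
  exact S.dep_pos_of_isEnd hu

lemma snap_cases (S : IsSystem loc arm dep) {z : V} (h : ¬ IsEnd (loc z)) :
    (snap loc arm dep z = 0 ∧ ∀ e, e ≤ dep z → ¬ EndAt loc arm dep (arm z) e) ∨
    ∃ e, 1 ≤ e ∧ e < dep z ∧ EndAt loc arm dep (arm z) e ∧ snap loc arm dep z = e + 1 ∧
      ∀ e', e < e' → e' ≤ dep z → ¬ EndAt loc arm dep (arm z) e' := by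
  classical
  by_cases h0 : Nat.findGreatest (EndAt loc arm dep (arm z)) (dep z) = 0
  · refine Or.inl ⟨by simp [snap, h, h0], fun e he hE => ?_⟩
    have := S.endAt_pos hE
    exact Nat.findGreatest_eq_zero_iff.1 h0 (by omega) he hE
  · have hE := Nat.findGreatest_of_ne_zero rfl h0
    have hle := Nat.findGreatest_le (P := EndAt loc arm dep (arm z)) (dep z)
    refine Or.inr ⟨_, S.endAt_pos hE, lt_of_le_of_ne hle fun he => ?_, hE, by simp [snap, h, h0],
      fun e' h1 h2 => Nat.findGreatest_is_greatest h1 h2⟩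
    rw [he] at hE
    exact S.not_endAt h rfl rfl hE

lemma snap_posEq (S : IsSystem loc arm dep) {z z' : V} (hc : Consec arm dep z z')
    (h : ¬ IsEnd (loc z)) (h' : ¬ IsEnd (loc z')) :
    PosEq arm (snap loc arm dep) z z' := by
  wlog hd : dep z' = dep z + 1 generalizing z z'
  · refine (this hc.symm h' h ?_).symm
    unfold Consec at hc
    omega
  have ha : dep z = 0 ∨ arm z = arm z' := by unfold Consec at hc; grind
  have hn := S.not_endAt h' rfl rfl
  rcases S.snap_cases h with ⟨e1, f1⟩ | ⟨e, e1, e2, e3, e4, e5⟩ <;>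
    rcases S.snap_cases h' with ⟨g1, k1⟩ | ⟨g, g1, g2, g3, g4, g5⟩
  · exact ⟨by omega, Or.inl e1⟩
  · rcases ha with ha | ha
    · omega
    · exact absurd (ha ▸ g3) (f1 g (by omega))
  · exact absurd ((show arm z = arm z' by grind) ▸ e3) (k1 e (by omega))
  · have ha : arm z = arm z' := by grind
    refine ⟨?_, Or.inr ha⟩
    rw [ha] at e3 e5
    have h1 : ¬ e < g := fun hlt => e5 g hlt (by omega) g3
    have h2 : ¬ g < e := fun hlt => g5 e hlt (by omega) e3
    omega

/-- The arms on which the vertex `v_n` of the word is a vertex of `X_0`. -/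
def Full (x : Option (Fin s)) : Prop := ∀ i, x = some i → (i : ℕ) + 1 = s

/-- The vertices of `X_1` which are vertices of `X_0`. -/
def Coarse (l : Loc s) : Prop :=
  l = Loc.O ∨ l = Loc.q ∨ (∃ x, l = Loc.pt x (2 * size s x + 2)) ∨
    ∃ x, Full x ∧ l = Loc.pt x (2 * size s x + 1)

lemma Coarse.cases {l : Loc s} (h : Coarse l) : l = Loc.O ∨ IsEnd l := by
  rcases h with h | rfl | ⟨x, rfl⟩ | ⟨x, -, rfl⟩
  · exact Or.inl h
  · exact Or.inr (by simp [IsEnd, label])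
  · exact Or.inr (by rw [IsEnd, label_tip]; omega)
  · exact Or.inr (by rw [IsEnd, label_odd, letter_size])

lemma not_isEnd_O : ¬ IsEnd (Loc.O : Loc s) := by simp [IsEnd, label]

/-- `z` lies below `z'` and no vertex of `X_0` lies strictly between them. -/
def Gap (loc : V → Loc s) (arm : V → K) (dep : V → ℕ) (z z' : V) : Prop :=
  snap loc arm dep z < snap loc arm dep z' ∧ (snap loc arm dep z = 0 ∨ arm z = arm z') ∧
    ∀ w, Coarse (loc w) → arm w = arm z' → snap loc arm dep z < snap loc arm dep w →
      snap loc arm dep w < snap loc arm dep z' → False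

lemma Gap.congr_left {z w z' : V} (hp : PosEq arm (snap loc arm dep) z w)
    (h : Gap loc arm dep z z') : Gap loc arm dep w z' := by
  obtain ⟨h1, h2, h3⟩ := h
  refine ⟨hp.1 ▸ h1, ?_, ?_⟩
  · unfold PosEq at hp; grind
  · rwa [← hp.1]

lemma Gap.congr_right {z w z' : V} (hp : PosEq arm (snap loc arm dep) z w)
    (h : Gap loc arm dep z' z) : Gap loc arm dep z' w := by
  obtain ⟨h1, h2, h3⟩ := h
  have ha : arm z = arm w := by unfold PosEq at hp; grind
  exact ⟨hp.1 ▸ h1, ha ▸ h2, by rwa [← hp.1, ← ha]⟩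

lemma gap_out (S : IsSystem loc arm dep) {z z' : V} (hc : Consec arm dep z z')
    (h : ¬ IsEnd (loc z)) (h' : IsEnd (loc z')) (hd : dep z' = dep z + 1) :
    Gap loc arm dep z z' := by
  have hs := snap_of_isEnd (arm := arm) (dep := dep) h'
  have ha : dep z = 0 ∨ arm z = arm z' := by unfold Consec at hc; grind
  have key : ∀ e, snap loc arm dep z ≤ e → e ≤ dep z → ¬ EndAt loc arm dep (arm z') e := by
    intro e he he' hE
    have hpos := S.endAt_pos hE
    rcases ha with ha | ha
    · omega
    · rw [← ha] at hE
      rcases S.snap_cases h with ⟨-, f1⟩ | ⟨e', -, e2, -, e4, e5⟩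
      · exact f1 e he' hE
      · exact e5 e (by omega) he' hE
  refine ⟨?_, ?_, fun w hw hwa h1 h2 => ?_⟩
  · rcases S.snap_cases h with ⟨f, -⟩ | ⟨e', -, e2, -, e4, e5⟩ <;> omega
  · rcases ha with ha | ha
    · rcases S.snap_cases h with ⟨f, -⟩ | ⟨e', -, e2, -, e4, e5⟩ <;> omega
    · exact Or.inr ha
  · by_cases hwE : IsEnd (loc w)
    · rw [snap_of_isEnd hwE] at h1 h2
      exact key _ h1.le (by omega) ⟨w, hwa, rfl, hwE⟩
    · rcases S.snap_cases hwE with ⟨f, -⟩ | ⟨e', -, -, e3, e4, -⟩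
      · omega
      · rw [hwa] at e3
        exact key e' (by omega) (by omega) e3

lemma snap_of_in (S : IsSystem loc arm dep) {z z' : V} (hc : Consec arm dep z z')
    (h : ¬ IsEnd (loc z)) (h' : IsEnd (loc z')) (hd : dep z = dep z' + 1) :
    snap loc arm dep z = dep z' + 1 ∧ arm z = arm z' := by
  have hpos := S.dep_pos_of_isEnd h'
  have ha : arm z = arm z' := by unfold Consec at hc; grind
  have hE : EndAt loc arm dep (arm z) (dep z') := ⟨z', ha.symm, rfl, h'⟩
  refine ⟨?_, ha⟩
  rcases S.snap_cases h with ⟨-, f1⟩ | ⟨e, -, e2, -, e4, e5⟩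
  · exact absurd hE (f1 _ (by omega))
  · by_contra hne
    exact e5 (dep z') (by omega) (by omega) hE

lemma gap_of_consec (S : IsSystem loc arm dep) {z z' : V} (hc : Consec arm dep z z')
    (h : ¬ IsEnd (loc z)) (h' : IsEnd (loc z')) :
    Gap loc arm dep z z' ∨ Gap loc arm dep z' z := by
  rcases hc.imp And.left And.left with hd | hd
  · exact Or.inl (S.gap_out hc h h' hd)
  · obtain ⟨h1, h2⟩ := S.snap_of_in hc h h' hd
    refine Or.inr ⟨?_, Or.inr h2.symm, fun w _ _ h3 h4 => ?_⟩ <;>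
      rw [snap_of_isEnd h'] at * <;> omega

lemma not_coarse_of_posEq (S : IsSystem loc arm dep) [Fintype K] (hK : Fintype.card K ≤ s + 1)
    {x : Option (Fin s)} (hx : ¬ Full x) {g w : V} (hg : loc g = Loc.pt x (2 * size s x + 1))
    (hw : Coarse (loc w)) (ha : arm w = arm g) (hd : snap loc arm dep w = dep g) : False := by
  have hlab : label (loc g) = s + 2 := by rw [hg, label_odd, letter_size]
  have hgE : IsEnd (loc g) := by rw [IsEnd, hlab]
  by_cases hwE : IsEnd (loc w)
  · have hp : PosEq arm dep g w := ⟨by rw [← hd, snap_of_isEnd hwE], Or.inr ha.symm⟩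
    have hl := (S.coh g w hp).symm.trans hlab
    have ht := S.typ_eq_of_isLast hK (Or.inl hlab) hp
    rcases hw with hw | hw | ⟨y, hw⟩ | ⟨y, hy, hw⟩
    · rw [hw] at hl; simp [label] at hl
    · rw [hw] at hl; simp [label] at hl
    · rw [hw, label_tip] at hl; omega
    · rw [hg, hw] at ht
      simp only [typ, Option.some.injEq] at ht
      exact hx (ht ▸ hy)
  · have := S.dep_pos_of_isEnd hgE
    rcases S.snap_cases hwE with ⟨f, -⟩ | ⟨e, -, e2, e3, e4, e5⟩
    · omega
    · exact e5 (dep g) (by omega) (by omega) ⟨g, ha.symm, rfl, hgE⟩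

lemma gap_of_tip (S : IsSystem loc arm dep) [Fintype K] (hK : Fintype.card K ≤ s + 1)
    {x : Option (Fin s)} (hx : ¬ Full x) {z g z' : V} (hz : label (loc z) = 0)
    (hg : loc g = Loc.pt x (2 * size s x + 1)) (hz' : loc z' = Loc.pt x (2 * size s x + 2))
    (hc : Consec arm dep z g) (hc' : Consec arm dep g z') :
    Gap loc arm dep z z' ∨ Gap loc arm dep z' z := by
  have hlab : label (loc g) = s + 2 := by rw [hg, label_odd, letter_size]
  have hlab' : label (loc z') = s + 4 := by rw [hz', label_tip]
  have hgE : IsEnd (loc g) := by rw [IsEnd, hlab]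
  have hzE : ¬ IsEnd (loc z) := by rw [IsEnd, hz]; omega
  have hzE' : IsEnd (loc z') := by rw [IsEnd, hlab']; omega
  have p1 := S.dep_pos_of_isEnd hgE
  have p2 := S.dep_pos_of_isEnd hzE'
  have ha : arm g = arm z' := by unfold Consec at hc'; grind
  have sg := snap_of_isEnd (arm := arm) (dep := dep) hgE
  have sz := snap_of_isEnd (arm := arm) (dep := dep) hzE'
  rcases hc.imp And.left And.left with hd | hd
  · have hd' : dep z' = dep g + 1 :=
      S.straight_out hc hc' (by omega) hd
    obtain ⟨g1, g2, g3⟩ := S.gap_out hc hzE hgE hd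
    refine Or.inl ⟨by omega, ha ▸ g2, fun w hw hwa h1 h2 => ?_⟩
    rcases (show snap loc arm dep w < snap loc arm dep g ∨ snap loc arm dep w = dep g by omega)
      with h | h
    · exact g3 w hw (hwa.trans ha.symm) h1 h
    · exact S.not_coarse_of_posEq hK hx hg hw (hwa.trans ha.symm) h
  · have hd' : dep g = dep z' + 1 := S.straight_in hc hc' (by omega) p1 hd
    obtain ⟨g1, g2⟩ := S.snap_of_in hc hzE hgE hd
    refine Or.inr ⟨by omega, Or.inr (g2.trans ha).symm, fun w hw hwa h1 h2 => ?_⟩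
    exact S.not_coarse_of_posEq hK hx hg hw (hwa.trans g2) (by omega)

/-- The edges between vertices of `X_0`, seen through the elementary edges of `X_1`. -/
inductive CoarseEdge (loc : V → Loc s) (arm : V → K) (dep : V → ℕ) : V → V → Prop
  | full {x τ} : Full x → Tr loc arm dep x τ →
      CoarseEdge loc arm dep (τ 0) (τ (2 * size s x + 1))
  | whole {x τ z'} : ¬ Full x → Tr loc arm dep x τ → loc z' = Loc.pt x (2 * size s x + 2) →
      Consec arm dep (τ (2 * size s x + 1)) z' → CoarseEdge loc arm dep (τ 0) z'
  | tip {x z z'} : Full x → loc z = Loc.pt x (2 * size s x + 1) →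
      loc z' = Loc.pt x (2 * size s x + 2) → Consec arm dep z z' → CoarseEdge loc arm dep z z'
  | short {o p q} : loc o = Loc.O → loc p = Loc.p → loc q = Loc.q → Consec arm dep o p →
      Consec arm dep p q → CoarseEdge loc arm dep o q

lemma Tr.snap_posEq (S : IsSystem loc arm dep) {x : Option (Fin s)} {τ : ℕ → V}
    (h : Tr loc arm dep x τ) {j : ℕ} (hj : j ≤ 2 * size s x) :
    PosEq arm (snap loc arm dep) (τ 0) (τ j) := by
  have hne : ∀ j, j ≤ 2 * size s x → ¬ IsEnd (loc (τ j)) := by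
    intro j hj hE
    have hE' := hE
    unfold IsEnd at hE'
    obtain ⟨r, hr, hjr, hl⟩ := h.eq_of_label_ne_zero (j := j) (by omega) (by omega)
    have := letter_bounds x hr
    have := (letter_eq_size_iff x hr).1 (by omega)
    omega
  induction j with
  | zero => exact ⟨rfl, Or.inr rfl⟩
  | succ j ih =>
    have h1 := ih (by omega)
    have h2 := S.snap_posEq (h.consec j (by omega)) (hne j (by omega)) (hne _ hj)
    unfold PosEq at *
    grind

lemma CoarseEdge.gap (S : IsSystem loc arm dep) [Fintype K] (hK : Fintype.card K ≤ s + 1)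
    {z z' : V} (h : CoarseEdge loc arm dep z z') :
    Gap loc arm dep z z' ∨ Gap loc arm dep z' z := by
  cases h with
  | @full x τ hx hT =>
    have hp := (Tr.snap_posEq S hT (j := 2 * size s x) le_rfl).symm
    have hl := hT.label_even (r := size s x) le_rfl
    have hl' := hT.label_odd (r := size s x) le_rfl
    rw [letter_size] at hl'
    exact (S.gap_of_consec (hT.consec (2 * size s x) (by omega)) (by rw [IsEnd, hl]; omega)
      (by rw [IsEnd, hl'])).imp (Gap.congr_left hp) (Gap.congr_right hp)
  | @whole x τ z' hx hT hz' hc =>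
    have hp := (Tr.snap_posEq S hT (j := 2 * size s x) le_rfl).symm
    have hl := hT.label_even (r := size s x) le_rfl
    exact (S.gap_of_tip hK hx hl (hT.pt (2 * size s x + 1) (by omega) (by omega)) hz'
      (hT.consec _ (by omega)) hc).imp (Gap.congr_left hp) (Gap.congr_right hp)
  | @tip x z z' hx hz hz' hc =>
    have hE : IsEnd (loc z) := by rw [IsEnd, hz, label_odd, letter_size]
    have hE' : IsEnd (loc z') := by rw [IsEnd, hz', label_tip]; omega
    have e := snap_of_isEnd (arm := arm) (dep := dep) hE
    have e' := snap_of_isEnd (arm := arm) (dep := dep) hE'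
    rcases hc with ⟨h1, h2⟩ | ⟨h1, h2⟩
    · exact Or.inl ⟨by omega, by grind, fun w _ _ _ _ => by omega⟩
    · exact Or.inr ⟨by omega, by grind, fun w _ _ _ _ => by omega⟩
  | @short o p q ho hp hq hop hpq =>
    have hoE : ¬ IsEnd (loc z) := by rw [ho]; exact not_isEnd_O
    have hpE : ¬ IsEnd (loc p) := by rw [hp]; simp [IsEnd, label]
    have hqE : IsEnd (loc z') := by rw [hq]; simp [IsEnd, label]
    have hpos := S.snap_posEq hop.symm hpE hoE
    exact (S.gap_of_consec hpq hpE hqE).imp (Gap.congr_left hpos) (Gap.congr_right hpos)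

lemma loc_eq_of_snap_posEq (S : IsSystem loc arm dep) [Fintype K] (hK : Fintype.card K ≤ s + 1)
    {z z' : V} (hz : Coarse (loc z)) (hz' : Coarse (loc z'))
    (hp : PosEq arm (snap loc arm dep) z z') : loc z = loc z' := by
  have mixed : ∀ {z z' : V}, loc z = Loc.O → IsEnd (loc z') →
      ¬ PosEq arm (snap loc arm dep) z z' := by
    intro z z' hO hE hp
    have hn : ¬ IsEnd (loc z) := by rw [hO]; exact not_isEnd_O
    have h1 := S.dep_pos_of_isEnd hE
    have h2 := snap_of_isEnd (arm := arm) (dep := dep) hE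
    have ha : arm z = arm z' := by unfold PosEq at hp; grind
    have hd := hp.1
    rcases S.snap_cases hn with ⟨f, -⟩ | ⟨e, -, e2, -, e4, e5⟩
    · omega
    · exact e5 (dep z') (by omega) (by omega) ⟨z', ha.symm, rfl, hE⟩
  rcases hz.cases with hO | hE <;> rcases hz'.cases with hO' | hE'
  · rw [hO, hO']
  · exact absurd hp (mixed hO hE')
  · exact absurd hp.symm (mixed hO' hE)
  · have hp' : PosEq arm dep z z' := by
      unfold PosEq at *
      rwa [snap_of_isEnd hE, snap_of_isEnd hE'] at hp
    have hl := S.coh _ _ hp'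
    have aux : ∀ {z : V}, Coarse (loc z) → IsEnd (loc z) →
        (loc z = Loc.q ∧ label (loc z) = s + 3) ∨
        (∃ x, loc z = Loc.pt x (2 * size s x + 2) ∧ label (loc z) = s + 4) ∨
        (∃ x, loc z = Loc.pt x (2 * size s x + 1) ∧ label (loc z) = s + 2) := by
      rintro z (h | h | ⟨x, h⟩ | ⟨x, -, h⟩) hE
      · rw [h] at hE; exact absurd hE not_isEnd_O
      · exact Or.inl ⟨h, by rw [h]; rfl⟩
      · exact Or.inr (Or.inl ⟨x, h, by rw [h, label_tip]⟩)
      · exact Or.inr (Or.inr ⟨x, h, by rw [h, label_odd, letter_size]⟩)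
    rcases aux hz hE with ⟨h, l⟩ | ⟨x, h, l⟩ | ⟨x, h, l⟩ <;>
      rcases aux hz' hE' with ⟨h', l'⟩ | ⟨x', h', l'⟩ | ⟨x', h', l'⟩ <;> try omega
    · rw [h, h']
    · have := S.typ_eq_of_isLast hK (Or.inr l) hp'
      rw [h, h'] at this ⊢
      simp only [typ, Option.some.injEq] at this
      rw [this]
    · have := S.typ_eq_of_isLast hK (Or.inl l) hp'
      rw [h, h'] at this ⊢
      simp only [typ, Option.some.injEq] at this
      rw [this]

open Classical in
/-- The depth counted along the vertices of `X_0` only. -/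
noncomputable def rank (loc : V → Loc s) (arm : V → K) (dep : V → ℕ) (z : V) : ℕ :=
  Nat.count (fun e => ∃ w, Coarse (loc w) ∧ arm w = arm z ∧ snap loc arm dep w = e + 1)
    (snap loc arm dep z)

lemma count_eq_of_forall_not {p : ℕ → Prop} [DecidablePred p] {a b : ℕ} (hab : a ≤ b)
    (h : ∀ e, a ≤ e → e < b → ¬ p e) : Nat.count p b = Nat.count p a := by
  induction b, hab using Nat.le_induction with
  | base => rfl
  | succ b hb ih =>
    rw [Nat.count_succ, if_neg (h b hb (by omega)), ih fun e h1 h2 => h e h1 (by omega)]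
    rfl

lemma Gap.rank_eq {z z' : V} (hz' : Coarse (loc z')) (h : Gap loc arm dep z z') :
    rank loc arm dep z' = rank loc arm dep z + 1 ∧
      (rank loc arm dep z = 0 ∨ arm z = arm z') := by
  classical
  obtain ⟨h1, h2, h3⟩ := h
  obtain ⟨m, hm⟩ : ∃ m, snap loc arm dep z' = m + 1 := ⟨snap loc arm dep z' - 1, by omega⟩
  have h0 : snap loc arm dep z = 0 → rank loc arm dep z = 0 := by
    intro h0
    rw [rank, h0, Nat.count_zero]
  refine ⟨?_, h2.imp_left h0⟩
  have e1 : rank loc arm dep z' = Nat.count (fun e => ∃ w, Coarse (loc w) ∧ arm w = arm z' ∧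
      snap loc arm dep w = e + 1) (snap loc arm dep z) + 1 := by
    rw [rank, hm, Nat.count_succ, if_pos ⟨z', hz', rfl, hm⟩]
    rw [count_eq_of_forall_not (a := snap loc arm dep z) (by omega)]
    rintro e he he' ⟨w, w1, w2, w3⟩
    exact h3 w w1 w2 (by omega) (by omega)
  rw [e1]
  rcases h2 with h2 | h2
  · rw [h0 h2, h2, Nat.count_zero]
  · rw [rank, h2]

lemma rank_lt {z z' : V} (hz' : Coarse (loc z')) (ha : arm z = arm z')
    (h : snap loc arm dep z < snap loc arm dep z') :
    rank loc arm dep z < rank loc arm dep z' := by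
  classical
  obtain ⟨m, hm⟩ : ∃ m, snap loc arm dep z' = m + 1 := ⟨snap loc arm dep z' - 1, by omega⟩
  rw [rank, rank, hm, Nat.count_succ, if_pos ⟨z', hz', rfl, hm⟩, ha]
  exact Nat.lt_succ_of_le (Nat.count_monotone _ (by omega))

lemma snap_eq_zero_of_rank {z : V} (hz : Coarse (loc z)) (h : rank loc arm dep z = 0) :
    snap loc arm dep z = 0 := by
  classical
  by_contra h0
  obtain ⟨m, hm⟩ : ∃ m, snap loc arm dep z = m + 1 := ⟨snap loc arm dep z - 1, by omega⟩
  rw [rank, hm, Nat.count_succ, if_pos ⟨z, hz, rfl, hm⟩] at h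
  omega

lemma consec_rank (S : IsSystem loc arm dep) [Fintype K] (hK : Fintype.card K ≤ s + 1) {z z' : V}
    (hz : Coarse (loc z)) (hz' : Coarse (loc z')) (h : CoarseEdge loc arm dep z z') :
    Consec arm (rank loc arm dep) z z' :=
  (h.gap S hK).imp (Gap.rank_eq hz') fun g =>
    ⟨(Gap.rank_eq hz g).1, (Gap.rank_eq hz g).2.imp_right Eq.symm⟩

lemma loc_eq_of_rank_posEq (S : IsSystem loc arm dep) [Fintype K] (hK : Fintype.card K ≤ s + 1)
    {z z' : V} (hz : Coarse (loc z)) (hz' : Coarse (loc z'))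
    (hp : PosEq arm (rank loc arm dep) z z') : loc z = loc z' := by
  refine S.loc_eq_of_snap_posEq hK hz hz' ?_
  obtain ⟨h1, h2 | h2⟩ := hp
  · have e1 := snap_eq_zero_of_rank hz h2
    have e2 := snap_eq_zero_of_rank hz' (h1 ▸ h2)
    exact ⟨e1.trans e2.symm, Or.inl e1⟩
  · refine ⟨?_, Or.inr h2⟩
    rcases lt_trichotomy (snap loc arm dep z) (snap loc arm dep z') with h | h | h
    · exact absurd h1 (rank_lt hz' h2 h).ne
    · exact h
    · exact absurd h1.symm (rank_lt hz h2.symm h).ne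

lemma loc_eq_of_rank_zero (S : IsSystem loc arm dep) {z : V} (hz : Coarse (loc z))
    (h : rank loc arm dep z = 0) : loc z = Loc.O := by
  refine hz.cases.resolve_right fun hE => ?_
  have h1 := snap_eq_zero_of_rank hz h
  rw [snap_of_isEnd hE] at h1
  have := S.dep_pos_of_isEnd hE
  omega

end IsSystem

end System

end OdWord

/-! ## The bonding map in coordinates -/

namespace OdMap

open OdWord Set

lemma norm_embC (n : ℕ) (p : ℕ × ℝ) : ‖embC n p‖ = min 1 (max 0 p.2) := by
  have h : (2 * Real.pi * Complex.I * (p.1 : ℂ) / (n : ℂ)) =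
      ((2 * Real.pi * p.1 / n : ℝ) : ℂ) * Complex.I := by push_cast; ring
  rw [embC, norm_mul, h, Complex.norm_exp_ofReal_mul_I, mul_one, Complex.norm_real,
    Real.norm_of_nonneg (le_min zero_le_one (le_max_left _ _))]

lemma embC_eq_zero {n : ℕ} {p : ℕ × ℝ} (h : min 1 (max 0 p.2) = 0) : embC n p = 0 := by
  rw [embC, h]; simp

lemma embC_inj {n : ℕ} (hn : 0 < n) {p q : ℕ × ℝ} (h : embC n p = embC n q) :
    min 1 (max 0 p.2) = min 1 (max 0 q.2) ∧
      (min 1 (max 0 p.2) = 0 ∨ p.1 % n = q.1 % n) := by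
  have h1 : min 1 (max 0 p.2) = min 1 (max 0 q.2) := by rw [← norm_embC n, ← norm_embC n, h]
  refine ⟨h1, or_iff_not_imp_left.2 fun h0 => ?_⟩
  rw [embC, embC, ← h1] at h
  have h2 := mul_left_cancel₀ (by exact_mod_cast h0) h
  obtain ⟨k, hk⟩ := Complex.exp_eq_exp_iff_exists_int.1 h2
  have hnC : (n : ℂ) ≠ 0 := by exact_mod_cast hn.ne'
  have hpi : (2 * Real.pi * Complex.I : ℂ) ≠ 0 := Complex.two_pi_I_ne_zero
  have h3 : (p.1 : ℂ) = q.1 + k * n := by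
    field_simp at hk
    have hpi' : (2 * (Real.pi : ℂ)) ≠ 0 := by
      intro h; rw [h] at hpi; simp at hpi
    have hI := Complex.I_ne_zero
    apply mul_left_cancel₀ hpi
    linear_combination (2 * (Real.pi : ℂ) * Complex.I) * hk
  have h4 : (p.1 : ℤ) = q.1 + k * n := by exact_mod_cast h3
  have h5 : (p.1 : ℤ) % n = q.1 % n := by rw [h4, Int.add_mul_emod_self_right]
  exact_mod_cast h5

lemma embC_congr {n : ℕ} {p q : ℕ × ℝ}
    (h1 : min 1 (max 0 p.2) = min 1 (max 0 q.2))
    (h2 : min 1 (max 0 p.2) = 0 ∨ p.1 = q.1) : embC n p = embC n q := by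
  rcases h2 with h2 | h2
  · rw [embC_eq_zero h2, embC_eq_zero (h1 ▸ h2)]
  · rw [embC, embC, h1, h2]

/-- The point of `S` with the given arm coordinates. -/
noncomputable def pnt (n : ℕ) (p : ℕ × ℝ) : Sspace n := ⟨embC n p, Set.mem_range_self _⟩

lemma clamp_eq {t : ℝ} (h : t ∈ Icc (0 : ℝ) 1) : min 1 (max 0 t) = t := by
  rw [max_eq_right h.1, min_eq_right h.2]

lemma pnt_inj {n : ℕ} {p q : ℕ × ℝ} (hp : p.1 < n) (hq : q.1 < n) (hp' : p.2 ∈ Icc (0 : ℝ) 1)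
    (hq' : q.2 ∈ Icc (0 : ℝ) 1) (h : pnt n p = pnt n q) :
    p.2 = q.2 ∧ (p.2 = 0 ∨ p.1 = q.1) := by
  have := embC_inj (by omega) (congrArg Subtype.val h)
  rwa [clamp_eq hp', clamp_eq hq', Nat.mod_eq_of_lt hp, Nat.mod_eq_of_lt hq] at this

lemma pnt_congr {n : ℕ} {p q : ℕ × ℝ} (h1 : p.2 = q.2) (h2 : p.2 = 0 ∨ p.1 = q.1) :
    pnt n p = pnt n q :=
  Subtype.ext (embC_congr (by rw [h1]) (h2.imp_left fun h => by rw [h]; norm_num))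

/-- The value of the bonding map on the `j`-th edge of the `a`-th arm of `X_1`. -/
noncomputable def piece (n a j : ℕ) (u : ℝ) : Sspace n :=
  pnt n (interpC (imgCoord n a j) (imgCoord n a (j + 1)) u)

lemma imgCoord_zero (n a : ℕ) : imgCoord n a 0 = (0, 0) := by
  simp [imgCoord, vcoord]

lemma segOf_zero (n a : ℕ) : segOf n a 0 = (0, 0) := by
  unfold segOf
  split_ifs <;> simp at *

lemma fS_pnt {n : ℕ} (hn : 0 < n) {p : ℕ × ℝ} (hp : p.1 < n) (hp' : p.2 ∈ Icc (0 : ℝ) 1) :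
    fS n (pnt n p) = piece n (p.1 + 1) (segOf n (p.1 + 1) p.2).1 (segOf n (p.1 + 1) p.2).2 := by
  have h : embC n (Function.invFun (embC n) (embC n p)) = embC n p :=
    Function.invFun_eq ⟨p, rfl⟩
  obtain ⟨h1, h2⟩ := embC_inj hn h
  have h3 : fS n (pnt n p) = pnt n (Gmap n (Function.invFun (embC n) (embC n p))) := rfl
  rw [h3]
  set q := Function.invFun (embC n) (embC n p)
  rw [h1, clamp_eq hp', Nat.mod_eq_of_lt hp] at h2
  rw [Gmap, h1, clamp_eq hp']
  rcases h2 with h2 | h2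
  · rw [h2, segOf_zero, segOf_zero]
    apply pnt_congr <;> simp [interpC, imgCoord_zero]
  · rw [h2]
    rfl

lemma floor_piece {X : Type*} {M j : ℕ} {F : ℕ → ℝ → X} (hF : ∀ j, j + 1 < M → F j 1 = F (j + 1) 0)
    {x u : ℝ} (hu : u ∈ Icc (0 : ℝ) 1) (hj : j < M) (hx : x = j + u) :
    F (min (M - 1) ⌊x⌋₊) (x - (min (M - 1) ⌊x⌋₊ : ℕ)) = F j u := by
  subst hx
  rcases hu.2.eq_or_lt with rfl | h1
  · have : ⌊(j : ℝ) + 1⌋₊ = j + 1 := by exact_mod_cast Nat.floor_natCast (R := ℝ) (j + 1)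
    rw [this]
    rcases (show j + 1 = M ∨ j + 1 < M by omega) with h | h
    · rw [show min (M - 1) (j + 1) = j by omega]; simp
    · rw [show min (M - 1) (j + 1) = j + 1 by omega, hF j h]; simp
  · have : ⌊(j : ℝ) + u⌋₊ = j := by
      rw [Nat.floor_eq_iff (by have := hu.1; positivity)]
      exact ⟨by linarith [hu.1], by linarith⟩
    rw [this, show min (M - 1) j = j by omega]; simp

variable {s : ℕ}

lemma vcoord_zero : vcoord (s + 2) 0 = (0, 0) := rfl

lemma vcoord_low {i : ℕ} (h1 : 1 ≤ i) (h2 : i ≤ s) : vcoord (s + 2) i = (i - 1, 1) := by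
  unfold vcoord
  rw [if_neg (by omega), if_pos (by omega)]

lemma vcoord_one : vcoord (s + 2) (s + 1) = (s, 1 / 2) := by simp [vcoord]

lemma vcoord_two : vcoord (s + 2) (s + 2) = (s + 1, 1 / 2) := by simp [vcoord]

lemma vcoord_three : vcoord (s + 2) (s + 3) = (s, 1) := by
  simp [vcoord]

lemma vcoord_four : vcoord (s + 2) (s + 4) = (s + 1, 1) := by
  simp [vcoord]

lemma vcoord_cases {i : ℕ} (hi : i ≤ s + 4) :
    (i = 0 ∧ vcoord (s + 2) i = (0, 0)) ∨
    (1 ≤ i ∧ i ≤ s ∧ vcoord (s + 2) i = (i - 1, 1)) ∨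
    (i = s + 1 ∧ vcoord (s + 2) i = (s, 1 / 2)) ∨
    (i = s + 2 ∧ vcoord (s + 2) i = (s + 1, 1 / 2)) ∨
    (i = s + 3 ∧ vcoord (s + 2) i = (s, 1)) ∨
    (i = s + 4 ∧ vcoord (s + 2) i = (s + 1, 1)) := by
  rcases Nat.eq_zero_or_pos i with rfl | h
  · exact Or.inl ⟨rfl, rfl⟩
  rcases (show i ≤ s ∨ i = s + 1 ∨ i = s + 2 ∨ i = s + 3 ∨ i = s + 4 by omega)
    with h' | rfl | rfl | rfl | rfl
  · exact Or.inr (Or.inl ⟨h, h', vcoord_low h h'⟩)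
  · simp [vcoord_one]
  · simp [vcoord_two]
  · simp [vcoord_three]
  · simp [vcoord_four]

lemma vcoord_valid {i : ℕ} (hi : i ≤ s + 4) :
    (vcoord (s + 2) i).1 < s + 2 ∧ (vcoord (s + 2) i).2 ∈ Icc (0 : ℝ) 1 := by
  rcases vcoord_cases hi with ⟨h, e⟩ | ⟨h, h', e⟩ | ⟨h, e⟩ | ⟨h, e⟩ | ⟨h, e⟩ | ⟨h, e⟩ <;>
    rw [e] <;> refine ⟨by simp; try omega, ?_⟩ <;> norm_num

lemma vpt_inj {i i' : ℕ} (hi : i ≤ s + 4) (hi' : i' ≤ s + 4)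
    (h : vpt (s + 2) i = vpt (s + 2) i') : i = i' := by
  have h1 := vcoord_valid hi
  have h2 := vcoord_valid hi'
  obtain ⟨e1, e2⟩ := pnt_inj h1.1 h2.1 h1.2 h2.2 h
  rcases vcoord_cases hi with ⟨h, e⟩ | ⟨h, h', e⟩ | ⟨h, e⟩ | ⟨h, e⟩ | ⟨h, e⟩ | ⟨h, e⟩ <;>
  rcases vcoord_cases hi' with ⟨g, f⟩ | ⟨g, g', f⟩ | ⟨g, f⟩ | ⟨g, f⟩ | ⟨g, f⟩ | ⟨g, f⟩ <;>
  rw [e, f] at e1 e2 <;>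
  first | omega | (exfalso; norm_num at e1; done) | (norm_num at e2 <;> omega)

/-- The point with parameter `t` of the `e`-th edge of `X_0`. -/
noncomputable def epnt (s e : ℕ) (t : ℝ) : Sspace (s + 2) := pnt (s + 2) (X0edgeCoord (s + 2) e t)

lemma edge_cases {e : ℕ} (he : e < s + 4) (t : ℝ) :
    (e < s ∧ X0edgeCoord (s + 2) e t = (e, t)) ∨
    (e = s ∧ X0edgeCoord (s + 2) e t = (s, t / 2)) ∨
    (e = s + 1 ∧ X0edgeCoord (s + 2) e t = (s, (1 + t) / 2)) ∨
    (e = s + 2 ∧ X0edgeCoord (s + 2) e t = (s + 1, t / 2)) ∨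
    (e = s + 3 ∧ X0edgeCoord (s + 2) e t = (s + 1, (1 + t) / 2)) := by
  unfold X0edgeCoord
  rcases (show e < s ∨ e = s ∨ e = s + 1 ∨ e = s + 2 ∨ e = s + 3 by omega)
    with h | rfl | rfl | rfl | rfl
  · simp [h]
  · simp
  · simp
  · simp
  · simp

lemma edge_valid {e : ℕ} (he : e < s + 4) {t : ℝ} (ht : t ∈ Icc (0 : ℝ) 1) :
    (X0edgeCoord (s + 2) e t).1 < s + 2 ∧ (X0edgeCoord (s + 2) e t).2 ∈ Icc (0 : ℝ) 1 := by
  have h1 := ht.1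
  have h2 := ht.2
  rcases edge_cases he t with ⟨h, h'⟩ | ⟨h, h'⟩ | ⟨h, h'⟩ | ⟨h, h'⟩ | ⟨h, h'⟩ <;> rw [h'] <;>
    refine ⟨by simp; try omega, by simp; try linarith, by simp; try linarith⟩

lemma eq_zero_or_one_of_vpt {e i : ℕ} (he : e < s + 4) (hi : i ≤ s + 4) {t : ℝ}
    (ht : t ∈ Icc (0 : ℝ) 1) (h : epnt s e t = vpt (s + 2) i) : t = 0 ∨ t = 1 := by
  have h1 := vcoord_valid hi
  have h2 := edge_valid he ht
  obtain ⟨e1, e2⟩ := pnt_inj h2.1 h1.1 h2.2 h1.2 h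
  have k1 := ht.1
  have k2 := ht.2
  rcases vcoord_cases hi with ⟨h, e⟩ | ⟨h, h', e⟩ | ⟨h, e⟩ | ⟨h, e⟩ | ⟨h, e⟩ | ⟨h, e⟩ <;>
  rcases edge_cases he t with ⟨g, f⟩ | ⟨g, f⟩ | ⟨g, f⟩ | ⟨g, f⟩ | ⟨g, f⟩ <;>
  rw [e, f] at e1 e2 <;> simp at e1 e2 <;>
  first
  | (left; linarith)
  | (right; linarith)
  | (rcases e2 with e2 | e2 <;> exfalso <;> linarith)

/-- The images of adjacent vertices of `X_1` are the ends of an edge of `X_0`. -/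
def AdjLabel (s i i' : ℕ) : Prop :=
  (i = 0 ∧ 1 ≤ i' ∧ i' ≤ s + 2) ∨ (i' = 0 ∧ 1 ≤ i ∧ i ≤ s + 2) ∨
    (i = s + 2 ∧ i' = s + 4) ∨ (i = s + 1 ∧ i' = s + 3)

lemma interp_out {i : ℕ} (h1 : 1 ≤ i) (h2 : i ≤ s + 2) :
    ∃ e, e < s + 4 ∧ ∀ u, pnt (s + 2) (interpC (vcoord (s + 2) 0) (vcoord (s + 2) i) u) =
      epnt s e u := by
  rcases (show i ≤ s ∨ i = s + 1 ∨ i = s + 2 by omega) with h | rfl | rfl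
  · refine ⟨i - 1, by omega, fun u => ?_⟩
    rw [epnt, vcoord_low h1 h, vcoord_zero, X0edgeCoord, if_pos (by omega)]
    apply pnt_congr <;> simp [interpC]
  · refine ⟨s, by omega, fun u => ?_⟩
    rw [epnt, vcoord_one, vcoord_zero]
    apply pnt_congr <;> simp [interpC, X0edgeCoord]
    ring
  · refine ⟨s + 2, by omega, fun u => ?_⟩
    rw [epnt, vcoord_two, vcoord_zero]
    apply pnt_congr <;> simp [interpC, X0edgeCoord]
    ring

lemma interp_symm {i : ℕ} (h1 : 1 ≤ i) (h2 : i ≤ s + 2) (u : ℝ) :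
    pnt (s + 2) (interpC (vcoord (s + 2) i) (vcoord (s + 2) 0) u) =
      pnt (s + 2) (interpC (vcoord (s + 2) 0) (vcoord (s + 2) i) (1 - u)) := by
  have : (vcoord (s + 2) i).2 ≠ 0 := by
    rcases vcoord_cases (s := s) (i := i) (by omega) with
      ⟨h, e⟩ | ⟨h, h', e⟩ | ⟨h, e⟩ | ⟨h, e⟩ | ⟨h, e⟩ | ⟨h, e⟩ <;> rw [e] <;> first | omega | norm_num
  apply pnt_congr <;> simp [interpC, vcoord_zero, this]

lemma interp_adj {i i' : ℕ} (h : AdjLabel s i i') :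
    ∃ e, e < s + 4 ∧
      ((∀ u, pnt (s + 2) (interpC (vcoord (s + 2) i) (vcoord (s + 2) i') u) = epnt s e u) ∨
      ∀ u, pnt (s + 2) (interpC (vcoord (s + 2) i) (vcoord (s + 2) i') u) =
        epnt s e (1 - u)) := by
  rcases h with ⟨rfl, h1, h2⟩ | ⟨rfl, h1, h2⟩ | ⟨rfl, rfl⟩ | ⟨rfl, rfl⟩
  · obtain ⟨e, he, h⟩ := interp_out h1 h2
    exact ⟨e, he, Or.inl h⟩
  · obtain ⟨e, he, h⟩ := interp_out h1 h2
    exact ⟨e, he, Or.inr fun u => by rw [interp_symm h1 h2, h]⟩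
  · refine ⟨s + 3, by omega, Or.inl fun u => ?_⟩
    rw [epnt, vcoord_two, vcoord_four]
    apply pnt_congr <;> simp [interpC, X0edgeCoord]
    ring
  · refine ⟨s + 1, by omega, Or.inl fun u => ?_⟩
    rw [epnt, vcoord_one, vcoord_three]
    apply pnt_congr <;> simp [interpC, X0edgeCoord]
    ring

/-- The ray of `S` carrying the arm of `X_1` with the given word. -/
def ray (s : ℕ) : Option (Fin s) → ℕ
  | none => s
  | some i => if (i : ℕ) + 1 = s then s + 1 else i

/-- The `j`-th vertex of the arm of `X_1` with the given word, the branch point included. -/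
def wloc (x : Option (Fin s)) (j : ℕ) : Loc s := if j = 0 then Loc.O else Loc.pt x j

lemma label_wloc (x : Option (Fin s)) (j : ℕ) : label (wloc x j) = label (Loc.pt x j) := by
  unfold wloc
  split_ifs with h
  · subst h; simp [label]
  · rfl

lemma ray_spec (x : Option (Fin s)) :
    (x = none ∧ ray s x = s ∧ size s x = 1 ∧ IsSystem.Full x) ∨
    (∃ i : Fin s, x = some i ∧ (i : ℕ) + 1 = s ∧ ray s x = s + 1 ∧ size s x = s + 1 ∧
      IsSystem.Full x) ∨
    (∃ i : Fin s, x = some i ∧ (i : ℕ) + 1 < s ∧ ray s x = i ∧ size s x = s + 1 ∧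
      ¬ IsSystem.Full x) := by
  cases x with
  | none => exact Or.inl ⟨rfl, rfl, rfl, by simp [IsSystem.Full]⟩
  | some i =>
    have hi := i.2
    rcases (show (i : ℕ) + 1 = s ∨ (i : ℕ) + 1 < s by omega) with h | h
    · exact Or.inr (Or.inl ⟨i, rfl, h, by simp [ray, h], rfl, by simp [IsSystem.Full, h]⟩)
    · exact Or.inr (Or.inr ⟨i, rfl, h, by simp [ray, h.ne], rfl, by simp [IsSystem.Full, h.ne]⟩)

lemma imgCoord_even {a r : ℕ} (ha : a ≠ s) (ha1 : a ≠ s + 1) (hr : r ≤ s + 1) :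
    imgCoord (s + 2) a (2 * r) = vcoord (s + 2) 0 := by
  rcases Nat.eq_zero_or_pos r with rfl | h0
  · exact imgCoord_zero _ _
  unfold imgCoord
  rcases eq_or_ne a (s + 2) with h | h
  · rw [if_pos h, if_neg (by omega), if_pos (by omega), if_neg (by omega), if_pos (by omega)]
  · rw [if_neg h, if_neg (by omega), if_neg (by omega), if_neg (by omega), if_pos (by omega),
      if_neg (by omega), if_neg (by omega), if_pos (by omega)]

lemma imgCoord_first {a : ℕ} (ha : a ≠ s) :
    imgCoord (s + 2) a 1 = vcoord (s + 2) (s + 1) := by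
  unfold imgCoord
  rw [if_neg (show ¬ a = s + 2 - 2 by omega)]
  split_ifs <;> first | contradiction | rfl | omega

lemma imgCoord_last {a : ℕ} (ha : a ≠ s) (ha1 : a ≠ s + 1) :
    imgCoord (s + 2) a (2 * s + 3) = vcoord (s + 2) (s + 2) := by
  unfold imgCoord
  rcases eq_or_ne a (s + 2) with h | h
  · rw [if_pos h, if_neg (by omega), if_neg (by omega), if_pos (by omega)]
  · rw [if_neg h, if_neg (by omega), if_neg (by omega), if_neg (by omega), if_pos (by omega),
      if_neg (by omega), if_pos (by omega)]

lemma imgCoord_tip {a : ℕ} (ha : a ≠ s) (ha1 : a ≠ s + 1) :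
    imgCoord (s + 2) a (2 * s + 4) = vcoord (s + 2) (s + 4) := by
  unfold imgCoord
  rcases eq_or_ne a (s + 2) with h | h
  · rw [if_pos h, if_neg (by omega), if_neg (by omega), if_neg (by omega)]
  · rw [if_neg h, if_neg (by omega), if_neg (by omega), if_neg (by omega), if_neg (by omega)]

lemma imgCoord_letter {i r : ℕ} (hi : i + 1 < s) (h1 : 1 ≤ r) (h2 : r ≤ s) :
    imgCoord (s + 2) (i + 1) (2 * r + 1) = vcoord (s + 2) ((i + (r - 1)) % s + 1) := by
  have e : i + 1 + (2 * r + 1 - 1) / 2 - 2 = i + (r - 1) := by omega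
  unfold imgCoord
  rw [if_neg (by omega), if_neg (by omega), if_neg (by omega), if_neg (by omega),
    if_pos (by omega), if_neg (by omega), if_neg (by omega), if_neg (by omega), e,
    Nat.add_sub_cancel]

lemma imgCoord_letter' {i r : ℕ} (hi : i + 1 = s) (h1 : 1 ≤ r) (h2 : r ≤ s) :
    imgCoord (s + 2) (s + 2) (2 * r + 1) = vcoord (s + 2) ((i + (r - 1)) % s + 1) := by
  unfold imgCoord
  rw [if_pos rfl, if_neg (by omega), if_pos (by omega), if_neg (by omega), if_neg (by omega)]
  by_cases h : r = 1
  · rw [h, if_pos (by omega), Nat.sub_self, Nat.add_zero, Nat.mod_eq_of_lt (by omega), hi,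
      Nat.add_sub_cancel]
  · rw [if_neg (by omega), show i + (r - 1) = (r - 2) + s by omega, Nat.add_mod_right,
      Nat.mod_eq_of_lt (by omega)]
    congr 1
    omega

lemma imgCoord_word (x : Option (Fin s)) {j : ℕ} (hj : j ≤ 2 * size s x + 2) :
    imgCoord (s + 2) (ray s x + 1) j = vcoord (s + 2) (label (wloc x j)) := by
  rw [label_wloc]
  rcases ray_spec x with ⟨rfl, h, h', -⟩ | ⟨i, rfl, hi, h, h', -⟩ | ⟨i, rfl, hi, h, h', -⟩ <;>
    rw [h'] at hj <;> rw [h]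
  · interval_cases j <;> simp [imgCoord, label, letter, size]
  all_goals
    rcases Nat.even_or_odd' j with ⟨r, rfl | rfl⟩
    · rcases (show r ≤ s + 1 ∨ r = s + 2 by omega) with hr | rfl
      · rw [imgCoord_even (by omega) (by omega) hr, label_even (by omega)]
      · rw [show 2 * (s + 2) = 2 * s + 4 by ring, imgCoord_tip (by omega) (by omega)]
        exact congrArg _ (label_tip (x := some i)).symm
    · rw [label_odd]
      rcases (show r = 0 ∨ r = s + 1 ∨ (1 ≤ r ∧ r ≤ s) by omega) with rfl | rfl | ⟨h1, h2⟩
      · rw [letter_zero]; exact imgCoord_first (by omega)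
      · rw [show letter s (some i) (s + 1) = s + 2 from letter_size (some i)]
        exact imgCoord_last (by omega) (by omega)
      · rw [letter_some h1 h2]
        first
        | exact imgCoord_letter' hi h1 h2
        | exact imgCoord_letter hi h1 h2

lemma imgCoord_short (hs : 1 ≤ s) :
    imgCoord (s + 2) s 1 = vcoord (s + 2) (s + 1) ∧
      imgCoord (s + 2) s 2 = vcoord (s + 2) (s + 3) := by
  constructor <;> rw [imgCoord] <;> split_ifs <;> first | (exfalso; omega) | rfl

/-- The point of `S` with the given location. -/
noncomputable def Pt : Loc s → Sspace (s + 2)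
  | Loc.O => pnt (s + 2) (0, 0)
  | Loc.pt x j =>
    if ray s x < s then pnt (s + 2) (ray s x, j / (2 * size s x + 2 : ℕ))
    else if j ≤ 2 * size s x + 1 then pnt (s + 2) (ray s x, j / (2 * size s x + 1 : ℕ) / 2)
    else pnt (s + 2) (ray s x, 1)
  | Loc.p => pnt (s + 2) (s - 1, 1 / 2)
  | Loc.q => pnt (s + 2) (s - 1, 1)

/-- A location that actually occurs. -/
def Valid (l : Loc s) : Prop := ∀ x j, l = Loc.pt x j → 1 ≤ j ∧ j ≤ 2 * size s x + 2

/-- The ray and the parameter of a location. -/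
lemma Pt_coord (hs : 1 ≤ s) {l : Loc s} (hl : Valid l) (hO : l ≠ Loc.O) :
    ∃ k t, Pt l = pnt (s + 2) (k, t) ∧ k < s + 2 ∧ 0 < t ∧ t ≤ 1 ∧
      ((l = Loc.p ∧ k = s - 1 ∧ t = 1 / 2) ∨ (l = Loc.q ∧ k = s - 1 ∧ t = 1) ∨
      ∃ x j, l = Loc.pt x j ∧ 1 ≤ j ∧ j ≤ 2 * size s x + 2 ∧ k = ray s x ∧ ((ray s x < s ∧
        t = j / (2 * size s x + 2 : ℕ)) ∨ (¬ ray s x < s ∧ j ≤ 2 * size s x + 1 ∧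
        t = j / (2 * size s x + 1 : ℕ) / 2) ∨ (¬ ray s x < s ∧ j = 2 * size s x + 2 ∧ t = 1))) := by
  cases l with
  | O => exact absurd rfl hO
  | p => exact ⟨s - 1, 1 / 2, rfl, by omega, by norm_num, by norm_num, by simp⟩
  | q => exact ⟨s - 1, 1, rfl, by omega, by norm_num, by norm_num, by simp⟩
  | pt x j =>
    obtain ⟨h1, h2⟩ := hl x j rfl
    have hr : ray s x < s + 2 := by
      rcases ray_spec x with ⟨-, h, -⟩ | ⟨i, -, hi, h, -⟩ | ⟨i, -, hi, h, -⟩ <;> omega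
    have h1' : (0 : ℝ) < j := by exact_mod_cast h1
    by_cases hx : ray s x < s
    · refine ⟨ray s x, j / (2 * size s x + 2 : ℕ), by simp only [Pt, if_pos hx], hr, by positivity,
        ?_, Or.inr (Or.inr ⟨x, j, rfl, h1, h2, rfl, Or.inl ⟨hx, rfl⟩⟩)⟩
      exact div_le_one_of_le₀ (by exact_mod_cast h2) (by positivity)
    · by_cases hj : j ≤ 2 * size s x + 1
      · refine ⟨ray s x, j / (2 * size s x + 1 : ℕ) / 2,
          by simp only [Pt, if_neg hx, if_pos hj], hr, by positivity, ?_,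
          Or.inr (Or.inr ⟨x, j, rfl, h1, h2, rfl, Or.inr (Or.inl ⟨hx, hj, rfl⟩)⟩)⟩
        have : (j : ℝ) / (2 * size s x + 1 : ℕ) ≤ 1 :=
          div_le_one_of_le₀ (by exact_mod_cast hj) (by positivity)
        linarith
      · exact ⟨ray s x, 1, by simp only [Pt, if_neg hx, if_neg hj], hr, one_pos, le_rfl,
          Or.inr (Or.inr ⟨x, j, rfl, h1, h2, rfl, Or.inr (Or.inr ⟨hx, by omega, rfl⟩)⟩)⟩

lemma ray_ne (x : Option (Fin s)) : ray s x ≠ s - 1 ∨ s = 0 := by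
  rcases ray_spec x with ⟨-, h, -⟩ | ⟨i, -, hi, h, -⟩ | ⟨i, -, hi, h, -⟩ <;> omega

lemma ray_inj {x y : Option (Fin s)} (h : ray s x = ray s y) : x = y := by
  rcases ray_spec x with ⟨rfl, h1, -⟩ | ⟨i, rfl, hi, h1, -⟩ | ⟨i, rfl, hi, h1, -⟩ <;>
    rcases ray_spec y with ⟨rfl, h2, -⟩ | ⟨i', rfl, hi', h2, -⟩ | ⟨i', rfl, hi', h2, -⟩ <;>
    first
    | rfl
    | (exfalso; omega)
    | (congr 1; ext; omega)

lemma Pt_inj (hs : 1 ≤ s) {l l' : Loc s} (hl : Valid l) (hl' : Valid l') (h : Pt l = Pt l') :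
    l = l' := by
  have aux : ∀ {l : Loc s}, Valid l → l ≠ Loc.O → Pt l ≠ Pt Loc.O := by
    intro l hl hO h
    obtain ⟨k, t, h1, h2, h3, h4, -⟩ := Pt_coord hs hl hO
    rw [h1] at h
    have := (pnt_inj h2 (by simp) ⟨h3.le, h4⟩ (by simp) h).1
    exact h3.ne' this
  by_cases hO : l = Loc.O
  · by_contra hne
    subst hO
    exact aux hl' (Ne.symm hne) h.symm
  by_cases hO' : l' = Loc.O
  · subst hO'
    exact absurd h (aux hl hO)
  obtain ⟨k, t, h1, h2, h3, h4, h5⟩ := Pt_coord hs hl hO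
  obtain ⟨k', t', g1, g2, g3, g4, g5⟩ := Pt_coord hs hl' hO'
  rw [h1, g1] at h
  obtain ⟨e1, e2⟩ := pnt_inj h2 g2 ⟨h3.le, h4⟩ ⟨g3.le, g4⟩ h
  simp only at e1 e2
  have e3 := e2.resolve_left h3.ne'
  clear e2 h h1 g1
  rcases h5 with ⟨rfl, rfl, rfl⟩ | ⟨rfl, rfl, rfl⟩ | ⟨x, j, rfl, a1, a2, rfl, a3⟩ <;>
    rcases g5 with ⟨rfl, f1, rfl⟩ | ⟨rfl, f1, rfl⟩ | ⟨y, i, rfl, b1, b2, rfl, b3⟩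
  · rfl
  · norm_num at e1
  · have := ray_ne y; omega
  · norm_num at e1
  · rfl
  · have := ray_ne y; omega
  · have := ray_ne x; omega
  · have := ray_ne x; omega
  · have := ray_inj e3
    subst this
    have hlt : ∀ i : ℕ, i ≤ 2 * size s x + 1 → (i : ℝ) / (2 * size s x + 1 : ℕ) / 2 < 1 := by
      intro i hi
      have : (i : ℝ) / (2 * size s x + 1 : ℕ) ≤ 1 :=
        div_le_one_of_le₀ (by exact_mod_cast hi) (by positivity)
      linarith
    congr 1
    rcases a3 with ⟨c1, rfl⟩ | ⟨c1, c2, rfl⟩ | ⟨c1, rfl, rfl⟩ <;>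
      rcases b3 with ⟨d1, rfl⟩ | ⟨d1, d2, rfl⟩ | ⟨d1, rfl, rfl⟩ <;> try (first | omega | rfl)
    · have : ((2 * size s x + 2 : ℕ) : ℝ) ≠ 0 := by positivity
      field_simp at e1
      exact_mod_cast e1
    · have : ((2 * size s x + 1 : ℕ) : ℝ) ≠ 0 := by positivity
      field_simp at e1
      exact_mod_cast e1
    · exact absurd e1 (hlt _ c2).ne
    · exact absurd e1.symm (hlt _ d2).ne

lemma full_iff (x : Option (Fin s)) : IsSystem.Full x ↔ ¬ ray s x < s := by
  rcases ray_spec x with ⟨-, h, -, h'⟩ | ⟨i, -, hi, h, -, h'⟩ | ⟨i, -, hi, h, -, h'⟩ <;>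
    simp only [h', true_iff, false_iff] <;> omega

lemma adjLabel_word (x : Option (Fin s)) {j : ℕ} (hj : j + 1 ≤ 2 * size s x + 2) :
    AdjLabel s (label (wloc x j)) (label (wloc x (j + 1))) := by
  rw [label_wloc, label_wloc]
  rcases Nat.even_or_odd' j with ⟨r, rfl | rfl⟩
  · rw [label_even (by omega), label_odd]
    exact Or.inl ⟨rfl, letter_bounds x (by omega)⟩
  · rw [label_odd]
    rcases (show r = size s x ∨ r + 1 ≤ size s x by omega) with rfl | h
    · rw [letter_size, label_tip]
      exact Or.inr (Or.inr (Or.inl ⟨rfl, rfl⟩))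
    · rw [show 2 * r + 1 + 1 = 2 * (r + 1) by ring, label_even h]
      exact Or.inr (Or.inl ⟨rfl, letter_bounds x (by omega)⟩)

lemma AdjLabel.coord {i i' : ℕ} (h : AdjLabel s i i') : (vcoord (s + 2) i).2 = 0 ∨
    (vcoord (s + 2) i').2 = 0 ∨ (vcoord (s + 2) i).1 = (vcoord (s + 2) i').1 := by
  rcases h with ⟨rfl, -⟩ | ⟨rfl, -⟩ | ⟨rfl, rfl⟩ | ⟨rfl, rfl⟩
  · simp [vcoord_zero]
  · simp [vcoord_zero]
  · simp [vcoord_two, vcoord_four]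
  · simp [vcoord_one, vcoord_three]

/-- The segment of `S` joining two vertices of `X_0` with the given indices. -/
noncomputable def seg (s i i' : ℕ) (u : ℝ) : Sspace (s + 2) :=
  pnt (s + 2) (interpC (vcoord (s + 2) i) (vcoord (s + 2) i') u)

lemma seg_zero (i i' : ℕ) : seg s i i' 0 = vpt (s + 2) i := by
  change _ = pnt (s + 2) (vcoord (s + 2) i)
  apply pnt_congr <;> simp [interpC]
  tauto

lemma seg_one {i i' : ℕ} (h : AdjLabel s i i') : seg s i i' 1 = vpt (s + 2) i' := by
  change _ = pnt (s + 2) (vcoord (s + 2) i')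
  have := h.coord
  apply pnt_congr <;> simp [interpC]
  tauto

lemma piece_word (x : Option (Fin s)) {j : ℕ} (hj : j + 1 ≤ 2 * size s x + 2) (u : ℝ) :
    piece (s + 2) (ray s x + 1) j u = seg s (label (wloc x j)) (label (wloc x (j + 1))) u := by
  rw [piece, imgCoord_word x (by omega), imgCoord_word x hj, seg]

lemma piece_word_glue (x : Option (Fin s)) {j : ℕ} (hj : j + 1 < 2 * size s x + 2) :
    piece (s + 2) (ray s x + 1) j 1 = piece (s + 2) (ray s x + 1) (j + 1) 0 := by
  rw [piece_word x (by omega), piece_word x (by omega), seg_one (adjLabel_word x (by omega)),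
    seg_zero]

lemma fS_whole {x : Option (Fin s)} (hx : ray s x < s) {j : ℕ} (hj : j < 2 * size s x + 2) {u : ℝ}
    (hu : u ∈ Icc (0 : ℝ) 1) :
    fS (s + 2) (pnt (s + 2) (ray s x, (j + u) / (2 * size s x + 2 : ℕ))) =
      seg s (label (wloc x j)) (label (wloc x (j + 1))) u := by
  obtain ⟨i, -, hi, h, h', -⟩ : ∃ i : Fin s, x = some i ∧ (i : ℕ) + 1 < s ∧ ray s x = i ∧
      size s x = s + 1 ∧ ¬ IsSystem.Full x := by
    rcases ray_spec x with ⟨-, h, -⟩ | ⟨i, -, hi, h, -⟩ | h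
    · omega
    · omega
    · exact h
  have hM : (0 : ℝ) < (2 * size s x + 2 : ℕ) := by positivity
  have hj' : (j : ℝ) + 1 ≤ (2 * size s x + 2 : ℕ) := by exact_mod_cast hj
  rw [fS_pnt (by omega) (by simp only; omega)
    ⟨div_nonneg (by linarith [hu.1, (Nat.cast_nonneg j : (0 : ℝ) ≤ j)]) hM.le,
      div_le_one_of_le₀ (by linarith [hu.2]) hM.le⟩, ← piece_word x hj]
  rw [segOf, if_neg (by simp only; omega), if_neg (by simp only; omega),
    if_neg (by simp only; omega)]
  have e : 2 * (s + 2) - 1 = (2 * size s x + 2) - 1 := by omega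
  simp only [e]
  refine floor_piece (M := 2 * size s x + 2) (F := piece (s + 2) (ray s x + 1))
    (fun j hj => piece_word_glue x hj) hu hj ?_
  have e' : (2 : ℝ) * ((s + 2 : ℕ) : ℝ) = (2 * size s x + 2 : ℕ) := by
    rw [h']; push_cast; ring
  rw [e']
  field_simp

lemma segOf_full {x : Option (Fin s)} (hx : ¬ ray s x < s) (t : ℝ) :
    segOf (s + 2) (ray s x + 1) t = if t ≤ 1 / 2 then
      (min ((2 * size s x + 1) - 1) ⌊2 * ((2 * size s x + 1 : ℕ) : ℝ) * t⌋₊,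
        2 * ((2 * size s x + 1 : ℕ) : ℝ) * t -
          (min ((2 * size s x + 1) - 1) ⌊2 * ((2 * size s x + 1 : ℕ) : ℝ) * t⌋₊ : ℕ))
    else (2 * size s x + 1, 2 * t - 1) := by
  rcases ray_spec x with ⟨-, h, h', -⟩ | ⟨i, -, hi, h, h', -⟩ | ⟨i, -, hi, h, h', -⟩
  · rw [h, h', segOf, if_neg (by omega), if_pos (by omega)]
    norm_num
  · have e : (4 : ℝ) * ((s + 2 : ℕ) : ℝ) - 2 = 2 * ((2 * (s + 1) + 1 : ℕ) : ℝ) := by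
      push_cast; ring
    rw [h, h', segOf, if_pos (by omega), e]
    rfl
  · omega

lemma fS_full {x : Option (Fin s)} (hx : ¬ ray s x < s) {j : ℕ} (hj : j < 2 * size s x + 1) {u : ℝ}
    (hu : u ∈ Icc (0 : ℝ) 1) :
    fS (s + 2) (pnt (s + 2) (ray s x, (j + u) / (2 * size s x + 1 : ℕ) / 2)) =
      seg s (label (wloc x j)) (label (wloc x (j + 1))) u := by
  have hM : (0 : ℝ) < (2 * size s x + 1 : ℕ) := by positivity
  have hj' : (j : ℝ) + 1 ≤ (2 * size s x + 1 : ℕ) := by exact_mod_cast hj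
  have h0 : 0 ≤ (j + u) / (2 * size s x + 1 : ℕ) :=
    div_nonneg (by linarith [hu.1, (Nat.cast_nonneg j : (0 : ℝ) ≤ j)]) hM.le
  have h1 : (j + u) / (2 * size s x + 1 : ℕ) ≤ 1 := div_le_one_of_le₀ (by linarith [hu.2]) hM.le
  have hr : ray s x < s + 2 := by
    rcases ray_spec x with ⟨-, h, -⟩ | ⟨i, -, hi, h, -⟩ | ⟨i, -, hi, h, -⟩ <;> omega
  rw [fS_pnt (by omega) hr ⟨by simp only; linarith, by simp only; linarith⟩,
    ← piece_word x (by omega)]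
  simp only
  rw [segOf_full hx, if_pos (by linarith)]
  refine floor_piece (M := 2 * size s x + 1) (F := piece (s + 2) (ray s x + 1))
    (fun j hj => piece_word_glue x (by omega)) hu hj ?_
  field_simp

lemma fS_tip {x : Option (Fin s)} (hx : ¬ ray s x < s) {u : ℝ} (hu : u ∈ Icc (0 : ℝ) 1) :
    fS (s + 2) (pnt (s + 2) (ray s x, (1 + u) / 2)) =
      seg s (label (wloc x (2 * size s x + 1))) (label (wloc x (2 * size s x + 2))) u := by
  have hr : ray s x < s + 2 := by
    rcases ray_spec x with ⟨-, h, -⟩ | ⟨i, -, hi, h, -⟩ | ⟨i, -, hi, h, -⟩ <;> omega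
  rcases hu.1.eq_or_lt with rfl | h0
  · have hM : ((2 * size s x + 1 : ℕ) : ℝ) ≠ 0 := by positivity
    have e : (1 + (0 : ℝ)) / 2 = ((2 * size s x : ℕ) + 1) / (2 * size s x + 1 : ℕ) / 2 := by
      rw [Nat.cast_succ (2 * size s x)] at hM ⊢
      rw [div_self hM]; norm_num
    rw [e, fS_full hx (j := 2 * size s x) (by omega) ⟨zero_le_one, le_rfl⟩,
      seg_one (adjLabel_word x (by omega)), seg_zero]
  · have h1 := hu.2
    rw [fS_pnt (by omega) hr ⟨by simp only; linarith, by simp only; linarith⟩]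
    simp only
    rw [segOf_full hx, if_neg (by linarith), piece_word x le_rfl]
    congr 1
    ring

lemma fS_short (hs : 1 ≤ s) {u : ℝ} (hu : u ∈ Icc (0 : ℝ) 1) :
    fS (s + 2) (pnt (s + 2) (s - 1, (0 + u) / 2)) = seg s 0 (s + 1) u ∧
      fS (s + 2) (pnt (s + 2) (s - 1, (1 + u) / 2)) = seg s (s + 1) (s + 3) u := by
  have hp : ∀ u, piece (s + 2) s 0 u = seg s 0 (s + 1) u ∧
      piece (s + 2) s 1 u = seg s (s + 1) (s + 3) u := by
    intro u
    obtain ⟨h1, h2⟩ := imgCoord_short hs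
    rw [piece, piece, h1, h2, imgCoord_zero, seg, seg, vcoord_zero]
    exact ⟨rfl, rfl⟩
  have key : ∀ j : ℕ, j < 2 → fS (s + 2) (pnt (s + 2) (s - 1, (j + u) / 2)) =
      piece (s + 2) s j u := by
    intro j hj
    have hj' : (j : ℝ) + 1 ≤ 2 := by exact_mod_cast hj
    have := hu.1
    have := hu.2
    have hj0 : (0 : ℝ) ≤ j := Nat.cast_nonneg j
    rw [fS_pnt (by omega) (by simp only; omega) ⟨by simp only; linarith, by simp only; linarith⟩]
    simp only [Nat.sub_add_cancel hs]
    rw [segOf, if_neg (by omega), if_neg (by omega), if_pos (by omega)]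
    refine floor_piece (M := 2) (F := piece (s + 2) s) ?_ hu hj (by ring)
    intro j hj
    obtain rfl : j = 0 := by omega
    rw [(hp 1).1, (hp 0).2, seg_one (Or.inl ⟨rfl, by omega, by omega⟩), seg_zero]
  refine ⟨?_, ?_⟩
  · rw [← (hp u).1, ← key 0 (by omega), Nat.cast_zero]
  · rw [← (hp u).2, ← key 1 (by omega), Nat.cast_one]

/-- `EdgeKind e N ℓ`: the `e`-th edge of `X_0` consists of `N` edges of `X_1`, the vertices of
which have the locations `ℓ 0, …, ℓ N`. -/
inductive EdgeKind (s : ℕ) : ℕ → ℕ → (ℕ → Loc s) → Prop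
  | whole (x : Option (Fin s)) : ray s x < s →
      EdgeKind s (ray s x) (2 * size s x + 2) (wloc x)
  | full (x : Option (Fin s)) : ¬ ray s x < s →
      EdgeKind s (2 * ray s x - s) (2 * size s x + 1) (wloc x)
  | tip (x : Option (Fin s)) : ¬ ray s x < s →
      EdgeKind s (2 * ray s x - s + 1) 1 (fun j => Loc.pt x (2 * size s x + 1 + j))
  | short : EdgeKind s (s - 1) 2 (fun j => if j = 0 then Loc.O else if j = 1 then Loc.p else Loc.q)

lemma ray_bound {x : Option (Fin s)} (hx : ¬ ray s x < s) : ray s x = s ∨ ray s x = s + 1 := by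
  rcases ray_spec x with ⟨-, h, -⟩ | ⟨i, -, hi, h, -⟩ | ⟨i, -, hi, h, -⟩ <;> omega

lemma exists_edgeKind (hs : 1 ≤ s) {e : ℕ} (he : e < s + 4) : ∃ N ℓ, EdgeKind s e N ℓ := by
  have h0 : ray s (none : Option (Fin s)) = s := rfl
  have h1 : ray s (some ⟨s - 1, by omega⟩) = s + 1 := if_pos (by simp only; omega)
  rcases (show e + 1 < s ∨ e + 1 = s ∨ e = s ∨ e = s + 1 ∨ e = s + 2 ∨ e = s + 3 by omega) with
    h | h | rfl | rfl | rfl | rfl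
  · have h' : ray s (some ⟨e, by omega⟩) = e := if_neg (by simp only; omega)
    have := EdgeKind.whole (some (⟨e, by omega⟩ : Fin s)) (by omega)
    rw [h'] at this
    exact ⟨_, _, this⟩
  · have := EdgeKind.short (s := s)
    rw [show s - 1 = e by omega] at this
    exact ⟨_, _, this⟩
  · have := EdgeKind.full (none : Option (Fin e)) (by omega)
    rw [h0, show 2 * e - e = e by omega] at this
    exact ⟨_, _, this⟩
  · have := EdgeKind.tip (none : Option (Fin s)) (by omega)
    rw [h0, show 2 * s - s = s by omega] at this
    exact ⟨_, _, this⟩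
  · have := EdgeKind.full (some (⟨s - 1, by omega⟩ : Fin s)) (by omega)
    rw [h1, show 2 * (s + 1) - s = s + 2 by omega] at this
    exact ⟨_, _, this⟩
  · have := EdgeKind.tip (some (⟨s - 1, by omega⟩ : Fin s)) (by omega)
    rw [h1, show 2 * (s + 1) - s + 1 = s + 3 by omega] at this
    exact ⟨_, _, this⟩

lemma valid_wloc (x : Option (Fin s)) {j : ℕ} (hj : j ≤ 2 * size s x + 2) : Valid (wloc x j) := by
  intro y i h
  unfold wloc at h
  split_ifs at h with h0
  cases h
  omega

lemma epnt_whole {x : Option (Fin s)} (hx : ray s x < s) (t : ℝ) :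
    epnt s (ray s x) t = pnt (s + 2) (ray s x, t) := by
  rcases edge_cases (show ray s x < s + 4 by omega) t with h | h | h | h | h
  · rw [epnt, h.2]
  all_goals omega

lemma epnt_full {x : Option (Fin s)} (hx : ¬ ray s x < s) (t : ℝ) :
    epnt s (2 * ray s x - s) t = pnt (s + 2) (ray s x, t / 2) := by
  rcases ray_bound hx with hr | hr <;> rw [hr]
  · rw [show 2 * s - s = s by omega, epnt]
    simp [X0edgeCoord]
  · rw [show 2 * (s + 1) - s = s + 2 by omega, epnt]
    simp [X0edgeCoord]

lemma epnt_tip {x : Option (Fin s)} (hx : ¬ ray s x < s) (t : ℝ) :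
    epnt s (2 * ray s x - s + 1) t = pnt (s + 2) (ray s x, (1 + t) / 2) := by
  rcases ray_bound hx with hr | hr <;> rw [hr]
  · rw [show 2 * s - s + 1 = s + 1 by omega, epnt]
    simp [X0edgeCoord]
  · rw [show 2 * (s + 1) - s + 1 = s + 3 by omega, epnt]
    simp [X0edgeCoord]

lemma Pt_whole {x : Option (Fin s)} (hx : ray s x < s) (j : ℕ) :
    Pt (wloc x j) = pnt (s + 2) (ray s x, j / (2 * size s x + 2 : ℕ)) := by
  unfold wloc
  split_ifs with h
  · subst h
    apply pnt_congr <;> simp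
  · rw [Pt, if_pos hx]

lemma Pt_full {x : Option (Fin s)} (hx : ¬ ray s x < s) {j : ℕ} (hj : j ≤ 2 * size s x + 1) :
    Pt (wloc x j) = pnt (s + 2) (ray s x, j / (2 * size s x + 1 : ℕ) / 2) := by
  unfold wloc
  split_ifs with h
  · subst h
    apply pnt_congr <;> simp
  · rw [Pt, if_neg hx, if_pos hj]

lemma EdgeKind.pos {e N : ℕ} {ℓ : ℕ → Loc s} (h : EdgeKind s e N ℓ) : 1 ≤ N := by
  cases h <;> omega

lemma EdgeKind.valid {e N : ℕ} {ℓ : ℕ → Loc s} (h : EdgeKind s e N ℓ) {j : ℕ} (hj : j ≤ N) :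
    Valid (ℓ j) := by
  cases h with
  | whole x hx => exact valid_wloc x hj
  | full x hx => exact valid_wloc x (by omega)
  | tip x hx =>
    intro y i h
    cases h
    omega
  | short =>
    intro y i h
    simp only at h
    split_ifs at h

lemma EdgeKind.adj {e N : ℕ} {ℓ : ℕ → Loc s} (h : EdgeKind s e N ℓ) {j : ℕ} (hj : j < N) :
    AdjLabel s (label (ℓ j)) (label (ℓ (j + 1))) := by
  cases h with
  | whole x hx => exact adjLabel_word x hj
  | full x hx => exact adjLabel_word x (by omega)
  | tip x hx =>
    obtain rfl : j = 0 := by omega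
    have := adjLabel_word x (j := 2 * size s x + 1) le_rfl
    rwa [label_wloc, label_wloc] at this
  | short =>
    rcases (show j = 0 ∨ j = 1 by omega) with rfl | rfl
    · exact Or.inl ⟨rfl, by simp [label], by simp [label]⟩
    · exact Or.inr (Or.inr (Or.inr ⟨rfl, rfl⟩))

lemma EdgeKind.epnt_eq (hs : 1 ≤ s) {e N : ℕ} {ℓ : ℕ → Loc s} (h : EdgeKind s e N ℓ) {j : ℕ} (hj : j ≤ N) :
    epnt s e (j / N) = Pt (ℓ j) := by
  cases h with
  | whole x hx => rw [epnt_whole hx, Pt_whole hx]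
  | full x hx => rw [epnt_full hx, Pt_full hx hj]
  | tip x hx =>
    rw [epnt_tip hx]
    rcases (show j = 0 ∨ j = 1 by omega) with rfl | rfl
    · have hM : ((2 * size s x + 1 : ℕ) : ℝ) ≠ 0 := by positivity
      have := Pt_full hx (j := 2 * size s x + 1) le_rfl
      rw [wloc, if_neg (by omega)] at this
      change _ = Pt (Loc.pt x (2 * size s x + 1))
      rw [this, div_self hM]
      norm_num
    · rw [Pt, if_neg hx, if_neg (by omega)]
      norm_num
  | short =>
    have h : epnt s (s - 1) (j / (2 : ℕ)) = pnt (s + 2) (s - 1, j / (2 : ℕ)) := by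
      rw [epnt, X0edgeCoord, if_pos (by omega)]
    rw [h]
    rcases (show j = 0 ∨ j = 1 ∨ j = 2 by omega) with rfl | rfl | rfl
    · apply pnt_congr <;> simp
    · simp [Pt]
    · simp [Pt]

lemma EdgeKind.fS_eq (hs : 1 ≤ s) {e N : ℕ} {ℓ : ℕ → Loc s} (h : EdgeKind s e N ℓ) {j : ℕ}
    (hj : j < N) {u : ℝ} (hu : u ∈ Icc (0 : ℝ) 1) :
    fS (s + 2) (epnt s e ((j + u) / N)) = seg s (label (ℓ j)) (label (ℓ (j + 1))) u := by
  cases h with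
  | whole x hx => rw [epnt_whole hx, fS_whole hx hj hu]
  | full x hx => rw [epnt_full hx, fS_full hx hj hu]
  | tip x hx =>
    obtain rfl : j = 0 := by omega
    have := fS_tip hx hu
    rw [label_wloc, label_wloc] at this
    rw [epnt_tip hx]
    simpa using this
  | short =>
    have h : ∀ t, epnt s (s - 1) t = pnt (s + 2) (s - 1, t) := by
      intro t
      rw [epnt, X0edgeCoord, if_pos (by omega)]
    rw [h]
    rcases (show j = 0 ∨ j = 1 by omega) with rfl | rfl
    · exact_mod_cast (fS_short hs hu).1
    · exact_mod_cast (fS_short hs hu).2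

lemma EdgeKind.fS_vertex (hs : 1 ≤ s) {e N : ℕ} {ℓ : ℕ → Loc s} (h : EdgeKind s e N ℓ) {j : ℕ}
    (hj : j ≤ N) : fS (s + 2) (Pt (ℓ j)) = vpt (s + 2) (label (ℓ j)) := by
  rw [← h.epnt_eq hs hj]
  rcases hj.lt_or_eq with hj | rfl
  · have := h.fS_eq hs hj (u := 0) ⟨le_rfl, zero_le_one⟩
    rwa [add_zero, seg_zero] at this
  · obtain ⟨i, rfl⟩ : ∃ i, j = i + 1 := ⟨j - 1, by have := h.pos; omega⟩
    have := h.fS_eq hs (Nat.lt_succ_self i) (u := 1) ⟨zero_le_one, le_rfl⟩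
    rw [seg_one (h.adj (Nat.lt_succ_self i))] at this
    rwa [← Nat.cast_succ] at this

lemma Valid.exists_edgeKind {l : Loc s} (hl : Valid l) :
    ∃ e N ℓ j, EdgeKind s e N ℓ ∧ j ≤ N ∧ ℓ j = l := by
  cases l with
  | O => exact ⟨_, _, _, 0, EdgeKind.short, by omega, rfl⟩
  | p => exact ⟨_, _, _, 1, EdgeKind.short, by omega, rfl⟩
  | q => exact ⟨_, _, _, 2, EdgeKind.short, by omega, rfl⟩
  | pt x j =>
    obtain ⟨h1, h2⟩ := hl x j rfl
    have hw : wloc x j = Loc.pt x j := if_neg (by omega)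
    by_cases hx : ray s x < s
    · exact ⟨_, _, _, j, EdgeKind.whole x hx, h2, hw⟩
    · rcases (show j ≤ 2 * size s x + 1 ∨ j = 2 * size s x + 2 by omega) with h | rfl
      · exact ⟨_, _, _, j, EdgeKind.full x hx, h, hw⟩
      · exact ⟨_, _, _, 1, EdgeKind.tip x hx, le_rfl, rfl⟩

lemma label_le (l : Loc s) : label l ≤ s + 4 := by
  cases l with
  | O => simp [label]
  | p => simp [label]
  | q => simp [label]
  | pt x j =>
    simp only [label]
    split_ifs with h1 h2
    · omega
    · exact le_rfl
    · unfold letter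
      split_ifs
      · omega
      · omega
      · cases x with
        | none => simp
        | some i =>
          have := Nat.mod_lt ((i : ℕ) + (j / 2 - 1)) (show 0 < s by have := i.2; omega)
          simp only
          omega

/-! ## Edges of the subdivisions of `S` as lifts of edges of `X_0` -/

/-- The vertices of `X_0`. -/
def IsVert (z : Sspace (s + 2)) : Prop := ∃ i, i ≤ s + 4 ∧ z = vpt (s + 2) i

/-- `γ` runs through an edge of the `h`-preimage of `X_0` lying over the `e`-th edge of `X_0`. -/
structure Lift (h : Sspace (s + 2) → Sspace (s + 2)) (e : ℕ) (γ : ℝ → Sspace (s + 2)) : Prop where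
  lt : e < s + 4
  cont : ContinuousOn γ (Icc 0 1)
  eq : ∀ t ∈ Icc (0 : ℝ) 1, h (γ t) = epnt s e t

/-- The edges of the `h`-preimage of `X_0` cover `S`, and its vertices are connected by edges. -/
structure Good (h : Sspace (s + 2) → Sspace (s + 2)) : Prop where
  cover : ∀ z, ∃ e γ t, Lift h e γ ∧ t ∈ Icc (0 : ℝ) 1 ∧ γ t = z
  conn : ∀ Q : Sspace (s + 2) → Prop, (∀ e γ, Lift h e γ → (Q (γ 0) ↔ Q (γ 1))) →
    ∀ z z', IsVert (h z) → IsVert (h z') → Q z → Q z'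

lemma div_mem {N j : ℕ} (hj : j < N) {u : ℝ} (hu : u ∈ Icc (0 : ℝ) 1) :
    ((j : ℝ) + u) / N ∈ Icc (0 : ℝ) 1 := by
  have h1 : ((j + 1 : ℕ) : ℝ) ≤ N := by exact_mod_cast hj
  push_cast at h1
  have h2 : (0 : ℝ) ≤ j := by positivity
  exact ⟨div_nonneg (by linarith [hu.1]) (by linarith), div_le_one_of_le₀ (by linarith [hu.2])
    (by linarith)⟩

lemma exists_div {N : ℕ} (hN : 1 ≤ N) {t : ℝ} (ht : t ∈ Icc (0 : ℝ) 1) :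
    ∃ j u, j < N ∧ u ∈ Icc (0 : ℝ) 1 ∧ t = ((j : ℝ) + u) / N := by
  have hN' : (0 : ℝ) < N := by exact_mod_cast hN
  rcases ht.2.eq_or_lt with rfl | h1
  · refine ⟨N - 1, 1, by omega, by simp, ?_⟩
    rw [Nat.cast_sub hN, Nat.cast_one, sub_add_cancel, div_self hN'.ne']
  · have h0 : 0 ≤ t * N := mul_nonneg ht.1 hN'.le
    refine ⟨⌊t * N⌋₊, t * N - ⌊t * N⌋₊, ?_, ⟨?_, ?_⟩, ?_⟩
    · rw [Nat.floor_lt h0]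
      nlinarith
    · linarith [Nat.floor_le h0]
    · linarith [Nat.lt_floor_add_one (t * N)]
    · rw [add_sub_cancel, mul_div_cancel_right₀ _ hN'.ne']

namespace Lift

variable {h : Sspace (s + 2) → Sspace (s + 2)} {e N : ℕ} {γ : ℝ → Sspace (s + 2)} {ℓ : ℕ → Loc s}

lemma piece (hs : 1 ≤ s) (hγ : Lift h e γ) (hk : EdgeKind s e N ℓ) {j : ℕ} (hj : j < N) :
    ∃ e', Lift (fS (s + 2) ∘ h) e' (fun u => γ ((j + u) / N)) ∨
      Lift (fS (s + 2) ∘ h) e' (fun u => γ ((j + (1 - u)) / N)) := by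
  obtain ⟨e', he', H⟩ := interp_adj (hk.adj hj)
  have hrev : ∀ u ∈ Icc (0 : ℝ) 1, 1 - u ∈ Icc (0 : ℝ) 1 := fun u hu =>
    ⟨by linarith [hu.2], by linarith [hu.1]⟩
  have key : ∀ u ∈ Icc (0 : ℝ) 1, fS (s + 2) (h (γ ((j + u) / N))) =
      seg s (label (ℓ j)) (label (ℓ (j + 1))) u := fun u hu => by
    rw [hγ.eq _ (div_mem hj hu), hk.fS_eq hs hj hu]
  refine ⟨e', H.imp (fun H => ⟨he', ?_, fun u hu => ?_⟩) fun H => ⟨he', ?_, fun u hu => ?_⟩⟩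
  · exact hγ.cont.comp (by fun_prop) fun u hu => div_mem hj hu
  · exact (key u hu).trans (H u)
  · exact hγ.cont.comp (by fun_prop) fun u hu => div_mem hj (hrev u hu)
  · exact (key _ (hrev u hu)).trans ((H (1 - u)).trans (by rw [sub_sub_cancel]))

lemma rel (hs : 1 ≤ s) (hγ : Lift h e γ) (hk : EdgeKind s e N ℓ)
    {R : Sspace (s + 2) → Sspace (s + 2) → Prop} (hR : ∀ z z', R z z' → R z' z)
    (H : ∀ e γ, Lift (fS (s + 2) ∘ h) e γ → R (γ 0) (γ 1)) {j : ℕ} (hj : j < N) :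
    R (γ (j / N)) (γ ((j + 1 : ℕ) / N)) := by
  rw [Nat.cast_succ]
  obtain ⟨e', h' | h'⟩ := hγ.piece hs hk hj
  · simpa using H _ _ h'
  · simpa using hR _ _ (H _ _ h')

lemma exists_index (hs : 1 ≤ s) (hγ : Lift h e γ) (hk : EdgeKind s e N ℓ) {t : ℝ}
    (ht : t ∈ Icc (0 : ℝ) 1) (hv : IsVert (fS (s + 2) (h (γ t)))) : ∃ j, j ≤ N ∧ t = j / N := by
  obtain ⟨j, u, hj, hu, rfl⟩ := exists_div hk.pos ht
  obtain ⟨i, hi, hv⟩ := hv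
  have hu' : u = 0 ∨ u = 1 := by
    obtain ⟨e', H⟩ := hγ.piece hs hk hj
    rcases H with H | H
    · exact eq_zero_or_one_of_vpt H.lt hi hu ((H.eq u hu).symm.trans hv)
    · have hu' : 1 - u ∈ Icc (0 : ℝ) 1 := ⟨by linarith [hu.2], by linarith [hu.1]⟩
      have h1 := H.eq _ hu'
      simp only [Function.comp, sub_sub_cancel] at h1
      rcases eq_zero_or_one_of_vpt H.lt hi hu' (h1.symm.trans hv) with h | h
      · right; linarith
      · left; linarith
  rcases hu' with rfl | rfl
  · exact ⟨j, hj.le, by rw [add_zero]⟩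
  · exact ⟨j + 1, hj, by push_cast; rfl⟩

lemma eq_zero_or_one (hγ : Lift h e γ) {t : ℝ} (ht : t ∈ Icc (0 : ℝ) 1) (hv : IsVert (h (γ t))) :
    t = 0 ∨ t = 1 := by
  obtain ⟨i, hi, hv⟩ := hv
  exact eq_zero_or_one_of_vpt hγ.lt hi ht ((hγ.eq t ht).symm.trans hv)

end Lift

/-- The vertices joined by the edges of `X_0`. -/
lemma epnt_ends {e : ℕ} (he : e < s + 4) :
    ∃ i i', i ≤ s + 4 ∧ i' ≤ s + 4 ∧ i ≠ i' ∧ epnt s e 0 = vpt (s + 2) i ∧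
      epnt s e 1 = vpt (s + 2) i' ∧
      ((e ≤ s ∧ i = 0 ∧ i' = e + 1) ∨ (e = s + 1 ∧ i = s + 1 ∧ i' = s + 3) ∨
      (e = s + 2 ∧ i = 0 ∧ i' = s + 2) ∨ (e = s + 3 ∧ i = s + 2 ∧ i' = s + 4)) := by
  rcases (show e < s ∨ e = s ∨ e = s + 1 ∨ e = s + 2 ∨ e = s + 3 by omega) with
    h | rfl | rfl | rfl | rfl
  · refine ⟨0, e + 1, by omega, by omega, by omega, ?_, ?_, by omega⟩ <;>
      apply pnt_congr <;> simp [X0edgeCoord, h, vcoord_zero, vcoord_low (s := s) (i := e + 1)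
        (by omega) (by omega)]
  · refine ⟨0, e + 1, by omega, by omega, by omega, ?_, ?_, by omega⟩ <;>
      apply pnt_congr <;> simp [X0edgeCoord, vcoord_zero, vcoord_one]
  · refine ⟨s + 1, s + 3, by omega, by omega, by omega, ?_, ?_, by omega⟩ <;>
      apply pnt_congr <;> simp [X0edgeCoord, vcoord_three, vcoord_one]
  · refine ⟨0, s + 2, by omega, by omega, by omega, ?_, ?_, by omega⟩ <;>
      apply pnt_congr <;> simp [X0edgeCoord, vcoord_zero, vcoord_two]
  · refine ⟨s + 2, s + 4, by omega, by omega, by omega, ?_, ?_, by omega⟩ <;>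
      apply pnt_congr <;> simp [X0edgeCoord, vcoord_four, vcoord_two]

lemma continuous_epnt (e : ℕ) : Continuous (epnt s e) := by
  unfold epnt pnt embC
  refine Continuous.subtype_mk ?_ _
  unfold X0edgeCoord
  split_ifs <;> fun_prop

lemma lift_id {e : ℕ} (he : e < s + 4) : Lift id e (epnt s e) :=
  ⟨he, (continuous_epnt e).continuousOn, fun _ _ => rfl⟩

lemma exists_epnt (z : Sspace (s + 2)) : ∃ e t, e < s + 4 ∧ t ∈ Icc (0 : ℝ) 1 ∧ epnt s e t = z := by
  obtain ⟨z, ⟨a, t⟩, rfl⟩ := z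
  have h1 : ∃ k t', k < s + 2 ∧ t' ∈ Icc (0 : ℝ) 1 ∧ embC (s + 2) (k, t') = embC (s + 2) (a, t) := by
    refine ⟨a % (s + 2), min 1 (max 0 t), Nat.mod_lt _ (by omega), by simp, ?_⟩
    have h2 : (a : ℂ) = (a % (s + 2) : ℕ) + ((s + 2 : ℕ) : ℂ) * (a / (s + 2) : ℕ) := by
      exact_mod_cast (Nat.mod_add_div a (s + 2)).symm
    have h3 : ((s + 2 : ℕ) : ℂ) ≠ 0 := by exact_mod_cast (show s + 2 ≠ 0 by omega)
    have h4 : 2 * Real.pi * Complex.I * (a : ℂ) / ((s + 2 : ℕ) : ℂ) =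
        2 * Real.pi * Complex.I * ((a % (s + 2) : ℕ) : ℂ) / ((s + 2 : ℕ) : ℂ) +
        ((a / (s + 2) : ℕ) : ℂ) * (2 * Real.pi * Complex.I) := by
      rw [h2]
      field_simp
    have h5 : min 1 (max 0 t) ∈ Icc (0 : ℝ) 1 := by simp
    rw [embC, embC, h4, Complex.exp_add, Complex.exp_nat_mul_two_pi_mul_I, mul_one,
      clamp_eq h5]
  obtain ⟨k, t', hk, ht, h1⟩ := h1
  have h2 : ∀ e u, X0edgeCoord (s + 2) e u = (k, t') →
      epnt s e u = ⟨embC (s + 2) (a, t), ⟨(a, t), rfl⟩⟩ := by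
    intro e u h
    rw [epnt, h]
    exact Subtype.ext h1
  have h3 : t' ≤ 1 / 2 → 2 * t' ∈ Icc (0 : ℝ) 1 := fun h => ⟨by linarith [ht.1], by linarith⟩
  have h4 : 1 / 2 < t' → 2 * t' - 1 ∈ Icc (0 : ℝ) 1 := fun h => ⟨by linarith, by linarith [ht.2]⟩
  rcases (show k < s ∨ k = s ∨ k = s + 1 by omega) with h | rfl | rfl
  · exact ⟨k, t', by omega, ht, h2 _ _ (by simp [X0edgeCoord, h])⟩
  · rcases le_or_gt t' (1 / 2) with h | h
    · exact ⟨k, _, by omega, h3 h, h2 _ _ (by simp [X0edgeCoord])⟩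
    · exact ⟨k + 1, _, by omega, h4 h, h2 _ _ (by simp [X0edgeCoord])⟩
  · rcases le_or_gt t' (1 / 2) with h | h
    · exact ⟨s + 2, _, by omega, h3 h, h2 _ _ (by simp [X0edgeCoord])⟩
    · exact ⟨s + 3, _, by omega, h4 h, h2 _ _ (by simp [X0edgeCoord])⟩

lemma good_id : Good (s := s) id where
  cover z := by
    obtain ⟨e, t, he, ht, h⟩ := exists_epnt z
    exact ⟨e, _, t, lift_id he, ht, h⟩
  conn Q hQ := by
    have h0 : ∀ e, e < s + 4 → (Q (epnt s e 0) ↔ Q (epnt s e 1)) := fun e he =>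
      hQ _ _ (lift_id he)
    have h1 : ∀ i, 1 ≤ i → i ≤ s + 2 → (Q (vpt (s + 2) 0) ↔ Q (vpt (s + 2) i)) := by
      intro i h1 h2
      rcases (show i ≤ s + 1 ∨ i = s + 2 by omega) with h | rfl
      · obtain ⟨j, j', -, -, -, h3, h4, h5⟩ := epnt_ends (s := s) (e := i - 1) (by omega)
        have := h0 (i - 1) (by omega)
        rwa [h3, h4, show j = 0 by omega, show j' = i by omega] at this
      · obtain ⟨j, j', -, -, -, h3, h4, h5⟩ := epnt_ends (s := s) (e := s + 2) (by omega)
        have := h0 (s + 2) (by omega)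
        rwa [h3, h4, show j = 0 by omega, show j' = s + 2 by omega] at this
    have h2 : ∀ i, i ≤ s + 4 → (Q (vpt (s + 2) 0) ↔ Q (vpt (s + 2) i)) := by
      intro i hi
      rcases (show i = 0 ∨ (1 ≤ i ∧ i ≤ s + 2) ∨ i = s + 3 ∨ i = s + 4 by omega) with
        rfl | h | rfl | rfl
      · rfl
      · exact h1 i h.1 h.2
      · obtain ⟨j, j', -, -, -, h3, h4, h5⟩ := epnt_ends (s := s) (e := s + 1) (by omega)
        have := h0 (s + 1) (by omega)
        rw [h3, h4, show j = s + 1 by omega, show j' = s + 3 by omega] at this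
        exact (h1 _ (by omega) (by omega)).trans this
      · obtain ⟨j, j', -, -, -, h3, h4, h5⟩ := epnt_ends (s := s) (e := s + 3) (by omega)
        have := h0 (s + 3) (by omega)
        rw [h3, h4, show j = s + 2 by omega, show j' = s + 4 by omega] at this
        exact (h1 _ (by omega) (by omega)).trans this
    rintro z z' ⟨i, hi, rfl⟩ ⟨i', hi', rfl⟩ hz
    exact (h2 i' hi').1 ((h2 i hi).2 hz)

lemma Lift.isVert_zero {h : Sspace (s + 2) → Sspace (s + 2)} {e : ℕ} {γ : ℝ → Sspace (s + 2)}
    (hγ : Lift h e γ) : IsVert (h (γ 0)) := by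
  obtain ⟨i, i', hi, -, -, h1, -⟩ := epnt_ends hγ.lt
  exact ⟨i, hi, (hγ.eq 0 (by simp)).trans h1⟩

lemma Lift.isVert_one {h : Sspace (s + 2) → Sspace (s + 2)} {e : ℕ} {γ : ℝ → Sspace (s + 2)}
    (hγ : Lift h e γ) : IsVert (h (γ 1)) := by
  obtain ⟨i, i', -, hi, -, -, h1, -⟩ := epnt_ends hγ.lt
  exact ⟨i', hi, (hγ.eq 1 (by simp)).trans h1⟩

lemma iff_of_chain {P : ℕ → Prop} {N : ℕ} (h : ∀ j < N, (P j ↔ P (j + 1))) :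
    ∀ j ≤ N, (P 0 ↔ P j) := by
  intro j hj
  induction j with
  | zero => rfl
  | succ j ih => exact (ih (by omega)).trans (h j hj)

lemma Good.comp (hs : 1 ≤ s) {h : Sspace (s + 2) → Sspace (s + 2)} (H : Good h) :
    Good (fS (s + 2) ∘ h) where
  cover z := by
    obtain ⟨e, γ, t, hγ, ht, rfl⟩ := H.cover z
    obtain ⟨N, ℓ, hk⟩ := exists_edgeKind hs hγ.lt
    obtain ⟨j, u, hj, hu, rfl⟩ := exists_div hk.pos ht
    obtain ⟨e', h' | h'⟩ := hγ.piece hs hk hj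
    · exact ⟨e', _, u, h', hu, rfl⟩
    · exact ⟨e', _, 1 - u, h', ⟨by linarith [hu.2], by linarith [hu.1]⟩, by simp⟩
  conn Q hQ z z' hz hz' := by
    have hstart : ∀ e γ N ℓ, Lift h e γ → EdgeKind s e N ℓ → ∀ j ≤ N,
        (Q (γ 0) ↔ Q (γ (j / N))) := by
      intro e γ N ℓ hγ hk j hj
      have := iff_of_chain (P := fun j : ℕ => Q (γ (j / N))) (N := N) (fun j hj =>
        hγ.rel hs hk (R := fun z z' => Q z ↔ Q z') (fun _ _ => Iff.symm) hQ hj) j hj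
      simpa using this
    have hQ' : ∀ e γ, Lift h e γ → (Q (γ 0) ↔ Q (γ 1)) := by
      intro e γ hγ
      obtain ⟨N, ℓ, hk⟩ := exists_edgeKind hs hγ.lt
      have hN : (N : ℝ) ≠ 0 := by have := hk.pos; positivity
      simpa [hN] using hstart e γ N ℓ hγ hk N le_rfl
    have hver : ∀ z, IsVert (fS (s + 2) (h z)) → ∃ w, IsVert (h w) ∧ (Q w ↔ Q z) := by
      intro z hz
      obtain ⟨e, γ, t, hγ, ht, rfl⟩ := H.cover z
      obtain ⟨N, ℓ, hk⟩ := exists_edgeKind hs hγ.lt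
      obtain ⟨j, hj, rfl⟩ := hγ.exists_index hs hk ht hz
      exact ⟨γ 0, hγ.isVert_zero, hstart e γ N ℓ hγ hk j hj⟩
    obtain ⟨w, hw, h1⟩ := hver z hz
    obtain ⟨w', hw', h2⟩ := hver z' hz'
    exact fun hq => h2.1 (H.conn Q hQ' w w' hw hw' (h1.2 hq))

lemma EdgeKind.edge {V K : Type*} {loc : V → Loc s} {arm : V → K} {dep : V → ℕ} {e N : ℕ}
    {ℓ : ℕ → Loc s} (h : EdgeKind s e N ℓ) {τ : ℕ → V} (hτ : ∀ j ≤ N, loc (τ j) = ℓ j)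
    (hc : ∀ j < N, Consec arm dep (τ j) (τ (j + 1))) :
    (∀ j < N, Edge loc arm dep (τ j) (τ (j + 1))) ∧
      IsSystem.CoarseEdge loc arm dep (τ 0) (τ N) := by
  have hw : ∀ (x : Option (Fin s)) j, 1 ≤ j → wloc x j = Loc.pt x j := fun x j hj =>
    if_neg (by omega)
  cases h with
  | whole x hx =>
    have hT : Tr loc arm dep x τ := ⟨(hτ 0 (by omega)).trans rfl,
      fun j h1 h2 => (hτ j (by omega)).trans (hw x j h1), fun j hj => hc j (by omega)⟩
    have h1 := hT.pt _ (by omega) le_rfl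
    have h2 := (hτ _ le_rfl).trans (hw x _ (by omega))
    have h3 := hc _ (Nat.lt_succ_self (2 * size s x + 1))
    refine ⟨fun j hj => ?_, .whole (fun h => (full_iff x).1 h hx) hT h2 h3⟩
    rcases (show j < 2 * size s x + 1 ∨ j = 2 * size s x + 1 by omega) with hj | rfl
    · exact .tr hT hj
    · exact .tip h1 h2 h3
  | full x hx =>
    have hT : Tr loc arm dep x τ := ⟨(hτ 0 (by omega)).trans rfl,
      fun j h1 h2 => (hτ j (by omega)).trans (hw x j h1), fun j hj => hc j (by omega)⟩
    have hF := (full_iff x).2 hx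
    exact ⟨fun j hj => .tr hT hj, .full hF hT⟩
  | tip x hx =>
    have hF := (full_iff x).2 hx
    have h0 := hτ 0 (by omega)
    have h1 := hτ 1 le_rfl
    have h2 := hc 0 one_pos
    refine ⟨fun j hj => ?_, .tip hF h0 h1 h2⟩
    obtain rfl : j = 0 := by omega
    exact .tip h0 h1 h2
  | short =>
    have h0 : loc (τ 0) = Loc.O := hτ 0 (by omega)
    have h1 : loc (τ 1) = Loc.p := hτ 1 (by omega)
    have h2 : loc (τ 2) = Loc.q := hτ 2 (by omega)
    refine ⟨fun j hj => ?_, .short h0 h1 h2 (hc 0 (by omega)) (hc 1 (by omega))⟩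
    rcases (show j = 0 ∨ j = 1 by omega) with rfl | rfl
    · exact .op h0 h1 (hc 0 (by omega))
    · exact .pq h1 h2 (hc 1 (by omega))

lemma EdgeKind.coarse {e N : ℕ} {ℓ : ℕ → Loc s} (h : EdgeKind s e N ℓ) :
    IsSystem.Coarse (ℓ 0) ∧ IsSystem.Coarse (ℓ N) := by
  have hw : ∀ (x : Option (Fin s)) j, 1 ≤ j → wloc x j = Loc.pt x j := fun x j hj =>
    if_neg (by omega)
  cases h with
  | whole x hx => exact ⟨Or.inl rfl, Or.inr (Or.inr (Or.inl ⟨x, hw x _ (by omega)⟩))⟩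
  | full x hx =>
    exact ⟨Or.inl rfl, Or.inr (Or.inr (Or.inr ⟨x, (full_iff x).2 hx, hw x _ (by omega)⟩))⟩
  | tip x hx =>
    exact ⟨Or.inr (Or.inr (Or.inr ⟨x, (full_iff x).2 hx, rfl⟩)),
      Or.inr (Or.inr (Or.inl ⟨x, rfl⟩))⟩
  | short => exact ⟨Or.inl rfl, Or.inr (Or.inl rfl)⟩

/-- The vertices of the `h`-preimage of `X_0` are assigned vertices of a simple od (given by arm
and depth), compatibly with edges and with `h`. -/
structure Factors {K : Type*} (h : Sspace (s + 2) → Sspace (s + 2)) (arm : Sspace (s + 2) → K)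
    (dep : Sspace (s + 2) → ℕ) : Prop where
  consec : ∀ e γ, Lift h e γ → Consec arm dep (γ 0) (γ 1)
  coh : ∀ z z', IsVert (h z) → IsVert (h z') → PosEq arm dep z z' → h z = h z'
  zero : ∀ z, IsVert (h z) → dep z = 0 → h z = vpt (s + 2) 0

/-- The points sent by `h` to a vertex of `X_1`. -/
abbrev Fine (h : Sspace (s + 2) → Sspace (s + 2)) : Type :=
  {z : Sspace (s + 2) // ∃ l : Loc s, Valid l ∧ h z = Pt l}

namespace Fine

variable {h : Sspace (s + 2) → Sspace (s + 2)}

/-- The location of the image of a point. -/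
noncomputable def loc (z : Fine h) : Loc s := z.2.choose

lemma loc_valid (z : Fine h) : Valid z.loc := z.2.choose_spec.1

lemma eq_loc (z : Fine h) : h z.1 = Pt z.loc := z.2.choose_spec.2

lemma loc_eq (hs : 1 ≤ s) {z : Fine h} {l : Loc s} (hl : Valid l) (hz : h z.1 = Pt l) :
    z.loc = l :=
  Pt_inj hs z.loc_valid hl (z.eq_loc.symm.trans hz)

lemma fS_eq (hs : 1 ≤ s) (z : Fine h) : fS (s + 2) (h z.1) = vpt (s + 2) (label z.loc) := by
  obtain ⟨e, N, ℓ, j, hk, hj, hl⟩ := z.loc_valid.exists_edgeKind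
  rw [z.eq_loc, ← hl, hk.fS_vertex hs hj]

lemma isVert (hs : 1 ≤ s) (z : Fine h) : IsVert (fS (s + 2) (h z.1)) :=
  ⟨_, label_le _, z.fS_eq hs⟩

end Fine

lemma Lift.exists_fine (hs : 1 ≤ s) {h : Sspace (s + 2) → Sspace (s + 2)} {e N : ℕ}
    {γ : ℝ → Sspace (s + 2)} {ℓ : ℕ → Loc s} (hγ : Lift h e γ) (hk : EdgeKind s e N ℓ) :
    ∃ τ : ℕ → Fine h, ∀ j ≤ N, (τ j).1 = γ (j / N) ∧ (τ j).loc = ℓ j := by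
  have h1 : ∀ j ≤ N, Valid (ℓ j) ∧ h (γ (j / N)) = Pt (ℓ j) := by
    intro j hj
    refine ⟨hk.valid hj, ?_⟩
    rw [← hk.epnt_eq hs hj]
    exact hγ.eq _ ⟨by positivity, div_le_one_of_le₀ (by exact_mod_cast hj) (by positivity)⟩
  refine ⟨fun j => ⟨γ ((min j N : ℕ) / N), _, h1 _ (min_le_right _ _)⟩, fun j hj => ?_⟩
  have : γ ((min j N : ℕ) / N) = γ (j / N) := by rw [min_eq_left hj]
  refine ⟨this, Fine.loc_eq hs (hk.valid hj) (Eq.trans ?_ (h1 j hj).2)⟩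
  exact congrArg h this

/-- A vertex over `X_0` lies at a coarse location. -/
lemma Good.exists_coarse (hs : 1 ≤ s) {h : Sspace (s + 2) → Sspace (s + 2)} (H : Good h)
    {z : Sspace (s + 2)} (hz : IsVert (h z)) :
    ∃ w : Fine h, w.1 = z ∧ IsSystem.Coarse w.loc := by
  obtain ⟨e, γ, t, hγ, ht, rfl⟩ := H.cover z
  obtain ⟨N, ℓ, hk⟩ := exists_edgeKind hs hγ.lt
  obtain ⟨τ, hτ⟩ := hγ.exists_fine hs hk
  have hN : (N : ℝ) ≠ 0 := by have := hk.pos; positivity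
  obtain ⟨h0, h1⟩ := hk.coarse
  rcases hγ.eq_zero_or_one ht hz with rfl | rfl
  · exact ⟨τ 0, by simpa using (hτ 0 (by omega)).1, by rwa [(hτ 0 (by omega)).2]⟩
  · exact ⟨τ N, by simpa [hN] using (hτ N le_rfl).1, by rwa [(hτ N le_rfl).2]⟩

section Step

variable {K : Type*} {h : Sspace (s + 2) → Sspace (s + 2)} {arm : Sspace (s + 2) → K}
  {dep : Sspace (s + 2) → ℕ}

lemma Factors.exists_chain (hs : 1 ≤ s) (F : Factors (fS (s + 2) ∘ h) arm dep) {e N : ℕ}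
    {γ : ℝ → Sspace (s + 2)} {ℓ : ℕ → Loc s} (hγ : Lift h e γ) (hk : EdgeKind s e N ℓ) :
    ∃ τ : ℕ → Fine h, (∀ j ≤ N, (τ j).1 = γ (j / N) ∧ (τ j).loc = ℓ j) ∧
      (∀ j < N, Edge Fine.loc (fun w : Fine h => arm w) (fun w => dep w) (τ j) (τ (j + 1))) ∧
      IsSystem.CoarseEdge Fine.loc (fun w : Fine h => arm w) (fun w => dep w) (τ 0) (τ N) := by
  obtain ⟨τ, hτ⟩ := hγ.exists_fine hs hk
  refine ⟨τ, hτ, hk.edge (fun j hj => (hτ j hj).2) fun j hj => ?_⟩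
  have := hγ.rel hs hk (R := Consec arm dep) (fun _ _ => Consec.symm) F.consec hj
  rwa [← (hτ j hj.le).1, ← (hτ (j + 1) hj).1] at this

lemma Factors.isSystem (hs : 1 ≤ s) (F : Factors (fS (s + 2) ∘ h) arm dep) (H : Good h) :
    IsSystem (Fine.loc (h := h)) (fun w => arm w) (fun w => dep w) where
  coh w w' hp := vpt_inj (label_le _) (label_le _) <| by
    rw [← w.fS_eq hs, ← w'.fS_eq hs]
    exact F.coh _ _ (w.isVert hs) (w'.isVert hs) hp
  zero w hw := vpt_inj (label_le _) (by omega) <| by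
    rw [← w.fS_eq hs]
    exact F.zero _ (w.isVert hs) hw
  conn P hP w w' hw := by
    have hchain : ∀ e N γ ℓ, Lift h e γ → EdgeKind s e N ℓ →
        ∃ τ : ℕ → Fine h, ∀ j ≤ N, (τ j).1 = γ (j / N) ∧ (P (τ 0) ↔ P (τ j)) := by
      intro e N γ ℓ hγ hk
      obtain ⟨τ, hτ, he, -⟩ := F.exists_chain hs hγ hk
      exact ⟨τ, fun j hj => ⟨(hτ j hj).1,
        iff_of_chain (P := fun j => P (τ j)) (fun j hj => hP _ _ (he j hj)) j hj⟩⟩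
    have hstart : ∀ w : Fine h, ∃ w' : Fine h, IsVert (h w'.1) ∧ (P w' ↔ P w) := by
      intro w
      obtain ⟨e, γ, t, hγ, ht, hw⟩ := H.cover w.1
      obtain ⟨N, ℓ, hk⟩ := exists_edgeKind hs hγ.lt
      obtain ⟨τ, hτ⟩ := hchain e N γ ℓ hγ hk
      obtain ⟨j, hj, rfl⟩ := hγ.exists_index hs hk ht (by rw [hw]; exact w.isVert hs)
      obtain rfl : τ j = w := Subtype.ext ((hτ j hj).1.trans hw)
      refine ⟨τ 0, ?_, (hτ j hj).2⟩
      have := (hτ 0 (by omega)).1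
      rw [Nat.cast_zero, zero_div] at this
      rw [this]
      exact hγ.isVert_zero
    obtain ⟨v, hv, h1⟩ := hstart w
    obtain ⟨v', hv', h2⟩ := hstart w'
    have hQ := H.conn (fun z => ∃ w : Fine h, w.1 = z ∧ P w) (fun e γ hγ => by
      obtain ⟨N, ℓ, hk⟩ := exists_edgeKind hs hγ.lt
      obtain ⟨τ, hτ⟩ := hchain e N γ ℓ hγ hk
      have hN : (N : ℝ) ≠ 0 := by have := hk.pos; positivity
      have h0 : (τ 0).1 = γ 0 := by simpa using (hτ 0 (by omega)).1
      have h1 : (τ N).1 = γ 1 := by simpa [hN] using (hτ N le_rfl).1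
      rw [← h0, ← h1]
      constructor
      · rintro ⟨w, hw, hP⟩
        obtain rfl := Subtype.ext hw
        exact ⟨_, rfl, (hτ N le_rfl).2.1 hP⟩
      · rintro ⟨w, hw, hP⟩
        obtain rfl := Subtype.ext hw
        exact ⟨_, rfl, (hτ N le_rfl).2.2 hP⟩) v.1 v'.1 hv hv' ⟨v, rfl, h1.2 hw⟩
    obtain ⟨u, hu, hP⟩ := hQ
    obtain rfl := Subtype.ext hu
    exact h2.1 hP

open Classical in
/-- A factorization of `f ∘ h` through a simple od with fewer arms than `S` yields one of `h`. -/
lemma Factors.of_comp [Fintype K] (hK : Fintype.card K ≤ s + 1) (hs : 1 ≤ s)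
    (F : Factors (fS (s + 2) ∘ h) arm dep) (H : Good h) : ∃ dep', Factors h arm dep' := by
  have S := F.isSystem hs H
  set r : Fine h → ℕ :=
    IsSystem.rank Fine.loc (fun w : Fine h => arm w) (fun w : Fine h => dep w) with hr
  obtain ⟨dep', hd⟩ : ∃ dep' : Sspace (s + 2) → ℕ, ∀ w : Fine h, dep' w = r w :=
    ⟨fun z => if hz : _ then r ⟨z, hz⟩ else 0, fun w => dif_pos w.2⟩
  refine ⟨dep', fun e γ hγ => ?_, fun z z' hz hz' hp => ?_, fun z hz h0 => ?_⟩
  · obtain ⟨N, ℓ, hk⟩ := exists_edgeKind hs hγ.lt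
    obtain ⟨τ, hτ, -, hc⟩ := F.exists_chain hs hγ hk
    have hN : (N : ℝ) ≠ 0 := by have := hk.pos; positivity
    have h0 : (τ 0).1 = γ 0 := by simpa using (hτ 0 (by omega)).1
    have h1 : (τ N).1 = γ 1 := by simpa [hN] using (hτ N le_rfl).1
    have := IsSystem.consec_rank S hK (by rw [(hτ 0 (by omega)).2]; exact hk.coarse.1)
      (by rw [(hτ N le_rfl).2]; exact hk.coarse.2) hc
    rw [← h0, ← h1]
    simpa only [Consec, hd] using this
  · obtain ⟨w, rfl, hw⟩ := H.exists_coarse hs hz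
    obtain ⟨w', rfl, hw'⟩ := H.exists_coarse hs hz'
    rw [w.eq_loc, w'.eq_loc]
    refine congrArg Pt (IsSystem.loc_eq_of_rank_posEq S hK hw hw' ?_)
    simpa only [PosEq, hd] using hp
  · obtain ⟨w, rfl, hw⟩ := H.exists_coarse hs hz
    rw [w.eq_loc, IsSystem.loc_eq_of_rank_zero S hw ((hd w).symm.trans h0)]
    rfl

/-- The identity does not factor through a simple od with fewer arms than `S`. -/
lemma Factors.not_id [Fintype K] (hK : Fintype.card K ≤ s + 1) (hs : 1 ≤ s)
    (F : Factors (s := s) id arm dep) : False := by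
  have hv : ∀ i, i ≤ s + 4 → IsVert (id (vpt (s + 2) i)) := fun i hi => ⟨i, hi, rfl⟩
  have hc : ∀ i : Fin (s + 2), Consec arm dep (vpt (s + 2) 0) (vpt (s + 2) (i + 1)) := by
    intro ⟨i, hi⟩
    rcases (show i ≤ s ∨ i = s + 1 by omega) with h | rfl
    · obtain ⟨j, j', -, -, -, h3, h4, h5⟩ := epnt_ends (s := s) (e := i) (by omega)
      have := F.consec _ _ (lift_id (s := s) (e := i) (by omega))
      rwa [h3, h4, show j = 0 by omega, show j' = i + 1 by omega] at this
    · obtain ⟨j, j', -, -, -, h3, h4, h5⟩ := epnt_ends (s := s) (e := s + 2) (by omega)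
      have := F.consec _ _ (lift_id (s := s) (e := s + 2) (by omega))
      rwa [h3, h4, show j = 0 by omega, show j' = s + 2 by omega] at this
  have hne : ∀ i j : Fin (s + 2), PosEq arm dep (vpt (s + 2) (i + 1)) (vpt (s + 2) (j + 1)) →
      i = j := fun i j h => by
    have := vpt_inj (by omega) (by omega)
      (F.coh _ _ (hv (i + 1) (by omega)) (hv (j + 1) (by omega)) h)
    exact Fin.ext (by omega)
  by_cases h0 : dep (vpt (s + 2) 0) = 0
  · have hinj : Function.Injective fun i : Fin (s + 2) => arm (vpt (s + 2) (i + 1)) := by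
      intro i j hij
      refine hne i j ⟨?_, Or.inr hij⟩
      rcases hc i with ⟨h1, -⟩ | ⟨h1, -⟩ <;> rcases hc j with ⟨h2, -⟩ | ⟨h2, -⟩ <;> omega
    have := Fintype.card_le_of_injective _ hinj
    rw [Fintype.card_fin] at this
    omega
  · have key : ∀ i j : Fin (s + 2),
        (dep (vpt (s + 2) (i + 1)) = dep (vpt (s + 2) (j + 1))) → i = j := by
      intro i j hij
      refine hne i j ⟨hij, ?_⟩
      rcases hc i with ⟨h1, h3⟩ | ⟨h1, h3⟩ <;> rcases hc j with ⟨h2, h4⟩ | ⟨h2, h4⟩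
      · exact Or.inr ((h3.resolve_left h0).symm.trans (h4.resolve_left h0))
      · omega
      · omega
      · rcases h3 with h3 | h3
        · exact Or.inl h3
        · rcases h4 with h4 | h4
          · exact Or.inl (hij.trans h4)
          · exact Or.inr (h3.symm.trans h4)
    have hinj : Function.Injective fun i : Fin (s + 2) =>
        decide (dep (vpt (s + 2) (i + 1)) = dep (vpt (s + 2) 0) + 1) := by
      intro i j hij
      refine key i j ?_
      have := decide_eq_decide.1 hij
      rcases hc i with ⟨h1, -⟩ | ⟨h1, -⟩ <;> rcases hc j with ⟨h2, -⟩ | ⟨h2, -⟩ <;> omega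
    have := Fintype.card_le_of_injective _ hinj
    rw [Fintype.card_fin, Fintype.card_bool] at this
    omega

end Step

lemma good_iterate (hs : 1 ≤ s) (m : ℕ) : Good (s := s) (fS (s + 2))^[m] := by
  induction m with
  | zero => exact good_id
  | succ m ih => rw [Function.iterate_succ']; exact ih.comp hs

lemma not_factors_iterate {K : Type*} [Fintype K] (hK : Fintype.card K ≤ s + 1) (hs : 1 ≤ s)
    {arm : Sspace (s + 2) → K} (m : ℕ) :
    ∀ dep, ¬ Factors (s := s) (fS (s + 2))^[m] arm dep := by
  induction m with
  | zero => exact fun dep F => F.not_id hK hs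
  | succ m ih =>
    intro dep F
    rw [Function.iterate_succ'] at F
    obtain ⟨dep', hF⟩ := F.of_comp hK hs (good_iterate hs m)
    exact ih dep' hF

/-- The arm and the depth of the vertices of a simple od. -/
lemma _root_.IsSimpleOdWith.exists_pos {T : Type*} [TopologicalSpace T] {Δ : GraphData T} {m : ℕ}
    {t₀ : T} {k : Fin m → ℕ} {t : Fin m → ℕ → T} (hΔ : IsSimpleOdWith Δ m t₀ k t) (hm : 1 ≤ m) :
    ∃ (arm : T → Fin m) (dep : T → ℕ), (∀ i j, j ≤ k i → dep (t i j) = j ∧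
      (j = 0 ∨ arm (t i j) = i)) ∧ ∀ x ∈ Δ.verts, ∃ i j, j ≤ k i ∧ x = t i j := by
  obtain ⟨-, -, h0, hv, hinj, hne, -⟩ := hΔ
  have key : ∀ x, ∃ p : Fin m × ℕ, ∀ i j, j ≤ k i → x = t i j → p.2 = j ∧ (j = 0 ∨ p.1 = i) := by
    intro x
    by_cases hx : ∃ i j, 1 ≤ j ∧ j ≤ k i ∧ x = t i j
    · obtain ⟨i, j, h1, h2, rfl⟩ := hx
      refine ⟨(i, j), fun i' j' hj' h => ?_⟩
      rcases Nat.eq_zero_or_pos j' with rfl | hpos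
      · exact absurd (h.trans (h0 i')) (hne i j h1 h2)
      · obtain ⟨rfl, rfl⟩ := hinj _ _ _ _ h1 h2 hpos hj' h
        exact ⟨rfl, Or.inr rfl⟩
    · refine ⟨(⟨0, hm⟩, 0), fun i j hj h => ?_⟩
      rcases Nat.eq_zero_or_pos j with rfl | hpos
      · exact ⟨rfl, Or.inl rfl⟩
      · exact absurd ⟨i, j, hpos, hj, h⟩ hx
  choose p hp using key
  refine ⟨fun x => (p x).1, fun x => (p x).2, fun i j hj => hp _ i j hj rfl, fun x hx => ?_⟩
  have hx' : x ∈ (Δ.verts : Set T) := hx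
  rw [hv] at hx'
  rcases hx' with rfl | ⟨i, j, -, hj, rfl⟩
  · exact ⟨⟨0, hm⟩, 0, Nat.zero_le _, (h0 _).symm⟩
  · exact ⟨i, j, hj, rfl⟩

/-- A path whose interior avoids the vertices of a graph, and whose distinct ends are vertices,
joins adjacent vertices. -/
lemma _root_.GraphData.IsGraph.adj_of_path {T : Type*} [TopologicalSpace T] [T2Space T]
    {Δ : GraphData T} (hΔ : Δ.IsGraph) {c : ℝ → T} (hc : ContinuousOn c (Icc 0 1))
    (hin : ∀ t ∈ Ioo (0 : ℝ) 1, c t ∉ Δ.verts) (h0 : c 0 ∈ Δ.verts) (h1 : c 1 ∈ Δ.verts)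
    (hne : c 0 ≠ c 1) : Δ.Adj (c 0) (c 1) := by
  obtain ⟨hcont, -, -, -, -, hopen, hcov, hmeet, -⟩ := hΔ
  have hcl : ∀ e, IsClosed (Δ.edge e '' Icc 0 1) := fun e =>
    (isCompact_Icc.image_of_continuousOn (hcont e)).isClosed
  have hmem : ∀ x, ∃ e, x ∈ Δ.edge e '' Icc 0 1 := fun x => by
    have : x ∈ ⋃ e, Δ.edge e '' Icc (0 : ℝ) 1 := hcov ▸ mem_univ x
    simpa only [mem_iUnion] using this
  obtain ⟨e, he⟩ := hmem (c (1 / 2))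
  have hsub : c '' Ioo 0 1 ⊆ Δ.edge e '' Icc 0 1 := by
    by_contra hnot
    obtain ⟨y, hy, hye⟩ := not_subset.1 hnot
    obtain ⟨e', he'⟩ := hmem y
    have hpre : IsPreconnected (c '' Ioo 0 1) :=
      isPreconnected_Ioo.image _ (hc.mono Ioo_subset_Icc_self)
    have hcl' : IsClosed (⋃ e' ∈ {e' | e' ≠ e}, Δ.edge e' '' Icc (0 : ℝ) 1) :=
      Set.Finite.isClosed_biUnion (toFinite _) fun e' _ => hcl e'
    obtain ⟨z, ⟨t, ht, rfl⟩, hz, hz'⟩ := isPreconnected_closed_iff.1 hpre _ _ (hcl e) hcl'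
      (fun x _ => by
        obtain ⟨e'', hx⟩ := hmem x
        by_cases h : e'' = e
        · exact Or.inl (h ▸ hx)
        · exact Or.inr (mem_biUnion (show e'' ∈ {e' | e' ≠ e} from h) hx))
      ⟨_, ⟨1 / 2, by norm_num, rfl⟩, he⟩
      ⟨y, hy, mem_biUnion (show e' ∈ {e' | e' ≠ e} from fun h => hye (h ▸ he')) he'⟩
    simp only [mem_iUnion] at hz'
    obtain ⟨e'', h, hz'⟩ := hz'
    exact hin t ht (hmeet e e'' (Ne.symm h) ⟨hz, hz'⟩)
  have hall : ∀ t ∈ Icc (0 : ℝ) 1, c t ∈ Δ.edge e '' Icc 0 1 := by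
    have hm : MapsTo c (closure (Ioo (0 : ℝ) 1)) (closure (Δ.edge e '' Icc 0 1)) :=
      MapsTo.closure_of_continuousOn (fun t ht => hsub ⟨t, ht, rfl⟩)
        (by rwa [closure_Ioo zero_ne_one])
    rw [closure_Ioo zero_ne_one, (hcl e).closure_eq] at hm
    exact hm
  have hend : ∀ x ∈ Δ.edge e '' Icc 0 1, x ∈ Δ.verts → x = Δ.edge e 0 ∨ x = Δ.edge e 1 := by
    rintro _ ⟨t, ht, rfl⟩ hx
    rcases ht.1.eq_or_lt with rfl | h
    · exact Or.inl rfl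
    rcases ht.2.eq_or_lt with rfl | h'
    · exact Or.inr rfl
    · exact absurd hx (hopen e t ⟨h, h'⟩)
  refine ⟨e, ?_⟩
  rcases hend _ (hall 0 (by simp)) h0 with h | h <;> rcases hend _ (hall 1 (by simp)) h1 with h' | h'
  · exact absurd (h.trans h'.symm) hne
  · rw [h, h']
  · rw [h, h', pair_comm]
  · exact absurd (h.trans h'.symm) hne

lemma isVert_iff {z : Sspace (s + 2)} : z ∈ (X0graph (s + 2)).verts ↔ IsVert z := by
  classical
  simp only [X0graph, IsVert, Finset.mem_image, Finset.mem_range]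
  constructor
  · rintro ⟨i, hi, rfl⟩
    exact ⟨i, by omega, rfl⟩
  · rintro ⟨i, hi, rfl⟩
    exact ⟨i, by omega, rfl⟩

lemma exists_factors {T : Type*} [TopologicalSpace T] [T2Space T] {Δ : GraphData T} {m : ℕ}
    {t₀ : T} {h : Sspace (s + 2) → Sspace (s + 2)} {α : Sspace (s + 2) → T}
    {β : T → Sspace (s + 2)} (hΔ : IsSimpleOdGraphData Δ m t₀) (hm : 1 ≤ m)
    (hα : Continuous α) (hαv : ∀ z, IsVert (h z) → α z ∈ Δ.verts)
    (hβ : ∀ x ∈ Δ.verts, IsVert (β x)) (hβα : ∀ z, β (α z) = h z) (h₀ : β t₀ = vpt (s + 2) 0) :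
    ∃ (arm : Sspace (s + 2) → Fin m) (dep : Sspace (s + 2) → ℕ), Factors h arm dep := by
  obtain ⟨k, t, hΔ⟩ := hΔ
  obtain ⟨arm, dep, hpos, hex⟩ := hΔ.exists_pos hm
  refine ⟨fun z => arm (α z), fun z => dep (α z), fun e γ hγ => ?_, fun z z' hz hz' hp => ?_,
    fun z hz hd => ?_⟩
  · have hne : α (γ 0) ≠ α (γ 1) := by
      intro heq
      obtain ⟨i, i', hi, hi', hii, h1, h2, -⟩ := epnt_ends hγ.lt
      have h3 := congrArg β heq
      rw [hβα, hβα, hγ.eq 0 (by simp), hγ.eq 1 (by simp), h1, h2] at h3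
      exact hii (vpt_inj hi hi' h3)
    have hadj := hΔ.1.adj_of_path (c := α ∘ γ) (hα.comp_continuousOn hγ.cont)
      (fun u hu hv => by
        have hb := hβ _ hv
        rw [Function.comp, hβα] at hb
        rcases hγ.eq_zero_or_one (Ioo_subset_Icc_self hu) hb with rfl | rfl
        · exact lt_irrefl _ hu.1
        · exact lt_irrefl _ hu.2) (hαv _ hγ.isVert_zero) (hαv _ hγ.isVert_one) hne
    obtain ⟨i, j, hj, hij⟩ := (hΔ.2.2.2.2.2.2 _ _).1 hadj
    have h1 := hpos i j (by omega)
    have h2 := hpos i (j + 1) hj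
    have h3 := h2.2.resolve_left (by omega)
    rcases pair_eq_pair_iff.1 hij with ⟨e1, e2⟩ | ⟨e1, e2⟩ <;>
      simp only [Function.comp] at e1 e2 <;> simp only [Consec, e1, e2]
    · exact Or.inl ⟨by omega, h1.2.imp h1.1.trans fun h => h.trans h3.symm⟩
    · exact Or.inr ⟨by omega, h1.2.imp h1.1.trans fun h => h3.trans h.symm⟩
  · obtain ⟨i, j, hj, h1⟩ := hex _ (hαv z hz)
    obtain ⟨i', j', hj', h2⟩ := hex _ (hαv z' hz')
    obtain ⟨h3, h4⟩ := hpos i j hj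
    obtain ⟨h5, h6⟩ := hpos i' j' hj'
    simp only [PosEq, h1, h2, h3, h5] at hp
    obtain ⟨rfl, hp⟩ := hp
    have hz0 : ∀ i, t i 0 = t₀ := hΔ.2.2.1
    rw [← hβα, ← hβα, h1, h2]
    rcases Nat.eq_zero_or_pos j with rfl | hpos
    · rw [hz0, hz0]
    · rw [h4.resolve_left hpos.ne', h6.resolve_left hpos.ne'] at hp
      rw [hp.resolve_left hpos.ne']
  · obtain ⟨i, j, hj, h1⟩ := hex _ (hαv z hz)
    rw [h1, (hpos i j hj).1] at hd
    subst hd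
    rw [← hβα, h1, hΔ.2.2.1, h₀]

end OdMap

/-- Let `n ≥ 3`, let `X_m` be the subdivision of `S` with vertex set
`f^{-m}(V(X_0))` and `Φ_0^m = f^m`.  For every `m ≥ 1` and `1 ≤ n' ≤ n - 1` there
are no simple-`n'`-od graph `T` with branch point `s₀` and simplicial maps
`α : X_m → T`, `β : T → X_0` with `β ∘ α = Φ_0^m` and `β s₀ = v_0`. -/
theorem statement13 (n : ℕ) (hn : 3 ≤ n) (m : ℕ) (hm : 1 ≤ m)
    (Γm : GraphData (Sspace n)) (hΓm : Γm.IsGraph)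
    (hverts : (Γm.verts : Set (Sspace n)) = (fS n)^[m] ⁻¹' ((X0graph n).verts : Set (Sspace n)))
    (n' : ℕ) (h1 : 1 ≤ n') (h2 : n' ≤ n - 1) :
    ¬ ∃ (T : Type) (_ : MetricSpace T) (Δ : GraphData T) (s₀ : T),
        IsSimpleOdGraphData Δ n' s₀ ∧
        ∃ (α : Sspace n → T) (β : T → Sspace n),
          IsSimplicialMap Γm Δ α ∧ IsSimplicialMap Δ (X0graph n) β ∧
          β ∘ α = (fS n)^[m] ∧ β s₀ = vpt n 0 := by
  rintro ⟨T, _, Δ, s₀, hΔ, α, β, hα, hβ, hβα, h₀⟩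
  obtain ⟨s, rfl⟩ : ∃ s, n = s + 2 := ⟨n - 2, by omega⟩
  obtain ⟨arm, dep, F⟩ := OdMap.exists_factors (h := (fS (s + 2))^[m]) hΔ h1 hα.1
    (fun z hz => hα.2.1 z <| by
      rw [← Finset.mem_coe, hverts]
      exact OdMap.isVert_iff.2 hz)
    (fun x hx => OdMap.isVert_iff.1 (hβ.2.1 x hx)) (congrFun hβα) h₀
  exact OdMap.not_factors_iterate (by rw [Fintype.card_fin]; omega) (by omega) m dep F
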